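/- Let (R,𝔪) be a complete Noetherian local ring. Then there exists a balanced big Cohen-Macaulay R-algebra, i.e., an R-algebra B with 𝔪B ≠ B such that every system of parameters of R is a regular sequence on B. -/

import Mathlib

/-- A list of elements of a Noetherian local ring is a system of parameters if it consists of
elements of the maximal ideal, has length equal to the Krull dimension, and the radical of the
ideal it generates is the maximal ideal. -/
def IsSOP (R : Type*) [CommRing R] [IsLocalRing R] (xs : List R) : Prop :=
  (∀ x ∈ xs, x ∈ IsLocalRing.maximalIdeal R) ∧
    (xs.length : WithBot ℕ∞) = ringKrullDim R ∧
    (Ideal.span {x | x ∈ xs}).radical = IsLocalRing.maximalIdeal R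

/-- An `R`-algebra `B` is a balanced big Cohen-Macaulay algebra for the local ring `(R, 𝔪)` if
`𝔪 B ≠ B` and every system of parameters of `R` is a regular sequence on `B`, i.e. each
parameter is a nonzerodivisor modulo the previous ones. -/
def IsBalancedBigCM (R B : Type*) [CommRing R] [IsLocalRing R] [CommRing B] [Algebra R B] :
    Prop :=
  (IsLocalRing.maximalIdeal R).map (algebraMap R B) ≠ ⊤ ∧
    ∀ xs : List R, IsSOP R xs → RingTheory.Sequence.IsWeaklyRegular B xs

/-- A local ring has mixed characteristic if it has characteristic zero and its residue field
has characteristic `p > 0`. -/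
def MixedCharLocal (R : Type*) [CommRing R] [IsLocalRing R] : Prop :=
  CharZero R ∧ ∃ p : ℕ, 0 < p ∧ CharP (IsLocalRing.ResidueField R) p

universe u

universe v

section BigCohenMacaulay

open Filter

/-- `l` is a weakly regular sequence on the quotient of `B` by the ideal `I`. -/
def RegMod {B : Type*} [CommRing B] : Ideal B → List B → Prop
  | _, [] => True
  | I, a :: l => (∀ u, a * u ∈ I → u ∈ I) ∧ RegMod (I ⊔ Ideal.span {a}) l

namespace RegMod

variable {B : Type*} [CommRing B] {I : Ideal B}

theorem append_iff {l₁ l₂ : List B} :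
    RegMod I (l₁ ++ l₂) ↔ RegMod I l₁ ∧ RegMod (I ⊔ Ideal.ofList l₁) l₂ := by
  induction l₁ generalizing I with
  | nil => simp [RegMod]
  | cons a l ih => simp [RegMod, ih, and_assoc, sup_assoc]

theorem iff_split {l : List B} : RegMod I l ↔
    ∀ l₁ a l₂, l = l₁ ++ a :: l₂ → ∀ u, a * u ∈ I ⊔ Ideal.ofList l₁ →
      u ∈ I ⊔ Ideal.ofList l₁ := by
  induction l generalizing I with
  | nil => simp [RegMod]
  | cons a l ih =>
    simp only [RegMod, ih]
    constructor
    · rintro ⟨h1, h2⟩ l₁ b l₂ h u hu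
      cases l₁ with
      | nil =>
        simp only [List.nil_append, List.cons.injEq] at h
        obtain ⟨rfl, rfl⟩ := h
        simpa using h1 u (by simpa using hu)
      | cons c l₁ =>
        simp only [List.cons_append, List.cons.injEq] at h
        obtain ⟨rfl, rfl⟩ := h
        have := h2 l₁ b l₂ rfl u (by simpa [sup_assoc] using hu)
        simpa [sup_assoc] using this
    · intro h
      refine ⟨fun u hu => by simpa using h [] a l rfl u (by simpa using hu), ?_⟩
      rintro l₁ b l₂ rfl u hu
      have := h (a :: l₁) b l₂ rfl u (by simpa [sup_assoc] using hu)
      simpa [sup_assoc] using this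

theorem of_top {l : List B} : RegMod (⊤ : Ideal B) l := by
  rw [iff_split]; simp

theorem nzd_swap {a b : B} (ha : ∀ u, a * u ∈ I → u ∈ I)
    (hb : ∀ u, b * u ∈ I ⊔ Ideal.span {a} → u ∈ I ⊔ Ideal.span {a}) :
    ∀ u, a * u ∈ I ⊔ Ideal.span {b} → u ∈ I ⊔ Ideal.span {b} := by
  intro u hu
  obtain ⟨i, hi, j, hj, h⟩ := Submodule.mem_sup.1 hu
  obtain ⟨v, rfl⟩ := Ideal.mem_span_singleton.1 hj
  have h1 : v ∈ I ⊔ Ideal.span {a} := hb v <| Submodule.mem_sup.2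
    ⟨-i, I.neg_mem hi, a * u, Ideal.mul_mem_right _ _ (Ideal.mem_span_singleton_self a), by
      rw [← h]; ring⟩
  obtain ⟨i', hi', k, hk, h2⟩ := Submodule.mem_sup.1 h1
  obtain ⟨w, rfl⟩ := Ideal.mem_span_singleton.1 hk
  have h3 : u - b * w ∈ I := ha _ <| by
    have : a * (u - b * w) = i + b * i' := by rw [mul_sub, ← h, ← h2]; ring
    rw [this]; exact I.add_mem hi (I.mul_mem_left _ hi')
  exact Submodule.mem_sup.2 ⟨_, h3, b * w,
    Ideal.mul_mem_right _ _ (Ideal.mem_span_singleton_self b), by ring⟩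

/-- The first element of a weakly regular sequence is regular modulo the remaining ones. -/
theorem head_nzd {a : B} {l : List B} (h : RegMod I (a :: l)) :
    ∀ u, a * u ∈ I ⊔ Ideal.ofList l → u ∈ I ⊔ Ideal.ofList l := by
  induction l generalizing I with
  | nil => simpa using h.1
  | cons b l ih =>
    have := ih (I := I ⊔ Ideal.span {b})
      ⟨nzd_swap h.1 h.2.1, by rw [sup_right_comm]; exact h.2.2⟩
    simpa [sup_assoc] using this

theorem pow_nzd {a : B} (ha : ∀ u, a * u ∈ I → u ∈ I) (n : ℕ) : ∀ u, a ^ n * u ∈ I → u ∈ I := by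
  induction n with
  | zero => simp
  | succ n ih => intro u hu; exact ha _ (ih _ (by rwa [← mul_assoc, ← pow_succ]))

theorem pow_base {a : B} {l : List B} (n : ℕ) (ha : ∀ u, a * u ∈ I → u ∈ I)
    (h : RegMod (I ⊔ Ideal.span {a}) l) : RegMod (I ⊔ Ideal.span {a ^ n}) l := by
  induction l generalizing I with
  | nil => trivial
  | cons b l ih =>
    refine ⟨?_, ?_⟩
    · clear ih
      induction n with
      | zero => simp
      | succ n ihn =>
        intro u hu
        obtain ⟨i, hi, j, hj, e⟩ := Submodule.mem_sup.1 hu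
        obtain ⟨v, rfl⟩ := Ideal.mem_span_singleton.1 hj
        have h1 : u ∈ I ⊔ Ideal.span {a ^ n} := ihn u <| Submodule.mem_sup.2
          ⟨i, hi, a ^ n * (a * v), Ideal.mul_mem_right _ _ (Ideal.mem_span_singleton_self _), by
            rw [← e]; ring⟩
        obtain ⟨i', hi', k, hk, e2⟩ := Submodule.mem_sup.1 h1
        obtain ⟨w, rfl⟩ := Ideal.mem_span_singleton.1 hk
        have h2 : b * w - a * v ∈ I := pow_nzd ha n _ <| by
          have : a ^ n * (b * w - a * v) = i - b * i' := by linear_combination b * e2 - e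
          rw [this]; exact I.sub_mem hi (I.mul_mem_left _ hi')
        have h3 : w ∈ I ⊔ Ideal.span {a} := h.1 w <| Submodule.mem_sup.2
          ⟨_, h2, a * v, Ideal.mul_mem_right _ _ (Ideal.mem_span_singleton_self _), by ring⟩
        obtain ⟨i3, hi3, k, hk, e3⟩ := Submodule.mem_sup.1 h3
        obtain ⟨w', rfl⟩ := Ideal.mem_span_singleton.1 hk
        refine Submodule.mem_sup.2 ⟨i' + a ^ n * i3, I.add_mem hi' (I.mul_mem_left _ hi3),
          a ^ (n + 1) * w', Ideal.mul_mem_right _ _ (Ideal.mem_span_singleton_self _), ?_⟩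
        rw [← e2, ← e3]; ring
    · rw [sup_right_comm]
      exact ih (nzd_swap ha h.1) (by rw [sup_right_comm]; exact h.2)

theorem map_pow {l : List B} (n : ℕ) (h : RegMod I l) : RegMod I (l.map (· ^ n)) := by
  induction l generalizing I with
  | nil => trivial
  | cons a l ih => exact ⟨pow_nzd h.1 n, ih (pow_base n h.1 h.2)⟩

theorem tail_pow {a : B} {l : List B} (n : ℕ) (h : RegMod I (a :: l)) :
    RegMod I (a :: l.map (· ^ n)) :=
  ⟨h.1, h.2.map_pow n⟩

theorem comap {C : Type*} [CommRing C] {f : B →+* C} (hf : Function.Surjective f) {K : Ideal C}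
    {l : List B} : RegMod (K.comap f) l ↔ RegMod K (l.map f) := by
  induction l generalizing K with
  | nil => simp [RegMod]
  | cons a l ih =>
    simp only [RegMod, List.map_cons, Ideal.mem_comap, map_mul, hf.forall]
    rw [← ih]
    have : (K ⊔ Ideal.span {f a}).comap f = K.comap f ⊔ Ideal.span {a} := by
      have := Ideal.comap_map_of_surjective f hf (K.comap f ⊔ Ideal.span {a})
      rw [Ideal.map_sup, Ideal.map_comap_of_surjective f hf, Ideal.map_span,
        Set.image_singleton] at this
      rw [this]
      exact sup_eq_left.2 (le_sup_of_le_left (Ideal.comap_mono bot_le))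
    rw [this]

theorem map_quotient {l : List B} :
    RegMod (⊥ : Ideal (B ⧸ I)) (l.map (Ideal.Quotient.mk I)) ↔ RegMod I l := by
  rw [← comap Ideal.Quotient.mk_surjective]
  have : (⊥ : Ideal (B ⧸ I)).comap (Ideal.Quotient.mk I) = I := Ideal.mk_ker
  rw [this]

theorem isWeaklyRegular {l : List B} (h : RegMod ⊥ l) :
    RingTheory.Sequence.IsWeaklyRegular B l := by
  refine ⟨fun i hi => ?_⟩
  rw [isSMulRegular_quotient_iff_mem_of_smul_mem]
  intro u hu
  rw [iff_split] at h
  have := h (l.take i) l[i] (l.drop (i + 1)) (by simp) u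
  simpa using this (by simpa using hu)

/-- The ideal generated by the `n`-th powers absorbs multiplication by an entry of the sequence. -/
theorem mul_mem_pow {l₁ l₂ : List B} {a u : B} {n : ℕ} (h : RegMod ⊥ (l₁ ++ a :: l₂))
    (hu : a * u ∈ Ideal.ofList l₁ ⊔ Ideal.ofList ((l₁ ++ a :: l₂).map (· ^ (n + 1)))) :
    u ∈ Ideal.ofList l₁ ⊔ Ideal.ofList ((l₁ ++ a :: l₂).map (· ^ n)) := by
  have h1 : RegMod (Ideal.ofList l₁) (a :: l₂) := by simpa using (append_iff.1 h).2
  have h2 := (h1.tail_pow (n + 1)).head_nzd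
  have h3 : Ideal.ofList l₁ ⊔ Ideal.ofList ((l₁ ++ a :: l₂).map (· ^ (n + 1))) ≤
      (Ideal.ofList l₁ ⊔ Ideal.ofList (l₂.map (· ^ (n + 1)))) ⊔ Ideal.span {a ^ (n + 1)} := by
    refine sup_le (le_sup_of_le_left le_sup_left) ?_
    rw [Ideal.ofList, Ideal.span_le]
    intro x hx
    simp only [List.map_append, List.map_cons, List.mem_append, List.mem_map, List.mem_cons,
      Set.mem_ofPred_eq] at hx
    rcases hx with ⟨y, hy, rfl⟩ | rfl | ⟨y, hy, rfl⟩
    · exact Ideal.mem_sup_left (Ideal.mem_sup_left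
        (Ideal.pow_mem_of_mem (Ideal.ofList l₁) (Ideal.subset_span hy) _ (Nat.succ_pos n)))
    · exact Ideal.mem_sup_right (Ideal.mem_span_singleton_self _)
    · exact Ideal.mem_sup_left (Ideal.mem_sup_right (Ideal.subset_span (List.mem_map.2 ⟨y, hy, rfl⟩)))
  obtain ⟨i, hi, j, hj, e⟩ := Submodule.mem_sup.1 (h3 hu)
  obtain ⟨v, rfl⟩ := Ideal.mem_span_singleton.1 hj
  have h4 := h2 (u - a ^ n * v) (by convert hi using 1; linear_combination -e)
  have h5 : Ideal.ofList (l₂.map (· ^ (n + 1))) ≤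
      Ideal.ofList ((l₁ ++ a :: l₂).map (· ^ n)) := by
    rw [Ideal.ofList, Ideal.span_le]
    intro x hx
    obtain ⟨y, hy, rfl⟩ := List.mem_map.1 hx
    rw [pow_succ]
    exact Ideal.mul_mem_right _ _ (Ideal.subset_span (by simp; tauto))
  have h6 : a ^ n * v ∈ Ideal.ofList ((l₁ ++ a :: l₂).map (· ^ n)) :=
    Ideal.mul_mem_right _ _ (Ideal.subset_span (by simp))
  have := Ideal.add_mem _ (sup_le_sup_left h5 _ h4) (Ideal.mem_sup_right h6)
  simpa using this

end RegMod

/-- The ideal of sequences converging to zero with respect to a filtration by ideals. -/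
def nullIdeal {B : Type*} [CommRing B] (J : ℕ → Ideal B) : Ideal (ℕ → B) where
  carrier := {u | ∀ n, ∀ᶠ m in atTop, u m ∈ J n}
  add_mem' ha hb n := by
    filter_upwards [ha n, hb n] with m h1 h2 using Ideal.add_mem _ h1 h2
  zero_mem' n := by simp
  smul_mem' c x hx n := by
    filter_upwards [hx n] with m h1 using Ideal.mul_mem_left _ _ h1

/-- Sequences modulo null sequences. -/
abbrev Tilde {B : Type*} [CommRing B] (J : ℕ → Ideal B) := (ℕ → B) ⧸ nullIdeal J

theorem mem_ofList_iff {B : Type*} [CommRing B] {l : List B} {u : B} :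
    u ∈ Ideal.ofList l ↔ ∃ c : Fin l.length → B, u = ∑ i, c i * l[i] := by
  have : {r | r ∈ l} = Set.range (fun i : Fin l.length => l[i]) := by
    ext x; simp [List.mem_iff_get]
  rw [Ideal.ofList, this, Ideal.mem_span_range_iff_exists_fun]
  simp only [eq_comm]

namespace Tilde

variable {B : Type*} [CommRing B] {J : ℕ → Ideal B}

theorem mem_ofList (hJ : Antitone J) (u : ℕ → B) (l : List (ℕ → B)) :
    Ideal.Quotient.mk (nullIdeal J) u ∈ Ideal.ofList (l.map (Ideal.Quotient.mk (nullIdeal J))) ↔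
      ∀ n, ∀ᶠ m in atTop, u m ∈ Ideal.ofList (l.map (fun a => a m)) ⊔ J n := by
  classical
  rw [← Ideal.map_ofList, Ideal.mem_quotient_iff_mem_sup]
  constructor
  · intro h n
    obtain ⟨v, hv, w, hw, rfl⟩ := Submodule.mem_sup.1 h
    filter_upwards [hw n] with m hm
    refine Ideal.add_mem _ (Ideal.mem_sup_left ?_) (Ideal.mem_sup_right hm)
    have := Ideal.mem_map_of_mem (Pi.evalRingHom (fun _ : ℕ => B) m) hv
    rwa [Ideal.map_ofList] at this
  · intro h
    set P : ℕ → ℕ → Prop := fun m n => u m ∈ Ideal.ofList (l.map (fun a => a m)) ⊔ J n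
    let g : ℕ → ℕ := fun m => Nat.findGreatest (P m) m
    have hg : ∀ n, 0 < n → ∀ᶠ m in atTop, n ≤ g m ∧ P m (g m) := by
      intro n hn
      filter_upwards [h n, eventually_ge_atTop n] with m h1 h2
      exact ⟨Nat.le_findGreatest h2 h1, Nat.findGreatest_spec h2 h1⟩
    have hc : ∀ m, ∃ c : Fin l.length → B, P m (g m) → u m - ∑ i, c i * l[i] m ∈ J (g m) := by
      intro m
      by_cases hP : P m (g m)
      · obtain ⟨v, hv, w, hw, e⟩ := Submodule.mem_sup.1 hP
        obtain ⟨c, hc⟩ := mem_ofList_iff.1 hv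
        refine ⟨fun i => c (i.cast (by simp)), fun _ => ?_⟩
        convert hw using 1
        rw [← e, hc, add_comm, add_sub_assoc, ← Fin.sum_congr' (fun i => c i * _) (List.length_map (fun a : ℕ → B => a m)).symm]
        simp
      · exact ⟨0, fun h => absurd h hP⟩
    choose c hc using hc
    refine Submodule.mem_sup.2 ⟨∑ i, (fun m => c m i) * l[i], mem_ofList_iff.2 ⟨_, rfl⟩,
      u - ∑ i, (fun m => c m i) * l[i], fun n => ?_, by ring⟩
    filter_upwards [hg (n + 1) n.succ_pos] with m hm
    have := hJ ((Nat.le_succ n).trans hm.1) (hc m hm.2)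
    simpa using this

end Tilde

/-- The filtration by the ideals generated by the powers of the elements of a list. -/
def powFilt {B : Type*} [CommRing B] (l : List B) (n : ℕ) : Ideal B := Ideal.ofList (l.map (· ^ n))

theorem powFilt_antitone {B : Type*} [CommRing B] (l : List B) : Antitone (powFilt l) := by
  intro m n h
  rw [powFilt, Ideal.ofList, Ideal.span_le]
  intro x hx
  obtain ⟨y, hy, rfl⟩ := List.mem_map.1 hx
  exact Ideal.mem_of_dvd _ (pow_dvd_pow y h) (Ideal.subset_span (List.mem_map.2 ⟨y, hy, rfl⟩))

theorem powFilt_le {B : Type*} [CommRing B] (l : List B) {n : ℕ} (hn : 0 < n) :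
    powFilt l n ≤ Ideal.ofList l := by
  rw [powFilt, Ideal.ofList, Ideal.span_le]
  intro x hx
  obtain ⟨y, hy, rfl⟩ := List.mem_map.1 hx
  exact Ideal.pow_mem_of_mem (Ideal.ofList l) (Ideal.subset_span hy) _ hn

/-- The constant sequences embed a ring in its ring of sequences modulo null sequences. -/
def Tilde.const {B : Type*} [CommRing B] (J : ℕ → Ideal B) : B →+* Tilde J :=
  (Ideal.Quotient.mk (nullIdeal J)).comp (Pi.constRingHom ℕ B)

namespace Tilde

variable {B : Type*} [CommRing B] {J : ℕ → Ideal B}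

theorem mem_ofList_const (hJ : Antitone J) (u : ℕ → B) (l : List B) :
    Ideal.Quotient.mk (nullIdeal J) u ∈ Ideal.ofList (l.map (const J)) ↔
      ∀ n, ∀ᶠ m in atTop, u m ∈ Ideal.ofList l ⊔ J n := by
  have := mem_ofList hJ u (l.map (Pi.constRingHom ℕ B))
  simpa [List.map_map, Function.comp_def, const] using this

theorem ofList_ne_top (hJ : Antitone J) {l : List B} (h : ∃ n, Ideal.ofList l ⊔ J n ≠ ⊤) :
    Ideal.ofList (l.map (const J)) ≠ ⊤ := by
  intro h1
  obtain ⟨n, hn⟩ := h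
  have := (mem_ofList_const hJ 1 l).1 (by rw [map_one, h1]; trivial) n
  obtain ⟨m, hm⟩ := this.exists
  exact hn ((Ideal.eq_top_iff_one _).2 hm)

theorem regMod {l : List B} (h : RegMod ⊥ l) : RegMod ⊥ (l.map (const (powFilt l))) := by
  rw [RegMod.iff_split]
  intro l₁ a l₂ hl u hu
  obtain ⟨l₁, l', rfl, rfl, hl'⟩ := List.map_eq_append_iff.1 hl
  obtain ⟨a, l₂, rfl, rfl, rfl⟩ := List.map_eq_cons_iff.1 hl'
  obtain ⟨u, rfl⟩ := Ideal.Quotient.mk_surjective u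
  rw [bot_sup_eq] at hu ⊢
  rw [mem_ofList_const (powFilt_antitone _)]
  intro n
  have : const (powFilt (l₁ ++ a :: l₂)) a * Ideal.Quotient.mk _ u =
    Ideal.Quotient.mk _ (fun m => a * u m) := rfl
  rw [this, mem_ofList_const (powFilt_antitone _)] at hu
  filter_upwards [hu (n + 1)] with m hm
  exact h.mul_mem_pow hm

/-- Finitely generated ideals are closed. -/
theorem mem_of_forall (hJ : Antitone J) (l : List B) (u : Tilde J) (p : ℕ → List B)
    (hp : ∀ n, Ideal.ofList (p n) ≤ J n)
    (h : ∀ n, u ∈ Ideal.ofList (l.map (const J)) ⊔ Ideal.ofList ((p n).map (const J))) :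
    u ∈ Ideal.ofList (l.map (const J)) := by
  obtain ⟨u, rfl⟩ := Ideal.Quotient.mk_surjective u
  rw [mem_ofList_const hJ]
  intro n
  have := h n
  rw [← Ideal.ofList_append, ← List.map_append, mem_ofList_const hJ] at this
  filter_upwards [this n] with m hm
  rw [Ideal.ofList_append] at hm
  exact (sup_le_sup_right (sup_le_sup_left (hp n) _) _).trans
    (sup_le le_rfl le_sup_right) hm

end Tilde

section Balanced

variable {R B : Type*} [CommRing R] [CommRing B] (φ : R →+* B) (𝔪 : Ideal R)

/-- Ideals extended from finitely many elements of the base are closed for the `a`-adic topology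
for all `a` in `𝔪`. -/
def SatHom : Prop := ∀ (as : List R), ∀ a ∈ 𝔪, ∀ u : B,
  (∀ n : ℕ, u ∈ Ideal.ofList (as.map φ) ⊔ Ideal.span {φ a ^ n}) → u ∈ Ideal.ofList (as.map φ)

variable {φ 𝔪}

theorem SatHom.swap (h : SatHom φ 𝔪) {pre : List R} {a b : R} {l : List B} (hb : a ∈ 𝔪)
    (hr : RegMod (Ideal.ofList (pre.map φ)) (φ a :: φ b :: l)) :
    RegMod (Ideal.ofList (pre.map φ)) (φ b :: φ a :: l) := by
  set I := Ideal.ofList (pre.map φ) with hI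
  refine ⟨?_, RegMod.nzd_swap hr.1 hr.2.1, by rw [sup_right_comm]; exact hr.2.2⟩
  have key : ∀ n : ℕ, ∀ u, φ b * u ∈ I → u ∈ I ⊔ Ideal.span {φ a ^ n} := by
    intro n
    induction n with
    | zero => simp
    | succ n ih =>
      intro u hu
      obtain ⟨i, hi, j, hj, e⟩ := Submodule.mem_sup.1 (hr.2.1 u (Ideal.mem_sup_left hu))
      obtain ⟨v, rfl⟩ := Ideal.mem_span_singleton.1 hj
      have h1 : φ b * v ∈ I := hr.1 _ <| by
        have : φ a * (φ b * v) = φ b * u - φ b * i := by rw [← e]; ring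
        rw [this]
        exact I.sub_mem hu (I.mul_mem_left _ hi)
      obtain ⟨i', hi', j', hj', e'⟩ := Submodule.mem_sup.1 (ih v h1)
      obtain ⟨w, rfl⟩ := Ideal.mem_span_singleton.1 hj'
      refine Submodule.mem_sup.2 ⟨i + φ a * i', I.add_mem hi (I.mul_mem_left _ hi'),
        φ a ^ (n + 1) * w, Ideal.mul_mem_right _ _ (Ideal.mem_span_singleton_self _), ?_⟩
      rw [← e, ← e']; ring
  exact fun u hu => h pre a hb u fun n => key n u hu

theorem SatHom.perm (h : SatHom φ 𝔪) {l l' : List R} (hp : l.Perm l') :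
    ∀ pre : List R, (∀ a ∈ l, a ∈ 𝔪) → RegMod (Ideal.ofList (pre.map φ)) (l.map φ) →
      RegMod (Ideal.ofList (pre.map φ)) (l'.map φ) := by
  induction hp with
  | nil => simp
  | @cons x l l' _ ih =>
    intro pre hm hr
    refine ⟨hr.1, ?_⟩
    have := ih (pre ++ [x]) (fun a ha => hm a (List.mem_cons_of_mem _ ha))
    simp only [List.map_append, List.map_cons, List.map_nil, Ideal.ofList_append,
      Ideal.ofList_singleton] at this
    exact this hr.2
  | swap x y l =>
    intro pre hm hr
    exact h.swap (hm _ (by simp)) hr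
  | trans h1 h2 ih1 ih2 =>
    intro pre hm hr
    exact ih2 pre (fun a ha => hm a (h1.mem_iff.2 ha)) (ih1 pre hm hr)

theorem RegMod.exchange {u : List R} {v w : R} (hr : RegMod ⊥ ((u ++ [v]).map φ))
    (hv : v ∈ (Ideal.ofList (u ++ [w])).radical) : RegMod ⊥ ((u ++ [w]).map φ) := by
  rw [List.map_append, RegMod.append_iff] at hr ⊢
  refine ⟨hr.1, fun y hy => ?_, trivial⟩
  set I := ⊥ ⊔ Ideal.ofList (u.map φ) with hI
  obtain ⟨N, hN⟩ := hv
  refine RegMod.pow_nzd hr.2.1 N y ?_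
  have h1 := Ideal.mem_map_of_mem φ hN
  rw [Ideal.map_ofList, List.map_append, Ideal.ofList_append] at h1
  obtain ⟨i, hi, j, hj, e⟩ := Submodule.mem_sup.1 h1
  obtain ⟨z, rfl⟩ := Ideal.mem_span_singleton.1 (by simpa [Ideal.ofList_singleton] using hj)
  rw [_root_.map_pow] at e
  rw [← e, add_mul]
  refine I.add_mem (I.mul_mem_right _ (by simpa [hI] using hi)) ?_
  rw [mul_right_comm]
  exact I.mul_mem_right _ hy

end Balanced

theorem exists_common_parameter {R : Type*} [CommRing R] [IsNoetherianRing R] [IsLocalRing R]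
    (S : Finset (Ideal R)) (hS : ∀ I ∈ S, ∃ v ∈ IsLocalRing.maximalIdeal R,
      (I ⊔ Ideal.span {v}).radical = IsLocalRing.maximalIdeal R) :
    ∃ z ∈ IsLocalRing.maximalIdeal R,
      ∀ I ∈ S, (I ⊔ Ideal.span {z}).radical = IsLocalRing.maximalIdeal R := by
  classical
  set m := IsLocalRing.maximalIdeal R
  have hfin : (⋃ I ∈ S, {P ∈ I.minimalPrimes | P ≠ m}).Finite :=
    S.finite_toSet.biUnion fun I _ =>
      (I.finite_minimalPrimes_of_isNoetherianRing R).subset (Set.sep_subset _ _)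
  obtain ⟨z, hz, hz'⟩ : ∃ z ∈ m, ∀ I ∈ S, ∀ P ∈ I.minimalPrimes, P ≠ m → z ∉ P := by
    by_contra! hcon
    have hsub : (m : Set R) ⊆ ⋃ P ∈ (hfin.toFinset : Set (Ideal R)), (P : Set R) := by
      intro z hz
      obtain ⟨I, hI, P, hP, hPm, hzP⟩ := hcon z hz
      simp only [Set.Finite.coe_toFinset, Set.mem_iUnion]
      exact ⟨P, ⟨I, hI, hP, hPm⟩, hzP⟩
    rw [Ideal.subset_union_prime (f := fun P : Ideal R => P) m m] at hsub
    · obtain ⟨P, hP, hmP⟩ := hsub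
      simp only [Set.Finite.mem_toFinset, Set.mem_iUnion] at hP
      obtain ⟨I, hI, hP, hPm⟩ := hP
      have := hP.1.1
      exact hPm ((IsLocalRing.le_maximalIdeal this.ne_top).antisymm hmP)
    · intro P hP _ _
      simp only [Set.Finite.mem_toFinset, Set.mem_iUnion] at hP
      obtain ⟨I, hI, hP, hPm⟩ := hP
      exact hP.1.1
  refine ⟨z, hz, fun I hI => ?_⟩
  obtain ⟨v, hv, hrad⟩ := hS I hI
  have hIm : I ≤ m := le_sup_left.trans (Ideal.le_radical.trans hrad.le)
  refine le_antisymm ?_ ?_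
  · rw [(IsLocalRing.maximalIdeal.isMaximal R).isPrime.radical_le_iff, sup_le_iff,
      Ideal.span_singleton_le_iff_mem]
    exact ⟨hIm, hz⟩
  · rw [Ideal.radical_eq_sInf]
    refine le_sInf ?_
    rintro P' ⟨hP', hprime⟩
    obtain ⟨P, hP, hPP'⟩ := Ideal.exists_minimalPrimes_le (le_sup_left.trans hP')
    by_cases hPm : P = m
    · exact hPm ▸ hPP'
    have hPp : P.IsPrime := hP.1.1
    have hlt : P < P' := lt_of_le_of_ne hPP' (by
      rintro rfl
      exact hz' I hI P hP hPm (hP' (Ideal.mem_sup_right (Ideal.mem_span_singleton_self z))))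
    by_contra hne
    have hlt2 : P' < m := lt_of_le_not_ge (IsLocalRing.le_maximalIdeal hprime.ne_top) hne
    have hmin : m ∈ (P ⊔ Ideal.span {v}).minimalPrimes := by
      refine ⟨⟨inferInstance, sup_le (hlt.le.trans hlt2.le)
        ((Ideal.span_singleton_le_iff_mem _).2 hv)⟩, fun Q hQ _ => ?_⟩
      rw [← hrad, hQ.1.radical_le_iff]
      exact (sup_le_sup_right hP.1.2 _).trans hQ.2
    have h1 := Ideal.map_height_le_one_of_mem_minimalPrimes hmin
    set f := Ideal.Quotient.mk P
    have hf : Function.Surjective f := Ideal.Quotient.mk_surjective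
    have hk : RingHom.ker f = P := Ideal.mk_ker
    have hcm : ∀ Q, P ≤ Q → (Q.map f).comap f = Q := fun Q hQ => by
      rw [Ideal.comap_map_of_surjective f hf, sup_eq_left]
      exact hk.le.trans hQ
    have : (P'.map f).IsPrime := Ideal.map_isPrime_of_surjective hf (hk.le.trans hPP')
    have : (m.map f).IsPrime := Ideal.map_isPrime_of_surjective hf (hk.le.trans (hPP'.trans hlt2.le))
    have l1 : (⊥ : Ideal (R ⧸ P)) < P'.map f := by
      rw [bot_lt_iff_ne_bot]
      intro h
      have := hcm P' hPP'
      rw [h] at this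
      exact hlt.ne (by rw [← this]; exact hk.symm)
    have l2 : P'.map f < m.map f := lt_of_le_of_ne (Ideal.map_mono hlt2.le) (by
      intro h
      exact hlt2.ne (by rw [← hcm P' hPP', h, hcm m (hPP'.trans hlt2.le)]))
    have : (⊥ : Ideal (R ⧸ P)).IsPrime := Ideal.isPrime_bot
    have e1 := Ideal.height_add_one_le_of_lt_of_isPrime l1
    have e2 := Ideal.height_add_one_le_of_lt_of_isPrime l2
    have e3 := (add_le_add_left e1 1).trans (e2.trans h1)
    revert e3
    generalize (⊥ : Ideal (R ⧸ P)).height = h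
    intro e3
    have : (1 + 1 : ℕ∞) ≤ 1 := le_trans (add_le_add_left le_add_self 1) e3
    exact absurd this (by norm_num)

theorem SatHom.connect {R B : Type*} [CommRing R] [IsNoetherianRing R] [IsLocalRing R]
    [CommRing B] {φ : R →+* B} (h : SatHom φ (IsLocalRing.maximalIdeal R)) (n : ℕ) :
    ∀ x y z : List R, x.length = n → y.length = n →
      (Ideal.ofList (x ++ z)).radical = IsLocalRing.maximalIdeal R →
      (Ideal.ofList (y ++ z)).radical = IsLocalRing.maximalIdeal R →
      RegMod ⊥ ((x ++ z).map φ) → RegMod ⊥ ((y ++ z).map φ) := by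
  classical
  set m := IsLocalRing.maximalIdeal R
  have hmem : ∀ l : List R, (Ideal.ofList l).radical = m → ∀ a ∈ l, a ∈ m := fun l hl a ha =>
    hl ▸ Ideal.le_radical (Ideal.subset_span ha)
  have hofperm : ∀ {l l' : List R}, l.Perm l' → Ideal.ofList l = Ideal.ofList l' :=
    fun hp => by simp [Ideal.ofList, hp.mem_iff]
  have perm : ∀ {l l' : List R}, l.Perm l' → (Ideal.ofList l).radical = m →
      RegMod ⊥ (l.map φ) → RegMod ⊥ (l'.map φ) := fun hp hl hr => by
    simpa using h.perm hp [] (hmem _ hl) (by simpa using hr)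
  induction n with
  | zero =>
    intro x y z hx hy _ _ hr
    rw [List.length_eq_zero_iff] at hx hy
    rw [hy]; rwa [hx] at hr
  | succ n ih =>
    intro x y z hx hy hxm hym hr
    obtain ⟨v, x, rfl⟩ := List.exists_cons_of_length_eq_add_one hx
    obtain ⟨w, y, rfl⟩ := List.exists_cons_of_length_eq_add_one hy
    have px : ∀ (v : R) x, (v :: x ++ z).Perm (x ++ z ++ [v]) := fun v x => by
      rw [List.cons_append]; exact List.perm_append_singleton _ _ |>.symm
    have py : ∀ (v : R) x, (x ++ v :: z).Perm (x ++ z ++ [v]) := fun v x => by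
      refine List.perm_middle.trans (List.perm_append_singleton _ _).symm
    have hrad : ∀ (v : R) x, (Ideal.ofList (x ++ z) ⊔ Ideal.span {v}) =
        Ideal.ofList (x ++ z ++ [v]) := fun v x => by
      rw [Ideal.ofList_append (x ++ z), Ideal.ofList_singleton]
    have hxm' : (Ideal.ofList (x ++ z ++ [v])).radical = m := by rw [← hofperm (px _ _), hxm]
    have hym' : (Ideal.ofList (y ++ z ++ [w])).radical = m := by rw [← hofperm (px _ _), hym]
    obtain ⟨t, ht, ht'⟩ := exists_common_parameter {Ideal.ofList (x ++ z), Ideal.ofList (y ++ z)} (by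
      simp only [Finset.mem_insert, Finset.mem_singleton, forall_eq_or_imp, forall_eq, hrad]
      exact ⟨⟨v, hmem _ hxm _ (by simp), hxm'⟩, ⟨w, hmem _ hym _ (by simp), hym'⟩⟩)
    simp only [Finset.mem_insert, Finset.mem_singleton, forall_eq_or_imp, forall_eq, hrad] at ht'
    obtain ⟨t1, t2⟩ := ht'
    have r1 := perm (px v x) hxm hr
    have r2 : RegMod ⊥ ((x ++ z ++ [t]).map φ) := r1.exchange (by
      rw [t1]; exact hmem _ hxm _ (by simp))
    have r3 := perm (py t x).symm t1 r2
    have r4 := ih x y (t :: z) (by simpa using hx) (by simpa using hy)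
      (by rw [hofperm (py _ _), t1]) (by rw [hofperm (py _ _), t2]) r3
    have r5 := perm (py t y) (by rw [hofperm (py _ _), t2]) r4
    have r6 : RegMod ⊥ ((y ++ z ++ [w]).map φ) := r5.exchange (by rw [hym']; exact ht)
    exact perm (px w y).symm hym' r6

/-- A single regular system of parameters on an algebra produces a balanced algebra. -/
theorem exists_balanced_of_regMod {R B : Type*} [CommRing R] [IsNoetherianRing R] [IsLocalRing R]
    [CommRing B] [Algebra R B] {xs : List R} (hxs : IsSOP R xs)
    (hr : RegMod ⊥ (xs.map (algebraMap R B)))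
    (hp : Ideal.ofList (xs.map (algebraMap R B)) ≠ ⊤) :
    IsBalancedBigCM R (Tilde (powFilt (xs.map (algebraMap R B)))) := by
  classical
  set l := xs.map (algebraMap R B)
  set J := powFilt l
  set m := IsLocalRing.maximalIdeal R
  have hφ : algebraMap R (Tilde J) = (Tilde.const J).comp (algebraMap R B) := rfl
  have hofl : ∀ as : List R, as.map (algebraMap R (Tilde J)) =
      (as.map (algebraMap R B)).map (Tilde.const J) := fun as => by
    rw [hφ, List.map_map, RingHom.coe_comp]
  have hpowle : ∀ n, ∃ N : ℕ, m ^ N ≤ powFilt xs n := by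
    intro n
    refine Ideal.exists_pow_le_of_le_radical_of_fg ?_ (IsNoetherian.noetherian m)
    have h := hxs.2.2
    rw [← show _ = m from h, Ideal.IsRadical.radical_le_iff (Ideal.radical_isRadical _)]
    rw [Ideal.span_le]
    exact fun x hx => ⟨n, Ideal.subset_span (List.mem_map.2 ⟨x, hx, rfl⟩)⟩
  have hJmap : ∀ n, (powFilt xs n).map (algebraMap R B) = J n := fun n => by
    simp [J, l, powFilt, Function.comp_def]
  have hsat : SatHom (algebraMap R (Tilde J)) m := by
    intro as a ha u hu
    choose N hN using hpowle
    rw [hofl]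
    refine Tilde.mem_of_forall (powFilt_antitone l) _ u (fun n => [algebraMap R B a ^ N n]) ?_ ?_
    · intro n
      rw [Ideal.ofList_singleton, Ideal.span_singleton_le_iff_mem, ← map_pow, show powFilt l n = _ from (hJmap n).symm]
      exact Ideal.mem_map_of_mem _ (hN n (Ideal.pow_mem_pow ha _))
    · intro n
      have := hu (N n)
      rw [hofl] at this
      simpa [hφ, Ideal.ofList_singleton] using this
  have hr' : RegMod ⊥ (xs.map (algebraMap R (Tilde J))) := by
    rw [hofl]; exact Tilde.regMod hr
  refine ⟨?_, fun ys hys => ?_⟩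
  · intro htop
    obtain ⟨N, hN⟩ := hpowle 1
    have h1 : Ideal.ofList (xs.map (algebraMap R (Tilde J))) = ⊤ := by
      have : (m ^ N).map (algebraMap R (Tilde J)) = ⊤ := by
        rw [Ideal.map_pow, htop, Ideal.top_pow]
      rw [eq_top_iff, ← this, ← Ideal.map_ofList]
      exact Ideal.map_mono (hN.trans (powFilt_le _ one_pos))
    rw [hofl] at h1
    refine Tilde.ofList_ne_top (powFilt_antitone l) ⟨1, ?_⟩ h1
    rwa [sup_eq_left.2 (powFilt_le l one_pos)]
  · have hlen : xs.length = ys.length := by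
      have := hxs.2.1.trans hys.2.1.symm
      exact_mod_cast this
    have := hsat.connect ys.length xs ys [] hlen rfl (by simpa using hxs.2.2)
      (by simpa using hys.2.2) (by simpa using hr')
    rw [List.append_nil] at this
    exact (RingTheory.Sequence.isWeaklyRegular_map_algebraMap_iff (Tilde J) (Tilde J) ys).1
      this.isWeaklyRegular

/-- A perfect ring of characteristic `p` with a proper weakly regular sequence `xs` and an element
`t` which is zero or the first entry of `xs`. -/
structure PerfStage (p : ℕ) [Fact p.Prime] where
  Q : Type u
  [ring : CommRing Q]
  [char : CharP Q p]
  [perf : PerfectRing Q p]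
  xs : List Q
  t : Q
  ht : t = 0 ∨ ∃ l, xs = t :: l
  reg : RegMod ⊥ xs
  proper : Ideal.ofList xs ≠ ⊤

attribute [instance] PerfStage.ring PerfStage.char PerfStage.perf

namespace PerfStage

open WittVector

variable {p : ℕ} [Fact p.Prime]

/-- Ring homomorphisms respecting the sequence and the distinguished element. -/
structure Hom (E E' : PerfStage.{u} p) where
  f : E.Q →+* E'.Q
  hx : E'.xs = E.xs.map f
  ht : E'.t = f E.t

/-- The ideal of Witt vectors generated by `p - [t]`. -/
noncomputable def wIdeal {Q : Type*} [CommRing Q] (t : Q) : Ideal (WittVector p Q) :=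
  Ideal.span {(p : WittVector p Q) - teichmuller p t}

/-- The quotient of the Witt vectors by `p - [t]`. -/
abbrev S (E : PerfStage.{u} p) := WittVector p E.Q ⧸ wIdeal (p := p) E.t

/-- Teichmüller representatives in the quotient of the Witt vectors. -/
noncomputable def tm (E : PerfStage.{u} p) (a : E.Q) : E.S :=
  Ideal.Quotient.mk _ (teichmuller p a)

theorem tm_zero (E : PerfStage.{u} p) : E.tm 0 = 0 := by
  rw [tm, teichmuller_zero, map_zero]

theorem tm_mul (E : PerfStage.{u} p) (a b : E.Q) : E.tm (a * b) = E.tm a * E.tm b := by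
  rw [tm, map_mul, map_mul]; rfl

/-- The map on quotients of Witt vectors induced by a homomorphism. -/
noncomputable def Hom.map {E E' : PerfStage.{u} p} (g : Hom E E') : E.S →+* E'.S :=
  Ideal.quotientMap _ (WittVector.map g.f) (by
    rw [wIdeal, Ideal.span_singleton_le_iff_mem, Ideal.mem_comap, map_sub, map_natCast,
      map_teichmuller, ← g.ht]
    exact Ideal.mem_span_singleton_self _)

theorem Hom.map_mk {E E' : PerfStage.{u} p} (g : Hom E E') (a : WittVector p E.Q) :
    g.map (Ideal.Quotient.mk _ a) = Ideal.Quotient.mk _ (WittVector.map g.f a) :=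
  Ideal.quotientMap_mk

theorem Hom.map_tm {E E' : PerfStage.{u} p} (g : Hom E E') (a : E.Q) :
    g.map (E.tm a) = E'.tm (g.f a) := by
  rw [tm, map_mk, map_teichmuller]; rfl

theorem Hom.map_tm_list {E E' : PerfStage.{u} p} (g : Hom E E') :
    (E.xs.map E.tm).map g.map = E'.xs.map E'.tm := by
  rw [g.hx, List.map_map, List.map_map]
  exact List.map_congr_left fun a _ => g.map_tm a

/-- The identity homomorphism. -/
def Hom.id (E : PerfStage.{u} p) : Hom E E := ⟨RingHom.id _, by simp, rfl⟩

/-- Composition of homomorphisms. -/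
def Hom.comp {E E' E'' : PerfStage.{u} p} (g : Hom E' E'') (h : Hom E E') : Hom E E'' :=
  ⟨g.f.comp h.f, by rw [g.hx, h.hx, List.map_map]; rfl, by rw [g.ht, h.ht]; rfl⟩

theorem Hom.map_comp {E E' E'' : PerfStage.{u} p} (g : Hom E' E'') (h : Hom E E') :
    (g.comp h).map = g.map.comp h.map := by
  refine Ideal.Quotient.ringHom_ext (RingHom.ext fun a => ?_)
  simp only [RingHom.comp_apply, map_mk]
  congr 1

theorem p_mul_cancel {Q : Type*} [CommRing Q] [CharP Q p] [PerfectRing Q p]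
    {a b : WittVector p Q} (h : (p : WittVector p Q) * a = p * b) : a = b := by
  rw [← sub_eq_zero]
  exact eq_zero_of_p_mul_eq_zero _ (by rw [sub_mul, mul_comm a, mul_comm b, h, sub_self])

theorem exists_teichmuller_add {Q : Type*} [CommRing Q] [CharP Q p] [PerfectRing Q p]
    (a : WittVector p Q) : ∃ b, a = teichmuller p (a.coeff 0) + p * b := by
  have : a - teichmuller p (a.coeff 0) ∈ RingHom.ker (constantCoeff (p := p) (R := Q)) := by
    rw [RingHom.mem_ker, map_sub, sub_eq_zero]
    exact (teichmuller_coeff_zero p _).symm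
  rw [ker_constantCoeff, Ideal.mem_span_singleton] at this
  obtain ⟨b, hb⟩ := this
  exact ⟨b, by rw [← hb]; ring⟩

theorem constantCoeff_teichmuller {Q : Type*} [CommRing Q] (a : Q) :
    constantCoeff (teichmuller p a) = a := teichmuller_coeff_zero p a

theorem regMod_tm (E : PerfStage.{u} p) : RegMod ⊥ (E.xs.map E.tm) := by
  have h0 : E.xs.map E.tm =
      (E.xs.map (teichmuller p)).map (Ideal.Quotient.mk (wIdeal (p := p) E.t)) := by
    rw [List.map_map]; rfl
  have hc : ∀ (K : Ideal E.Q) (l : List E.Q), RegMod K l →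
      RegMod (K.comap (constantCoeff (p := p))) (l.map (teichmuller p)) := fun K l h => by
    rw [RegMod.comap (constantCoeff_surjective p), List.map_map]
    convert h
    conv_rhs => rw [← List.map_id l]
    exact List.map_congr_left fun a _ => constantCoeff_teichmuller a
  rw [h0, RegMod.map_quotient]
  rcases E.ht with ht | ⟨l, hl⟩
  · convert hc ⊥ _ E.reg
    rw [wIdeal, ht, teichmuller_zero, sub_zero, ← ker_constantCoeff]
    rfl
  · rw [hl, List.map_cons]
    have hreg := E.reg
    rw [hl] at hreg
    have e1 : (⊥ ⊔ Ideal.span {E.t} : Ideal E.Q).comap (constantCoeff (p := p)) =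
        wIdeal E.t ⊔ Ideal.span {teichmuller p E.t} := by
      apply le_antisymm
      · intro a ha
        rw [Ideal.mem_comap, bot_sup_eq, Ideal.mem_span_singleton] at ha
        obtain ⟨c, hc⟩ := ha
        obtain ⟨b, hb⟩ := exists_teichmuller_add a
        refine Submodule.mem_sup.2 ⟨(p - teichmuller p E.t) * b,
          Ideal.mul_mem_right _ _ (Ideal.mem_span_singleton_self _),
          teichmuller p E.t * (teichmuller p c + b),
          Ideal.mul_mem_right _ _ (Ideal.mem_span_singleton_self _), ?_⟩
        rw [hb, show a.coeff 0 = _ from hc, map_mul]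
        ring
      · rw [sup_le_iff, wIdeal, Ideal.span_singleton_le_iff_mem, Ideal.span_singleton_le_iff_mem,
          Ideal.mem_comap, Ideal.mem_comap, map_sub, constantCoeff_teichmuller, map_natCast,
          CharP.cast_eq_zero, zero_sub, bot_sup_eq]
        exact ⟨neg_mem (Ideal.mem_span_singleton_self _), Ideal.mem_span_singleton_self _⟩
    refine ⟨fun a ha => ?_, ?_⟩
    · have hpa : (p : WittVector p E.Q) * a ∈ wIdeal E.t := by
        have : (p : WittVector p E.Q) * a = (p - teichmuller p E.t) * a + teichmuller p E.t * a := by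
          ring
        rw [this]
        exact Ideal.add_mem _ (Ideal.mul_mem_right _ _ (Ideal.mem_span_singleton_self _)) ha
      obtain ⟨b, hb⟩ := Ideal.mem_span_singleton.1 hpa
      have hb0 : E.t * b.coeff 0 = 0 := by
        have := congrArg (constantCoeff (p := p)) hb
        rw [map_mul, map_mul, map_sub, constantCoeff_teichmuller, map_natCast,
          CharP.cast_eq_zero, zero_mul, zero_sub, neg_mul, eq_comm, neg_eq_zero] at this
        exact this
      have hb0' : b.coeff 0 = 0 := by simpa using hreg.1 _ (by simpa using hb0)
      obtain ⟨c, hc⟩ := exists_teichmuller_add b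
      rw [hb0', teichmuller_zero, zero_add] at hc
      refine Ideal.mem_span_singleton.2 ⟨c, p_mul_cancel ?_⟩
      rw [hb, hc]; ring
    · rw [← e1]
      exact hc _ _ hreg.2

theorem mem_ofList_of_tm_mem (E : PerfStage.{u} p) {a : E.Q}
    (h : E.tm a ∈ Ideal.ofList (E.xs.map E.tm)) : a ∈ Ideal.ofList E.xs := by
  have hle : wIdeal (p := p) E.t ≤ (Ideal.ofList E.xs).comap constantCoeff := by
    rw [wIdeal, Ideal.span_singleton_le_iff_mem,
          Ideal.mem_comap, map_sub, constantCoeff_teichmuller, map_natCast,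
          CharP.cast_eq_zero, zero_sub]
    apply neg_mem
    rcases E.ht with ht | ⟨l, hl⟩
    · rw [ht]; exact zero_mem _
    · exact Ideal.subset_span (by rw [hl]; simp)
  have hle2 : Ideal.ofList (E.xs.map E.tm) ≤
      ((Ideal.ofList E.xs).comap constantCoeff).map (Ideal.Quotient.mk (wIdeal (p := p) E.t)) := by
    rw [Ideal.ofList, Ideal.span_le]
    intro y hy
    obtain ⟨a, ha, rfl⟩ := List.mem_map.1 hy
    refine Ideal.mem_map_of_mem _ ?_
    rw [Ideal.mem_comap, constantCoeff_teichmuller]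
    exact Ideal.subset_span ha
  have h1 := hle2 h
  rwa [tm, Ideal.mem_quotient_iff_mem hle, Ideal.mem_comap, constantCoeff_teichmuller] at h1

theorem ofList_tm_ne_top (E : PerfStage.{u} p) : Ideal.ofList (E.xs.map E.tm) ≠ ⊤ := fun h =>
  E.proper ((Ideal.eq_top_iff_one _).2 (E.mem_ofList_of_tm_mem (h ▸ Submodule.mem_top)))

theorem nontrivial_S (E : PerfStage.{u} p) : Nontrivial E.S := by
  by_contra h
  rw [not_nontrivial_iff_subsingleton] at h
  exact E.ofList_tm_ne_top (Subsingleton.elim _ _)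

/-- A Teichmüller representative divisible by `p - [t]` is infinitely divisible by `t`. -/
theorem dvd_of_tm_eq_zero (E : PerfStage.{u} p) (n : ℕ) :
    ∀ b : E.Q, E.tm b = 0 → E.t ^ n ∣ b := by
  induction n with
  | zero => simp
  | succ n ih =>
    intro b hb
    obtain ⟨w, hw⟩ := Ideal.mem_span_singleton.1 (Ideal.Quotient.eq_zero_iff_mem.1 hb)
    have h0 : b = E.t * (-w).coeff 0 := by
      have := congrArg (constantCoeff (p := p)) hw
      rw [constantCoeff_teichmuller, map_mul, map_sub, constantCoeff_teichmuller, map_natCast,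
        CharP.cast_eq_zero, zero_sub] at this
      rw [this, show (-w).coeff 0 = constantCoeff (-w) from rfl, map_neg]
      ring
    obtain ⟨c, hc⟩ := exists_teichmuller_add (-w)
    have h1 : -w = teichmuller p E.t * c := by
      apply p_mul_cancel
      rw [h0, map_mul] at hw
      linear_combination hw + teichmuller p E.t * hc
    have h2 : E.tm ((-w).coeff 0) = 0 := by
      refine Ideal.Quotient.eq_zero_iff_mem.2 (Ideal.mem_span_singleton.2 ⟨-c, ?_⟩)
      rw [h1] at hc ⊢
      linear_combination -hc
    rw [h0, pow_succ']
    exact mul_dvd_mul_left _ (ih _ h2)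

theorem eq_zero_of_tm_eq_zero (E : PerfStage.{u} p)
    (hsep : ∀ a : E.Q, (∀ n, a ∈ powFilt E.xs n) → a = 0) {b : E.Q} (hb : E.tm b = 0) : b = 0 := by
  have h := fun n => E.dvd_of_tm_eq_zero n b hb
  rcases E.ht with ht | ⟨l, hl⟩
  · simpa [ht] using h 1
  · refine hsep b fun n => Ideal.mem_of_dvd _ (h n) (Ideal.subset_span ?_)
    rw [hl]; simp

end PerfStage

namespace PerfStage

open WittVector

variable {p : ℕ} [Fact p.Prime]

theorem coeff_init {R : Type*} [CommRing R] (n : ℕ) (x : WittVector p R) (i : ℕ) :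
    (init n x).coeff i = if i < n then x.coeff i else 0 := by
  rw [init, select, coeff_mk]; split_ifs <;> rfl

theorem coeff_tail {R : Type*} [CommRing R] (n : ℕ) (x : WittVector p R) (i : ℕ) :
    (tail n x).coeff i = if n ≤ i then x.coeff i else 0 := by
  rw [tail, select, coeff_mk]; split_ifs <;> rfl

theorem coeff_add_iterate_verschiebung {R : Type*} [CommRing R] (y v : WittVector p R) (m : ℕ) :
    (y + verschiebung^[m] v).coeff m = y.coeff m + v.coeff 0 := by
  have h1 : tail m y = verschiebung^[m] ((tail m y).shift m) :=
    eq_iterate_verschiebung fun i hi => by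
      rw [coeff_tail, if_neg (by omega)]
  have h2 : y + verschiebung^[m] v = init m y + verschiebung^[m] ((tail m y).shift m + v) := by
    conv_lhs => rw [← init_add_tail y m, h1]
    rw [iterate_map_add, add_assoc]
  rw [h2, coeff_add_of_disjoint]
  · rw [coeff_init, if_neg (lt_irrefl m), zero_add]
    have := iterate_verschiebung_coeff (p := p) ((tail m y).shift m + v) m 0
    rw [zero_add] at this
    rw [this, add_coeff_zero]
    rw [shift_coeff, add_zero, coeff_tail, if_pos le_rfl]
  · intro n
    by_cases hn : n < m
    · exact Or.inr (iterate_verschiebung_coeff_eq_zero _ hn)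
    · left; rw [coeff_init, if_neg hn]

theorem coeff_add_sub {R : Type*} [CommRing R] (a a' b : WittVector p R) (m : ℕ)
    (h : ∀ j < m, a.coeff j = a'.coeff j) :
    (∀ j < m, (a + b).coeff j = (a' + b).coeff j) ∧
      (a + b).coeff m - a.coeff m = (a' + b).coeff m - a'.coeff m := by
  have hi : init m a = init m a' := by
    ext j
    rw [coeff_init, coeff_init]
    split_ifs with hj
    · exact h j hj
    · rfl
  constructor
  · intro j hj
    have := congrArg (fun x => x.coeff j) (init_add a b m |>.trans
      ((by rw [hi]) : _ = init m (init m a' + init m b)) |>.trans (init_add a' b m).symm)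
    simpa only [coeff_init, if_pos hj] using this
  · have key : ∀ a : WittVector p R, (a + b).coeff m - a.coeff m = (init m a + b).coeff m := by
      intro a
      have h1 : tail m a = verschiebung^[m] ((tail m a).shift m) :=
        eq_iterate_verschiebung fun i hi => by
          rw [coeff_tail, if_neg (by omega)]
      have h2 : a + b = (init m a + b) + verschiebung^[m] ((tail m a).shift m) := by
        conv_lhs => rw [← init_add_tail a m, h1]
        ring
      rw [h2, coeff_add_iterate_verschiebung, shift_coeff, add_zero, coeff_tail,
        if_pos le_rfl, add_sub_cancel_right]
    rw [key, key, hi]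

open Polynomial in
/-- A sequence of elements which is triangular and monic in suitable variables is regular. -/
theorem regMod_of_triangular {P : Type*} [CommRing P] [Nontrivial P] (Φ : ℕ → P)
    (e : ℕ → P →+* P[X]) (v : ℕ → P) (hv : ∀ n r, (e n r).eval (v n) = r)
    (hj : ∀ n, ∀ j < n, e n (Φ j) = C (Φ j)) (hmon : ∀ n, (e n (Φ n)).Monic)
    (hdeg : ∀ n, 0 < (e n (Φ n)).natDegree) (n : ℕ) :
    RegMod ⊥ ((List.range n).map Φ) ∧ Ideal.ofList ((List.range n).map Φ) ≠ ⊤ := by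
  induction n with
  | zero => exact ⟨trivial, by simp [bot_ne_top]⟩
  | succ n ih =>
    set I := Ideal.ofList ((List.range n).map Φ) with hI
    have hle : I ≤ (I.map C).comap (e n) := by
      rw [hI, Ideal.ofList, Ideal.span_le]
      intro y hy
      obtain ⟨j, hj', rfl⟩ := List.mem_map.1 hy
      rw [List.mem_range] at hj'
      change e n (Φ j) ∈ I.map C
      rw [hj n j hj']
      exact Ideal.mem_map_of_mem _ (Ideal.subset_span (List.mem_map.2 ⟨j, List.mem_range.2 hj', rfl⟩))
    have hq : ∀ g : P[X], g ∈ I.map C ↔ g.map (Ideal.Quotient.mk I) = 0 := fun g => by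
      rw [Ideal.mem_map_C_iff, Polynomial.ext_iff]
      simp [coeff_map, Ideal.Quotient.eq_zero_iff_mem]
    have hnt : Nontrivial (P ⧸ I) := Ideal.Quotient.nontrivial_iff.2 ih.2
    rw [List.range_succ, List.map_append, List.map_singleton]
    refine ⟨RegMod.append_iff.2 ⟨ih.1, ?_, trivial⟩, ?_⟩
    · rw [bot_sup_eq]
      intro u hu
      have h1 : e n (Φ n * u) ∈ I.map C := hle hu
      rw [hq, map_mul, Polynomial.map_mul] at h1
      have h2 : e n u ∈ I.map C := by
        rw [hq]
        exact ((hmon n).map _).mul_right_eq_zero_iff.1 h1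
      have h3 : I.map C ≤ I.comap (evalRingHom (v n)) := Ideal.map_le_iff_le_comap.2 fun a ha => by
        simpa using ha
      have h4 := h3 h2
      rw [Ideal.mem_comap, coe_evalRingHom, hv] at h4
      exact h4
    · rw [Ideal.ofList_append, Ideal.ofList_singleton]
      intro htop
      have h1 : (1 : P) ∈ I ⊔ Ideal.span {Φ n} := htop ▸ Submodule.mem_top
      obtain ⟨i, hi, j, hj, hij⟩ := Submodule.mem_sup.1 h1
      obtain ⟨u, rfl⟩ := Ideal.mem_span_singleton.1 hj
      have h2 := congrArg (fun r => (e n r).map (Ideal.Quotient.mk I)) hij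
      simp only [map_add, Polynomial.map_add, (hq _).1 (hle hi), zero_add, map_mul, map_one,
        Polynomial.map_mul, Polynomial.map_one] at h2
      have h3 := ((hmon n).map (Ideal.Quotient.mk I)).isUnit_iff.1 (IsUnit.of_mul_eq_one _ h2)
      have h4 := (hmon n).natDegree_map (Ideal.Quotient.mk I)
      rw [h3, natDegree_one] at h4
      exact (hdeg n).ne h4

/-- The Witt vector whose coefficients are the variables of positive index. -/
noncomputable def wvars (p : ℕ) (A : Type*) [CommRing A] : WittVector p (MvPolynomial ℕ A) :=
  WittVector.mk p fun n => MvPolynomial.X (n + 1)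

open Polynomial in
/-- The generic expression `F([X₀]) + (p - [t]) w`. -/
noncomputable def phi {A : Type*} [CommRing A] (F : (WittVector p A)[X]) (t : A) :
    WittVector p (MvPolynomial ℕ A) :=
  ((p : WittVector p (MvPolynomial ℕ A)) - teichmuller p (MvPolynomial.C t)) * wvars p A +
    F.eval₂ (WittVector.map MvPolynomial.C) (teichmuller p (MvPolynomial.X 0))

open Polynomial in
theorem map_phi {A A' : Type*} [CommRing A] [CommRing A'] (f : A →+* A') (F : (WittVector p A)[X])
    (t : A) : WittVector.map (MvPolynomial.map f) (phi F t) =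
      phi (F.map (WittVector.map f)) (f t) := by
  rw [phi, map_add, map_mul, map_sub, map_natCast, map_teichmuller, MvPolynomial.map_C, phi,
    hom_eval₂, map_teichmuller, MvPolynomial.map_X, eval₂_map]
  congr 2
  · ext n; simp [wvars, WittVector.map_coeff]
  · ext a n; simp [WittVector.map_coeff]

open Polynomial in
theorem regMod_phi {A : Type*} [CommRing A] [CharP A p] [Nontrivial A] (F : (WittVector p A)[X])
    (hF : F.Monic) (hdeg : 0 < F.natDegree) (n : ℕ) :
    RegMod ⊥ ((List.range n).map (phi F (0 : A)).coeff) ∧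
      Ideal.ofList ((List.range n).map (phi F (0 : A)).coeff) ≠ ⊤ := by
  let e : ℕ → MvPolynomial ℕ A →+* (MvPolynomial ℕ A)[X] := fun n =>
    MvPolynomial.eval₂Hom (C.comp MvPolynomial.C) fun i => if i = n then X else C (MvPolynomial.X i)
  have heC : ∀ n, (e n).comp MvPolynomial.C = C.comp MvPolynomial.C := fun n =>
    MvPolynomial.eval₂Hom_comp_C _ _
  have heX : ∀ n i, e n (MvPolynomial.X i) = if i = n then X else C (MvPolynomial.X i) :=
    fun n i => MvPolynomial.eval₂Hom_X' _ _ _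
  have hphi : ∀ {B : Type _} [CommRing B] (g : MvPolynomial ℕ A →+* B),
      WittVector.map g (phi F (0 : A)) = WittVector.map g (wvars p A) * (p : WittVector p B) +
        F.eval₂ (WittVector.map (g.comp MvPolynomial.C)) (teichmuller p (g (MvPolynomial.X 0))) := by
    intro B _ g
    rw [phi, map_zero, teichmuller_zero, sub_zero, map_add, map_mul, map_natCast, mul_comm,
      hom_eval₂, map_teichmuller]
    congr 2
  have hsucc : ∀ n, (∀ j < n + 1, e (n + 1) ((phi F (0 : A)).coeff j) = C ((phi F (0 : A)).coeff j)) ∧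
      e (n + 1) ((phi F (0 : A)).coeff (n + 1)) = X ^ p +
        C ((phi F (0 : A)).coeff (n + 1) - (MvPolynomial.X (n + 1)) ^ p) := by
    intro n
    have h1 := hphi (e (n + 1))
    have h2 := hphi (C : MvPolynomial ℕ A →+* (MvPolynomial ℕ A)[X])
    rw [heC, heX, if_neg (by omega)] at h1
    have h3 := coeff_add_sub (WittVector.map (e (n + 1)) (wvars p A) * ((p : ℕ) : WittVector p (MvPolynomial ℕ A)[X]))
      (WittVector.map (C : MvPolynomial ℕ A →+* (MvPolynomial ℕ A)[X]) (wvars p A) * ((p : ℕ) : WittVector p (MvPolynomial ℕ A)[X]))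
      (F.eval₂ (WittVector.map (C.comp MvPolynomial.C)) (teichmuller p (C (MvPolynomial.X 0))))
      (n + 1) (by
        intro j hj
        cases j with
        | zero => rw [mul_charP_coeff_zero, mul_charP_coeff_zero]
        | succ j =>
          rw [mul_charP_coeff_succ, mul_charP_coeff_succ, map_coeff, map_coeff]
          congr 1
          change e (n + 1) (MvPolynomial.X (j + 1)) = _
          rw [heX, if_neg (by omega)]
          rfl)
    rw [← h1, ← h2] at h3
    simp only [map_coeff, mul_charP_coeff_succ] at h3
    refine ⟨h3.1, ?_⟩
    have h4 := h3.2
    have h5 : e (n + 1) ((wvars p A).coeff n) = X := by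
      change e (n + 1) (MvPolynomial.X (n + 1)) = _
      rw [heX, if_pos rfl]
    have h6 : (wvars p A).coeff n = MvPolynomial.X (n + 1) := rfl
    rw [h5, h6] at h4
    rw [map_sub, map_pow]
    linear_combination h4
  have hzero : e 0 ((phi F (0 : A)).coeff 0) =
      (F.map WittVector.constantCoeff).map (MvPolynomial.C (σ := ℕ)) := by
    have h1 := congrArg WittVector.constantCoeff (hphi (e 0))
    rw [heC, heX, if_pos rfl, map_add, map_mul, map_natCast, CharP.cast_eq_zero, mul_zero, zero_add,
      hom_eval₂, constantCoeff_teichmuller] at h1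
    rw [Polynomial.map_map]
    refine Eq.trans h1 ?_
    rw [Polynomial.map]
    congr 1
  have hp : 0 < p := (Fact.out : p.Prime).pos
  refine regMod_of_triangular (phi F (0 : A)).coeff e MvPolynomial.X ?_ ?_ ?_ ?_ n
  · intro n r
    have : (evalRingHom (MvPolynomial.X n)).comp (e n) = RingHom.id _ := by
      refine MvPolynomial.ringHom_ext (fun a => ?_) fun i => ?_
      · rw [RingHom.comp_apply, ← RingHom.comp_apply (e n), heC]; simp
      · rw [RingHom.comp_apply, heX]
        split_ifs with h <;> simp [h]
    exact congrArg (fun g => g r) this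
  · intro n j hj
    obtain ⟨n, rfl⟩ := Nat.exists_eq_add_of_lt (Nat.zero_le j |>.trans_lt hj)
    rw [zero_add] at hj ⊢
    exact (hsucc n).1 j hj
  · intro n
    cases n with
    | zero => rw [hzero]; exact (hF.map _).map _
    | succ n => rw [(hsucc n).2]; exact monic_X_pow_add_C _ hp.ne'
  · intro n
    cases n with
    | zero => rw [hzero, (hF.map _).natDegree_map, hF.natDegree_map]; exact hdeg
    | succ n => rw [(hsucc n).2, natDegree_X_pow_add_C]; exact hp

end PerfStage

section Perfect

variable {p : ℕ} [Fact p.Prime]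

/-- Extraction of `p`-power roots in a perfect ring preserves membership in an ideal. -/
theorem mem_ofList_of_pow_mem {Q : Type*} [CommRing Q] [CharP Q p] [PerfectRing Q p] (n : ℕ)
    {l : List Q} {u : Q} (h : u ^ p ^ n ∈ Ideal.ofList (l.map (· ^ p ^ n))) :
    u ∈ Ideal.ofList l := by
  have e : l.map (· ^ p ^ n) = l.map (iterateFrobeniusEquiv Q p n : Q →+* Q) :=
    List.map_congr_left fun a _ => (iterateFrobenius_def p n a).symm
  rw [e, ← Ideal.map_ofList] at h
  obtain ⟨w, hw, h1⟩ := (Ideal.mem_map_iff_of_surjective _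
    (iterateFrobeniusEquiv Q p n).surjective).1 h
  have : w = u := (iterateFrobeniusEquiv Q p n).injective
    (h1.trans (iterateFrobenius_def p n u).symm)
  exact this ▸ hw

section PRadical

variable {E L : Type*} [CommRing E] [CharP E p] [CommRing L] [CharP L p] (i : E →+* L)
  [IsPRadical i p]

theorem exists_pow_eq_list (c : List L) : ∃ n : ℕ, ∀ N ≥ n, ∀ x ∈ c, ∃ y, i y = x ^ p ^ N := by
  induction c with
  | nil => exact ⟨0, by simp⟩
  | cons x c ih =>
    obtain ⟨n, hn⟩ := ih
    obtain ⟨m, y, hy⟩ := IsPRadical.pow_mem i p x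
    refine ⟨n + m, fun N hN z hz => ?_⟩
    rcases List.mem_cons.1 hz with rfl | hz
    · refine ⟨y ^ p ^ (N - m), ?_⟩
      rw [map_pow, hy, ← pow_mul, ← pow_add]
      congr 2; omega
    · exact hn N (by omega) z hz

theorem exists_pow_mem_ofList {l : List E} {u : L} (h : u ∈ Ideal.ofList (l.map i)) {n : ℕ} {w : E}
    (hw : i w = u ^ p ^ n) : ∃ m, w ^ p ^ m ∈ Ideal.ofList (l.map (· ^ p ^ (m + n))) := by
  obtain ⟨c, hc⟩ := mem_ofList_iff.1 h
  obtain ⟨N, hN⟩ := exists_pow_eq_list (p := p) i (List.ofFn c)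
  choose d hd using fun j => hN (N + n) (by omega) (c j) (List.mem_ofFn.2 ⟨j, rfl⟩)
  have h1 : i (w ^ p ^ N) = i (∑ j, d j * (l.get (j.cast (by simp))) ^ p ^ (N + n)) := by
    rw [map_pow, hw, ← pow_mul, ← pow_add, add_comm n, hc, sum_pow_char_pow, map_sum]
    refine Finset.sum_congr rfl fun j _ => ?_
    rw [mul_pow, map_mul, map_pow, hd]
    congr 2
    simp
  have h2 : w ^ p ^ N - ∑ j, d j * (l.get (j.cast (by simp))) ^ p ^ (N + n) ∈ RingHom.ker i := by
    rw [RingHom.mem_ker, map_sub, h1, sub_self]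
  obtain ⟨k, hk⟩ := mem_pNilradical.1 (IsPRadical.ker_le i p h2)
  rw [sub_pow_char_pow, sub_eq_zero] at hk
  refine ⟨N + k, ?_⟩
  have h3 : w ^ p ^ (N + k) = (w ^ p ^ N) ^ p ^ k := by rw [← pow_mul, ← pow_add]
  rw [h3, hk, sum_pow_char_pow]
  refine Ideal.sum_mem _ fun j _ => ?_
  rw [mul_pow, ← pow_mul, ← pow_add, show N + n + k = N + k + n by omega]
  exact Ideal.mul_mem_left _ _ (Ideal.subset_span (List.mem_map.2 ⟨_, List.get_mem _ _, rfl⟩))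

theorem regMod_of_isPRadical [PerfectRing L p] {l : List E} (h : RegMod ⊥ l) :
    RegMod ⊥ (l.map i) := by
  rw [RegMod.iff_split]
  intro l₁ a l₂ hl u hu
  obtain ⟨l₁, l', rfl, rfl, hl'⟩ := List.map_eq_append_iff.1 hl
  obtain ⟨a, l₂, rfl, rfl, rfl⟩ := List.map_eq_cons_iff.1 hl'
  rw [bot_sup_eq] at hu ⊢
  obtain ⟨n, w, hw⟩ := IsPRadical.pow_mem i p u
  obtain ⟨m, hm⟩ := exists_pow_mem_ofList i hu (n := n) (w := a ^ p ^ n * w) (by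
    rw [map_mul, map_pow, hw, mul_pow])
  have h1 := RegMod.iff_split.1 (h.map_pow (p ^ (m + n))) (l₁.map (· ^ p ^ (m + n)))
    (a ^ p ^ (m + n)) (l₂.map (· ^ p ^ (m + n))) (by simp) (w ^ p ^ m) (by
      rw [bot_sup_eq]
      rwa [mul_pow, ← pow_mul, ← pow_add, add_comm n] at hm)
  rw [bot_sup_eq] at h1
  refine mem_ofList_of_pow_mem (p := p) (m + n) ?_
  have h2 := Ideal.mem_map_of_mem i h1
  rw [Ideal.map_ofList, map_pow, hw, ← pow_mul, ← pow_add, add_comm n] at h2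
  convert h2 using 2
  simp

end PRadical

end Perfect

theorem ofList_ne_top_of_isPRadical (p : ℕ) [Fact p.Prime] {E L : Type*} [CommRing E] [CharP E p]
    [CommRing L] [CharP L p] (i : E →+* L) [IsPRadical i p] {l : List E} (h : Ideal.ofList l ≠ ⊤) :
    Ideal.ofList (l.map i) ≠ ⊤ := by
  intro h1
  obtain ⟨m, hm⟩ := exists_pow_mem_ofList (p := p) i (u := 1) (h1 ▸ Submodule.mem_top) (n := 0) (w := 1)
    (by simp)
  rw [one_pow] at hm
  refine h ((Ideal.eq_top_iff_one _).2 (powFilt_le l (n := p ^ (m + 0)) ?_ hm))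
  exact pow_pos (Fact.out : p.Prime).pos _

theorem span_range_eq_iSup_ofList {P : Type*} [CommRing P] (Φ : ℕ → P) (J : Ideal P) {u : P}
    (h : u ∈ Ideal.span (Set.range Φ) ⊔ J) :
    ∃ n, u ∈ Ideal.ofList ((List.range n).map Φ) ⊔ J := by
  obtain ⟨v, hv, j, hj, rfl⟩ := Submodule.mem_sup.1 h
  suffices ∃ n, v ∈ Ideal.ofList ((List.range n).map Φ) from
    this.imp fun n hn => Submodule.add_mem_sup hn hj
  have hmono : Monotone fun n => Ideal.ofList ((List.range n).map Φ) := fun m n hmn =>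
    Ideal.span_mono fun x hx => by
      simp only [List.mem_map, List.mem_range, Set.mem_ofPred_eq] at hx ⊢
      exact hx.imp fun i hi => ⟨by omega, hi.2⟩
  rw [← Submodule.mem_iSup_of_directed _ hmono.directed_le]
  refine (Ideal.span_le.2 ?_ : Ideal.span (Set.range Φ) ≤ _) hv
  rintro _ ⟨i, rfl⟩
  exact Ideal.mem_iSup_of_mem (i + 1)
    (Ideal.subset_span (List.mem_map.2 ⟨i, List.mem_range.2 (by omega), rfl⟩))

namespace RegMod

theorem map_C {Q : Type*} [CommRing Q] {xs : List Q} (h : RegMod ⊥ xs) :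
    RegMod ⊥ (xs.map (MvPolynomial.C : Q →+* MvPolynomial ℕ Q)) := by
  rw [iff_split]
  intro l₁ a l₂ hl u hu
  obtain ⟨l₁, l', rfl, rfl, hl'⟩ := List.map_eq_append_iff.1 hl
  obtain ⟨a, l₂, rfl, rfl, rfl⟩ := List.map_eq_cons_iff.1 hl'
  rw [bot_sup_eq, ← Ideal.map_ofList, MvPolynomial.mem_map_C_iff] at hu ⊢
  intro m
  have := iff_split.1 h _ _ _ rfl (u.coeff m) (by
    rw [bot_sup_eq, ← MvPolynomial.coeff_C_mul]; exact hu m)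
  rwa [bot_sup_eq] at this

theorem of_map_mk {Q : Type*} [CommRing Q] (I : Ideal Q) (l : List (MvPolynomial ℕ Q)) :
    RegMod (I.map MvPolynomial.C) l ↔
      RegMod ⊥ (l.map (MvPolynomial.map (Ideal.Quotient.mk I))) := by
  rw [← comap (MvPolynomial.map_surjective _ Ideal.Quotient.mk_surjective)]
  have : (⊥ : Ideal (MvPolynomial ℕ (Q ⧸ I))).comap (MvPolynomial.map (Ideal.Quotient.mk I)) =
      I.map MvPolynomial.C := by
    rw [← RingHom.ker_eq_comap_bot, MvPolynomial.ker_map, Ideal.mk_ker]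
  rw [this]

/-- A regular sequence stays regular after adjoining countably many variables subject to relations
which remain regular modulo the relevant ideals. -/
theorem of_relations {Q : Type*} [CommRing Q] {xs : List Q} (h : RegMod ⊥ xs)
    (hp : Ideal.ofList xs ≠ ⊤) (Φ : ℕ → MvPolynomial ℕ Q)
    (H : ∀ I : Ideal Q, I ≠ ⊤ → (∀ a l, xs = a :: l → a ∈ I) → ∀ n,
      RegMod ⊥ ((List.range n).map fun i => MvPolynomial.map (Ideal.Quotient.mk I) (Φ i)) ∧
      Ideal.ofList ((List.range n).map fun i => MvPolynomial.map (Ideal.Quotient.mk I) (Φ i)) ≠ ⊤) :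
    RegMod ⊥ (xs.map ((Ideal.Quotient.mk (Ideal.span (Set.range Φ))).comp MvPolynomial.C)) ∧
      Ideal.ofList (xs.map ((Ideal.Quotient.mk (Ideal.span (Set.range Φ))).comp
        MvPolynomial.C)) ≠ ⊤ := by
  have e : xs.map ((Ideal.Quotient.mk (Ideal.span (Set.range Φ))).comp MvPolynomial.C) =
      (xs.map MvPolynomial.C).map (Ideal.Quotient.mk (Ideal.span (Set.range Φ))) := by
    rw [List.map_map]; rfl
  rw [e]
  constructor
  · rw [map_quotient, iff_split]
    intro l₁ a l₂ hl u hu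
    obtain ⟨l₁, l', rfl, rfl, hl'⟩ := List.map_eq_append_iff.1 hl
    obtain ⟨a, l₂, rfl, rfl, rfl⟩ := List.map_eq_cons_iff.1 hl'
    obtain ⟨n, hn⟩ := span_range_eq_iSup_ofList Φ _ hu
    have hle : Ideal.ofList ((List.range n).map Φ) ≤ Ideal.span (Set.range Φ) :=
      Ideal.span_mono fun x hx => by
        obtain ⟨i, -, rfl⟩ := List.mem_map.1 hx
        exact ⟨i, rfl⟩
    refine sup_le_sup_right hle _ ?_
    rw [sup_comm] at hn ⊢
    refine head_nzd ⟨?_, ?_⟩ u hn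
    · have := iff_split.1 h.map_C (l₁.map MvPolynomial.C) (MvPolynomial.C a) _ hl
      rwa [bot_sup_eq] at this
    · have e2 : Ideal.ofList (l₁.map (MvPolynomial.C : Q →+* MvPolynomial ℕ Q)) ⊔
          Ideal.span {MvPolynomial.C a} = (Ideal.ofList (l₁ ++ [a])).map MvPolynomial.C := by
        rw [Ideal.map_ofList, List.map_append, Ideal.ofList_append]; simp
      rw [e2]
      by_cases ht : Ideal.ofList (l₁ ++ [a]) = ⊤
      · rw [ht, Ideal.map_top]; exact of_top
      · rw [of_map_mk, List.map_map]
        refine (H _ ht ?_ n).1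
        intro b l hb
        refine Ideal.subset_span ?_
        cases l₁ with
        | nil => simp at hb; simp [hb.1]
        | cons c l₁ => simp at hb; simp [hb.1]
  · rw [← Ideal.map_ofList]
    intro ht
    have h1 : (1 : MvPolynomial ℕ Q) ∈
        Ideal.span (Set.range Φ) ⊔ Ideal.ofList (xs.map MvPolynomial.C) := by
      rw [sup_comm, ← Ideal.mem_quotient_iff_mem_sup, ht]; exact Submodule.mem_top
    obtain ⟨n, hn⟩ := span_range_eq_iSup_ofList Φ _ h1
    refine (H _ hp ?_ n).2 ?_
    · rintro a l rfl
      exact Ideal.subset_span (by simp)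
    · rw [Ideal.eq_top_iff_one, ← map_one (MvPolynomial.map (Ideal.Quotient.mk (Ideal.ofList xs)))]
      have h2 := Ideal.mem_map_of_mem (MvPolynomial.map (Ideal.Quotient.mk (Ideal.ofList xs))) hn
      rw [Ideal.map_sup, Ideal.map_ofList, List.map_map, ← Ideal.map_ofList] at h2
      have h3 : ((Ideal.ofList xs).map MvPolynomial.C).map
          (MvPolynomial.map (σ := ℕ) (Ideal.Quotient.mk (Ideal.ofList xs))) = ⊥ := by
        rw [Ideal.map_eq_bot_iff_le_ker, MvPolynomial.ker_map, Ideal.mk_ker]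
      rwa [h3, sup_bot_eq] at h2

end RegMod

theorem charP_of_ringHom {Q : Type*} {L : Type*} [CommRing Q] [CommRing L] [Nontrivial L] (f : Q →+* L)
    (p : ℕ) [Fact p.Prime] [CharP Q p] : CharP L p :=
  (CharP.charP_iff_prime_eq_zero Fact.out).2 (by
    rw [← map_natCast f, CharP.cast_eq_zero, map_zero])

namespace PerfStage

open WittVector Polynomial

variable {p : ℕ} [Fact p.Prime]

theorem exists_eval₂_tm_eq_zero (E : PerfStage.{u} p) (F : (WittVector p E.Q)[X]) (hF : F.Monic)
    (hdeg : 0 < F.natDegree) : ∃ (E' : PerfStage.{u} p) (g : Hom E E') (z : E'.Q),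
      F.eval₂ (g.map.comp (Ideal.Quotient.mk _)) (E'.tm z) = 0 := by
  let K := Ideal.span (Set.range (phi F E.t).coeff)
  let π : MvPolynomial ℕ E.Q →+* MvPolynomial ℕ E.Q ⧸ K := Ideal.Quotient.mk K
  obtain ⟨h1, h2⟩ := RegMod.of_relations E.reg E.proper (phi F E.t).coeff (by
    intro I hI hE n
    have := Ideal.Quotient.nontrivial_iff.2 hI
    have := charP_of_ringHom (Ideal.Quotient.mk I) p
    have ht : Ideal.Quotient.mk I E.t = 0 := by
      rcases E.ht with ht | ⟨l, hl⟩
      · rw [ht, map_zero]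
      · exact Ideal.Quotient.eq_zero_iff_mem.2 (hE _ _ hl)
    have e : (fun i => MvPolynomial.map (Ideal.Quotient.mk I) ((phi F E.t).coeff i)) =
        (phi (F.map (WittVector.map (Ideal.Quotient.mk I))) (0 : E.Q ⧸ I)).coeff := by
      rw [← ht, ← map_phi]; rfl
    rw [e]
    have hm := hF.map (WittVector.map (Ideal.Quotient.mk I))
    exact regMod_phi _ hm (by rwa [hF.natDegree_map]) n)
  have hnt : Nontrivial (MvPolynomial ℕ E.Q ⧸ K) := by
    by_contra hn
    rw [not_nontrivial_iff_subsingleton] at hn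
    exact h2 (Subsingleton.elim _ _)
  have := charP_of_ringHom (π.comp MvPolynomial.C) p
  let ι := PerfectClosure.of (MvPolynomial ℕ E.Q ⧸ K) p
  let f := ι.comp (π.comp MvPolynomial.C)
  have e : E.xs.map f = (E.xs.map (π.comp MvPolynomial.C)).map ι := by
    rw [List.map_map]; rfl
  let E' : PerfStage.{u} p :=
    { Q := PerfectClosure (MvPolynomial ℕ E.Q ⧸ K) p
      xs := E.xs.map f
      t := f E.t
      ht := E.ht.imp (fun h => by rw [h, map_zero]) fun ⟨l, hl⟩ => ⟨l.map f, by rw [hl]; rfl⟩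
      reg := e ▸ regMod_of_isPRadical (p := p) ι h1
      proper := e ▸ ofList_ne_top_of_isPRadical p ι h2 }
  let g : Hom E E' := ⟨f, rfl, rfl⟩
  refine ⟨E', g, ι (π (MvPolynomial.X 0)), ?_⟩
  have h3 : WittVector.map π (phi F E.t) = 0 := by
    ext n
    rw [map_coeff, zero_coeff]
    exact Ideal.Quotient.eq_zero_iff_mem.2 (Ideal.subset_span ⟨n, rfl⟩)
  have h4 : WittVector.map (ι.comp π) (phi F E.t) = 0 := by
    have : WittVector.map (ι.comp π) (phi F E.t) =
        WittVector.map ι (WittVector.map π (phi F E.t)) := by ext n; simp [map_coeff]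
    rw [this, h3, map_zero]
  rw [phi, map_add, map_mul, map_sub, map_natCast, map_teichmuller, hom_eval₂,
    map_teichmuller] at h4
  have h5 := congrArg (Ideal.Quotient.mk (wIdeal (p := p) E'.t)) h4
  have h7 : Ideal.Quotient.mk (wIdeal (p := p) E'.t)
      ((p - teichmuller p ((ι.comp π) (MvPolynomial.C E.t))) *
        WittVector.map (ι.comp π) (wvars p E.Q)) = 0 :=
    Ideal.Quotient.eq_zero_iff_mem.2 (Ideal.mul_mem_right _ (wIdeal (p := p) E'.t)
      (Ideal.subset_span rfl))
  rw [map_zero, map_add, h7, zero_add, hom_eval₂] at h5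
  have h6 : g.map.comp (Ideal.Quotient.mk _) = (Ideal.Quotient.mk (wIdeal (p := p) E'.t)).comp
      ((WittVector.map (ι.comp π)).comp (WittVector.map MvPolynomial.C)) := by
    refine RingHom.ext fun a => ?_
    rw [RingHom.comp_apply, Hom.map_mk, RingHom.comp_apply, RingHom.comp_apply]
    congr 1
  rw [h6]
  exact h5

/-- Every monic polynomial of positive degree over `E.S` acquires a root in some extension. -/
theorem exists_eval₂_eq_zero (E : PerfStage.{u} p) (F : E.S[X]) (hF : F.Monic)
    (hdeg : 0 < F.natDegree) : ∃ (E' : PerfStage.{u} p) (g : Hom E E') (z : E'.Q),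
      F.eval₂ g.map (E'.tm z) = 0 := by
  have hl : F ∈ Polynomial.lifts (Ideal.Quotient.mk (wIdeal (p := p) E.t)) :=
    Polynomial.map_surjective _ Ideal.Quotient.mk_surjective F
  have := E.nontrivial_S
  obtain ⟨G, hG, hd, hm⟩ := Polynomial.lifts_and_natDegree_eq_and_monic hl hF
  obtain ⟨E', g, z, hz⟩ := E.exists_eval₂_tm_eq_zero G hm (hd ▸ hdeg)
  refine ⟨E', g, z, ?_⟩
  rw [← hG, eval₂_map, hz]

theorem exists_map_eq_tm (E : PerfStage.{u} p) (a : E.S) :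
    ∃ (E' : PerfStage.{u} p) (g : Hom E E') (z : E'.Q), g.map a = E'.tm z := by
  have := E.nontrivial_S
  obtain ⟨E', g, z, hz⟩ := E.exists_eval₂_eq_zero (X - C a) (monic_X_sub_C a)
    (by rw [natDegree_X_sub_C]; exact one_pos)
  refine ⟨E', g, z, ?_⟩
  rw [eval₂_sub, eval₂_X, eval₂_C, sub_eq_zero] at hz
  exact hz.symm

theorem exists_map_list_eq_tm (E : PerfStage.{u} p) (l : List E.S) :
    ∃ (E' : PerfStage.{u} p) (g : Hom E E'), ∀ b ∈ l, ∃ z, g.map b = E'.tm z := by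
  induction l with
  | nil => exact ⟨E, Hom.id E, by simp⟩
  | cons b l ih =>
    obtain ⟨E₁, g₁, h₁⟩ := ih
    obtain ⟨E₂, g₂, z, h₂⟩ := E₁.exists_map_eq_tm (g₁.map b)
    refine ⟨E₂, g₂.comp g₁, fun c hc => ?_⟩
    rw [Hom.map_comp]
    rcases List.mem_cons.1 hc with rfl | hc
    · exact ⟨z, h₂⟩
    · obtain ⟨w, hw⟩ := h₁ c hc
      exact ⟨g₂.f w, by rw [RingHom.comp_apply, hw, g₂.map_tm]⟩

end PerfStage

open Classical in
theorem exists_pow_le_powFilt {B : Type*} [CommRing B] (l : List B) (n : ℕ) :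
    ∃ N : ℕ, Ideal.ofList l ^ N ≤ powFilt l n := by
  refine Ideal.exists_pow_le_of_le_radical_of_fg (Ideal.span_le.2 fun x hx => ?_) ⟨l.toFinset, ?_⟩
  · exact ⟨n, Ideal.subset_span (List.mem_map.2 ⟨x, hx, rfl⟩)⟩
  · rw [Ideal.ofList]; congr 1; ext; simp

theorem powFilt_mul {B : Type*} [CommRing B] (l : List B) (n k : ℕ) :
    powFilt l (n * k) = Ideal.ofList ((l.map (· ^ n)).map (· ^ k)) := by
  rw [powFilt, List.map_map]; congr 1
  exact List.map_congr_left fun a _ => pow_mul a n k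

namespace Tilde

variable {B : Type*} [CommRing B] (p : ℕ) [Fact p.Prime]

theorem charP {l : List B} [CharP B p] (h : Ideal.ofList l ≠ ⊤) : CharP (Tilde (powFilt l)) p := by
  have : Nontrivial (Tilde (powFilt l)) := by
    by_contra hn
    rw [not_nontrivial_iff_subsingleton] at hn
    refine ofList_ne_top (powFilt_antitone l) (l := l) ⟨1, ?_⟩ (Subsingleton.elim _ _)
    rwa [sup_eq_left.2 (powFilt_le l one_pos)]
  exact charP_of_ringHom (const (powFilt l)) p

theorem perfectRing (l : List B) [CharP B p] [PerfectRing B p] [CharP (Tilde (powFilt l)) p] :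
    PerfectRing (Tilde (powFilt l)) p := by
  refine ⟨(injective_iff_map_eq_zero (frobenius _ p)).2 fun u hu => ?_, fun u => ?_⟩
  · obtain ⟨u, rfl⟩ := Ideal.Quotient.mk_surjective u
    rw [frobenius_def, ← map_pow, Ideal.Quotient.eq_zero_iff_mem] at hu
    refine Ideal.Quotient.eq_zero_iff_mem.2 fun n => ?_
    filter_upwards [hu (n * p)] with m hm
    refine mem_ofList_of_pow_mem (p := p) 1 ?_
    rw [powFilt_mul] at hm
    simpa using hm
  · obtain ⟨u, rfl⟩ := Ideal.Quotient.mk_surjective u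
    choose w hw using fun m => (PerfectRing.bijective_frobenius (R := B) (p := p)).2 (u m)
    refine ⟨Ideal.Quotient.mk _ w, ?_⟩
    change Ideal.Quotient.mk _ w ^ p = _
    rw [← map_pow]
    congr 1
    ext m
    exact hw m

theorem eq_zero_of_forall_mem (l : List B) (u : Tilde (powFilt l))
    (h : ∀ n, u ∈ powFilt (l.map (const (powFilt l))) n) : u = 0 := by
  have := mem_of_forall (powFilt_antitone l) [] u (fun n => l.map (· ^ n)) (fun n => le_rfl)
    (fun n => by
      have := h n
      rw [powFilt, List.map_map] at this
      refine Ideal.mem_sup_right ?_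
      rw [List.map_map]
      rwa [show (const (powFilt l)) ∘ (· ^ n) = (· ^ n) ∘ (const (powFilt l)) from
        funext fun x => map_pow (const (powFilt l)) x n])
  simpa using this

end Tilde

namespace PerfStage

open WittVector Polynomial

variable {p : ℕ} [Fact p.Prime]

/-- The stage of sequences modulo null sequences. -/
noncomputable def tilde (E : PerfStage.{u} p) : PerfStage.{u} p :=
  have := Tilde.charP p E.proper
  have := Tilde.perfectRing p E.xs
  { Q := Tilde (powFilt E.xs)
    xs := E.xs.map (Tilde.const _)
    t := Tilde.const _ E.t
    ht := E.ht.imp (fun h => by rw [h, map_zero]) fun ⟨l, hl⟩ =>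
      ⟨l.map (Tilde.const (powFilt E.xs)), by
        rw [← List.map_cons, ← hl]⟩
    reg := Tilde.regMod E.reg
    proper := Tilde.ofList_ne_top (powFilt_antitone _)
      ⟨1, by rw [sup_eq_left.2 (powFilt_le _ one_pos)]; exact E.proper⟩ }

/-- The homomorphism to constant sequences. -/
noncomputable def toTilde (E : PerfStage.{u} p) : Hom E E.tilde := ⟨Tilde.const _, rfl, rfl⟩

theorem tm_pow (E : PerfStage.{u} p) (a : E.Q) (n : ℕ) : E.tm (a ^ n) = E.tm a ^ n := by
  rw [tm, map_pow, map_pow]; rfl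

/-- A zero divisor relation is witnessed by elements arbitrarily close to a unit. -/
theorem exists_almost_annihilator (E : PerfStage.{u} p)
    (hsep : ∀ a : E.Q, (∀ n, a ∈ powFilt E.xs n) → a = 0) (a : E.Q) :
    a = 0 ∨ ∃ γ : ℕ → E.Q, (∀ k, ∃ j, E.tm (γ j) ^ k ∉ Ideal.ofList (E.xs.map E.tm)) ∧
      ∀ c, E.tm a * E.tm c = 0 → ∀ j, E.tm (γ j) * E.tm c = 0 := by
  refine or_iff_not_imp_left.2 fun ha => ?_
  obtain ⟨n, hn⟩ : ∃ n, a ∉ powFilt E.xs n := by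
    by_contra! h; exact ha (hsep a h)
  refine ⟨fun j => (iterateFrobeniusEquiv E.Q p j).symm a, fun k => ?_, fun c hc j => ?_⟩
  · obtain ⟨N, hN⟩ := exists_pow_le_powFilt E.xs n
    by_contra! h
    have hp : 1 < p := (Fact.out : p.Prime).one_lt
    have h1 := h (k * N)
    rw [← tm_pow] at h1
    have h2 := E.mem_ofList_of_tm_mem h1
    have h3 := hN (Ideal.pow_mem_pow h2 N)
    have h4 : k * N ≤ p ^ (k * N) := (Nat.lt_pow_self hp).le
    have h5 : ((iterateFrobeniusEquiv E.Q p (k * N)).symm a) ^ p ^ (k * N) = a := by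
      rw [← iterateFrobeniusEquiv_def, RingEquiv.apply_symm_apply]
    rw [← pow_mul] at h3
    refine hn ?_
    rw [← h5, ← Nat.sub_add_cancel h4, pow_add]
    exact Ideal.mul_mem_left _ _ h3
  · rw [← tm_mul] at hc ⊢
    have h1 := E.eq_zero_of_tm_eq_zero hsep hc
    suffices ((iterateFrobeniusEquiv E.Q p j).symm a) * c = 0 by rw [this, tm_zero]
    apply (iterateFrobeniusEquiv E.Q p j).injective
    rw [map_mul, RingEquiv.apply_symm_apply, map_zero, iterateFrobeniusEquiv_def]
    have : 0 < p ^ j := pow_pos (Fact.out : p.Prime).pos _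
    rw [← Nat.sub_add_cancel this, pow_succ', ← mul_assoc, h1, zero_mul]

end PerfStage

namespace RegMod

theorem localization {N : Type*} [CommRing N] (M : Submonoid N) (B : Type*) [CommRing B]
    [Algebra N B] [IsLocalization M B] {l : List N} (h : RegMod ⊥ l) :
    RegMod ⊥ (l.map (algebraMap N B)) := by
  rw [iff_split]
  intro l₁ a l₂ hl u hu
  obtain ⟨l₁, l', rfl, rfl, hl'⟩ := List.map_eq_append_iff.1 hl
  obtain ⟨a, l₂, rfl, rfl, rfl⟩ := List.map_eq_cons_iff.1 hl'
  rw [bot_sup_eq, ← Ideal.map_ofList] at hu ⊢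
  obtain ⟨w, s, rfl⟩ := IsLocalization.exists_mk'_eq M u
  rw [← IsLocalization.mk'_one (M := M), ← IsLocalization.mk'_mul,
    IsLocalization.mk'_mem_map_algebraMap_iff] at hu
  rw [IsLocalization.mk'_mem_map_algebraMap_iff]
  obtain ⟨r, hr, hw⟩ := hu
  refine ⟨r, hr, ?_⟩
  have := iff_split.1 h _ _ _ rfl (r * w) (by rw [bot_sup_eq]; convert hw using 1; ring)
  rwa [bot_sup_eq] at this

theorem mem_ofList_pi {S : Type*} [CommRing S] {ι : Type*} {u : ι → S} {l : List S} :
    u ∈ Ideal.ofList (l.map (Pi.constRingHom ι S)) ↔ ∀ m, u m ∈ Ideal.ofList l := by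
  constructor
  · intro h m
    have := Ideal.mem_map_of_mem (Pi.evalRingHom (fun _ : ι => S) m) h
    rw [Ideal.map_ofList, List.map_map] at this
    have e : l.map (Pi.evalRingHom (fun _ : ι => S) m ∘ Pi.constRingHom ι S) = l := List.map_id l
    rwa [e] at this
  · intro h
    choose c hc using fun m => mem_ofList_iff.1 (h m)
    have : u = ∑ i : Fin l.length, (fun m => c m i) * Pi.constRingHom ι S l[i] := by
      ext m; simp [hc m]
    rw [this]
    exact Ideal.sum_mem _ fun i _ => Ideal.mul_mem_left _ _
      (Ideal.subset_span (List.mem_map_of_mem (List.getElem_mem _)))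

theorem pi {S : Type*} [CommRing S] (ι : Type*) {l : List S} (h : RegMod ⊥ l) :
    RegMod ⊥ (l.map (Pi.constRingHom ι S)) := by
  rw [iff_split]
  intro l₁ a l₂ hl u hu
  obtain ⟨l₁, l', rfl, rfl, hl'⟩ := List.map_eq_append_iff.1 hl
  obtain ⟨a, l₂, rfl, rfl, rfl⟩ := List.map_eq_cons_iff.1 hl'
  rw [bot_sup_eq, mem_ofList_pi] at hu ⊢
  intro m
  have := iff_split.1 h _ _ _ rfl (u m) (by rw [bot_sup_eq]; exact hu m)
  rwa [bot_sup_eq] at this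

/-- Elements killed by a family of elements arbitrarily close to units can be sent to zero while
preserving a proper regular sequence. -/
theorem exists_kill {S : Type u} [CommRing S] {xs : List S} (h : RegMod ⊥ xs) (γ : ℕ → S)
    (hγ : ∀ k, ∃ j, γ j ^ k ∉ Ideal.ofList xs) :
    ∃ (B : Type u) (_ : CommRing B) (f : S →+* B), RegMod ⊥ (xs.map f) ∧
      Ideal.ofList (xs.map f) ≠ ⊤ ∧ ∀ b, (∀ j, γ j * b = 0) → f b = 0 := by
  let M : Submonoid (ℕ → S) := Submonoid.powers γ
  let c := Pi.constRingHom ℕ S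
  have e : xs.map ((algebraMap (ℕ → S) (Localization M)).comp c) =
      (xs.map c).map (algebraMap (ℕ → S) (Localization M)) := by
    rw [List.map_map]; rfl
  refine ⟨Localization M, inferInstance, (algebraMap _ _).comp c, ?_, ?_, fun b hb => ?_⟩
  · rw [e]
    exact (h.pi ℕ).localization M _
  · rw [e, ← Ideal.map_ofList, Ne, Ideal.eq_top_iff_one, ← map_one (algebraMap (ℕ → S) (Localization M)),
      IsLocalization.algebraMap_mem_map_algebraMap_iff M]
    rintro ⟨_, ⟨k, rfl⟩, hk⟩
    obtain ⟨j, hj⟩ := hγ k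
    refine hj ?_
    have := mem_ofList_pi.1 hk j
    simpa using this
  · rw [RingHom.comp_apply]
    refine (IsLocalization.map_eq_zero_iff M _ _).2 ⟨⟨γ, 1, pow_one γ⟩, ?_⟩
    ext j
    exact hb j

end RegMod

/-- A class of rings with regular sequences allowing the construction of big Cohen-Macaulay
algebras: monic polynomials acquire roots, and annihilators are witnessed by elements close to
units. -/
structure StageClass (T : ∀ (S : Type u) [CommRing S], List S → Prop) : Prop where
  reg {S : Type u} [CommRing S] {xs : List S} (h : T S xs) : RegMod ⊥ xs ∧ Ideal.ofList xs ≠ ⊤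
  root {S : Type u} [CommRing S] {xs : List S} (h : T S xs) (F : Polynomial S) (hF : F.Monic)
    (hdeg : 0 < F.natDegree) :
    ∃ (S' : Type u) (_ : CommRing S') (f : S →+* S'), T S' (xs.map f) ∧ ∃ z, F.eval₂ f z = 0
  ann {S : Type u} [CommRing S] {xs : List S} (h : T S xs) (a : S) (l : List S) :
    ∃ (S' : Type u) (_ : CommRing S') (f : S →+* S'), T S' (xs.map f) ∧
      ((∀ b ∈ l, f a * f b = 0) → f a = 0 ∨ ∃ γ : ℕ → S',
        (∀ k, ∃ j, γ j ^ k ∉ Ideal.ofList (xs.map f)) ∧ ∀ b ∈ l, ∀ j, γ j * f b = 0)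

/-- The rings arising from perfect stages. -/
inductive IsPerfStage (p : ℕ) [Fact p.Prime] : ∀ (S : Type u) [CommRing S], List S → Prop
  | mk (E : PerfStage.{u} p) : IsPerfStage p E.S (E.xs.map E.tm)

theorem stageClass_isPerfStage (p : ℕ) [Fact p.Prime] :
    StageClass.{u} (fun S [CommRing S] xs => IsPerfStage p S xs) where
  reg h := by
    obtain ⟨E⟩ := h
    exact ⟨E.regMod_tm, E.ofList_tm_ne_top⟩
  root h F hF hdeg := by
    obtain ⟨E⟩ := h
    obtain ⟨E', g, z, hz⟩ := E.exists_eval₂_eq_zero F hF hdeg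
    exact ⟨E'.S, inferInstance, g.map, g.map_tm_list ▸ ⟨E'⟩, _, hz⟩
  ann h a l := by
    obtain ⟨E⟩ := h
    obtain ⟨E₁, g, hg⟩ := E.exists_map_list_eq_tm (a :: l)
    let E' := E₁.tilde
    let g' : E.Hom E' := E₁.toTilde.comp g
    have hg' : ∀ b ∈ a :: l, ∃ z, g'.map b = E'.tm z := fun b hb => by
      obtain ⟨z, hz⟩ := hg b hb
      exact ⟨E₁.toTilde.f z, by
        rw [← PerfStage.Hom.map_tm, ← hz, PerfStage.Hom.map_comp, RingHom.comp_apply]⟩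
    obtain ⟨z, hz⟩ := hg' a (by simp)
    refine ⟨E'.S, inferInstance, g'.map, g'.map_tm_list ▸ ⟨E'⟩, fun h => ?_⟩
    rw [g'.map_tm_list]
    rcases E'.exists_almost_annihilator (Tilde.eq_zero_of_forall_mem E₁.xs) z with h0 | ⟨γ, h1, h2⟩
    · left; rw [hz, h0, E'.tm_zero]
    · refine Or.inr ⟨fun j => E'.tm (γ j), h1, fun b hb j => ?_⟩
      obtain ⟨c, hc⟩ := hg' b (List.mem_cons_of_mem _ hb)
      rw [hc]
      exact h2 c (by rw [← hz, ← hc]; exact h b hb) j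

/-- A ring mapping to a ring with a proper weakly regular sequence coming from it has large
dimension. -/
theorem RegMod.length_le_ringKrullDim {N B : Type u} [CommRing N] [CommRing B] (f : N →+* B)
    {xs : List N} (h : RegMod ⊥ (xs.map f)) (hp : Ideal.ofList (xs.map f) ≠ ⊤) :
    (xs.length : WithBot ℕ∞) ≤ ringKrullDim N := by
  obtain ⟨n, hn⟩ : ∃ n, xs.length = n := ⟨_, rfl⟩
  rw [hn]
  induction n generalizing N B with
  | zero =>
    have : Nontrivial B := by
      by_contra hn
      rw [not_nontrivial_iff_subsingleton] at hn
      exact hp (Subsingleton.elim _ _)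
    have := f.domain_nontrivial
    simpa using ringKrullDim_nonneg_of_nontrivial
  | succ n ih =>
    obtain ⟨x, l, rfl⟩ := List.exists_cons_of_length_eq_add_one hn
    let y : f.range := f.rangeRestrict x
    let I : Ideal f.range := Ideal.span {y}
    let J : Ideal B := ⊥ ⊔ Ideal.span {f x}
    have hIJ : I ≤ J.comap f.range.subtype := by
      rw [Ideal.span_singleton_le_iff_mem, Ideal.mem_comap]
      exact Ideal.mem_sup_right (Ideal.mem_span_singleton_self _)
    let g : f.range ⧸ I →+* B ⧸ J := Ideal.quotientMap J f.range.subtype hIJ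
    have e : (l.map fun a => Ideal.Quotient.mk I (f.rangeRestrict a)).map g =
        (l.map f).map (Ideal.Quotient.mk J) := by
      rw [List.map_map, List.map_map]
      rfl
    have h1 := ih (N := f.range ⧸ I) (B := B ⧸ J) g
      (xs := l.map fun a => Ideal.Quotient.mk I (f.rangeRestrict a))
      (by rw [e, RegMod.map_quotient]; exact h.2) (by
        rw [e, ← Ideal.map_ofList, Ne, Ideal.eq_top_iff_one, ← map_one (Ideal.Quotient.mk J),
          Ideal.mem_quotient_iff_mem_sup, ← Ideal.eq_top_iff_one, sup_comm]
        rwa [List.map_cons, Ideal.ofList_cons, ← bot_sup_eq (Ideal.span {f x})] at hp) (by simpa using hn)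
    have hy : y ∈ nonZeroDivisors f.range := by
      rw [mem_nonZeroDivisors_iff_right]
      intro z hz
      have h2 := h.1 z (by
        rw [mul_comm]
        exact congrArg Subtype.val hz)
      exact Subtype.ext h2
    calc ((n + 1 : ℕ) : WithBot ℕ∞) = n + 1 := by push_cast; rfl
      _ ≤ ringKrullDim (f.range ⧸ I) + 1 := by gcongr
      _ ≤ ringKrullDim f.range := ringKrullDim_quotient_succ_le_of_nonZeroDivisor hy
      _ ≤ _ := ringKrullDim_le_of_surjective _ f.rangeRestrict_surjective

open Polynomial in
theorem StageClass.exists_splits {T : ∀ (S : Type u) [CommRing S], List S → Prop}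
    (hT : StageClass T) (n : ℕ) {S : Type u} [CommRing S] {xs : List S} (h : T S xs) (F : S[X])
    (hF : F.Monic) (hn : F.natDegree = n) :
    ∃ (S' : Type u) (_ : CommRing S') (f : S →+* S'), T S' (xs.map f) ∧
      ∃ zs : List S', F.map f = (zs.map fun z => X - C z).prod := by
  induction n generalizing S with
  | zero =>
    refine ⟨S, inferInstance, RingHom.id S, by simpa using h, [], ?_⟩
    simp [hF.natDegree_eq_zero.1 hn]
  | succ n ih =>
    obtain ⟨S₁, _, f₁, h₁, z, hz⟩ := hT.root h F hF (by omega)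
    have : Nontrivial S₁ := by
      by_contra hn
      rw [not_nontrivial_iff_subsingleton] at hn
      exact (hT.reg h₁).2 (Subsingleton.elim _ _)
    rw [← eval_map] at hz
    have hdiv := mul_divByMonic_eq_iff_isRoot.2 hz
    have hG := (monic_X_sub_C z).of_mul_monic_left (hdiv ▸ hF.map f₁)
    obtain ⟨S₂, _, f₂, h₂, zs, hzs⟩ := ih h₁ _ hG (by
      rw [natDegree_divByMonic _ (monic_X_sub_C z), hF.natDegree_map, hn, natDegree_X_sub_C]
      rfl)
    refine ⟨S₂, inferInstance, f₂.comp f₁, by rwa [List.map_map] at h₂, f₂ z :: zs, ?_⟩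
    rw [← Polynomial.map_map, ← hdiv, Polynomial.map_mul, hzs]
    simp

/-- A Noetherian ring mapping to a member of a stage class has a prime quotient mapping to a ring
in which the given sequence is still regular and proper. -/
theorem StageClass.exists_prime {T : ∀ (S : Type u) [CommRing S], List S → Prop}
    (hT : StageClass T) {N : Type u} [CommRing N] [IsNoetherianRing N] {S : Type u} [CommRing S]
    (φ : N →+* S) (ξ : List N) (h : T S (ξ.map φ)) :
    ∃ q : Ideal N, q.IsPrime ∧ RingHom.ker φ ≤ q ∧ ∃ (B : Type u) (_ : CommRing B) (g : N ⧸ q →+* B),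
      RegMod ⊥ (ξ.map fun x => g (Ideal.Quotient.mk q x)) ∧
      Ideal.ofList (ξ.map fun x => g (Ideal.Quotient.mk q x)) ≠ ⊤ := by
  let A : Set (Ideal N) := {K | RingHom.ker φ ≤ K ∧ ∃ (S' : Type u) (_ : CommRing S')
    (ψ : N →+* S'), T S' (ξ.map ψ) ∧ RingHom.ker ψ = K}
  obtain ⟨K, ⟨hK, S', _, ψ, hψ, rfl⟩, hmax⟩ := set_has_maximal_iff_noetherian.2
    (inferInstance : IsNoetherian N N) A ⟨_, le_rfl, S, inferInstance, φ, h, rfl⟩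
  have hnt : Nontrivial S' := by
    by_contra hn
    rw [not_nontrivial_iff_subsingleton] at hn
    exact (hT.reg hψ).2 (Subsingleton.elim _ _)
  have : Nontrivial (N ⧸ RingHom.ker ψ) := Ideal.Quotient.nontrivial_iff.2 (RingHom.ker_ne_top ψ)
  obtain ⟨q, hq⟩ := associatedPrimes.nonempty N (N ⧸ RingHom.ker ψ)
  obtain ⟨hqp, c, hc⟩ := isAssociatedPrime_iff.1 hq
  obtain ⟨c, rfl⟩ := Ideal.Quotient.mk_surjective c
  have hmem : ∀ b, b ∈ q ↔ ψ b * ψ c = 0 := fun b => by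
    rw [hc, Submodule.mem_colon_singleton, Submodule.mem_bot, ← map_mul, ← RingHom.mem_ker,
      ← Ideal.Quotient.eq_zero_iff_mem]
    rfl
  obtain ⟨s, hs⟩ := IsNoetherian.noetherian q
  obtain ⟨S₁, _, f, h₁, hf⟩ := hT.ann hψ (ψ c) (s.toList.map ψ)
  have hfc : f (ψ c) ≠ 0 := by
    intro h0
    refine hmax (RingHom.ker (f.comp ψ)) ⟨hK.trans ?_, S₁, inferInstance, f.comp ψ, ?_, rfl⟩ ?_
    · exact fun x hx => by rw [RingHom.mem_ker, RingHom.comp_apply, RingHom.mem_ker.1 hx, map_zero]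
    · rwa [List.map_map] at h₁
    · refine lt_of_le_of_ne
        (fun x hx => by rw [RingHom.mem_ker, RingHom.comp_apply, RingHom.mem_ker.1 hx, map_zero]) ?_
      intro heq
      have : c ∈ RingHom.ker ψ := heq ▸ h0
      refine hqp.ne_top ((Ideal.eq_top_iff_one _).2 ((hmem 1).2 ?_))
      rw [RingHom.mem_ker.1 this, mul_zero]
  have hsq : ∀ b ∈ s, b ∈ q := fun b hb => hs ▸ Submodule.subset_span hb
  obtain ⟨γ, hγ, hγ'⟩ := (hf (by
    intro b hb
    obtain ⟨b, hb', rfl⟩ := List.mem_map.1 hb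
    rw [← map_mul, mul_comm, (hmem b).1 (hsq b (Finset.mem_toList.1 hb')), map_zero])).resolve_left hfc
  obtain ⟨B, _, g, hg, hg', hg0⟩ := RegMod.exists_kill (hT.reg h₁).1 γ hγ
  let χ : N →+* B := (g.comp f).comp ψ
  have hχ : ∀ b ∈ q, χ b = 0 := by
    have : q ≤ RingHom.ker χ := by
      rw [← hs]
      refine Submodule.span_le.2 fun b hb => ?_
      exact hg0 _ (hγ' _ (List.mem_map.2 ⟨b, Finset.mem_toList.2 hb, rfl⟩))
    exact this
  refine ⟨q, hqp, hK.trans fun b hb => (hmem b).2 (by rw [RingHom.mem_ker.1 hb, zero_mul]), B,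
    inferInstance, Ideal.Quotient.lift q χ hχ, ?_⟩
  have e : (ξ.map fun x => Ideal.Quotient.lift q χ hχ (Ideal.Quotient.mk q x)) =
      ((ξ.map ψ).map f).map g := by
    rw [List.map_map, List.map_map]
    rfl
  rw [e]
  exact ⟨hg, hg'⟩

open Polynomial in
/-- Integral extensions of a domain `A` embed into any domain over `A` in which suitable monic
polynomials split. -/
theorem exists_ringHom_of_splits {A D E : Type u} [CommRing A] [IsDomain A] [CommRing D] [IsDomain D]
    [Algebra A D] [Algebra.IsIntegral A D] [CommRing E] [IsDomain E] [Algebra A E]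
    (hD : Function.Injective (algebraMap A D)) (hE : Function.Injective (algebraMap A E))
    (F : A[X]) (s : Set D) (hs : Algebra.adjoin A s = ⊤)
    (hF : ∀ y ∈ s, aeval y F = 0) (zs : List E)
    (hzs : F.map (algebraMap A E) = (zs.map fun z => X - C z).prod) :
    Nonempty (D →ₐ[A] E) := by
  let L := AlgebraicClosure (FractionRing E)
  have hEL : Function.Injective (algebraMap E L) := by
    rw [IsScalarTower.algebraMap_eq E (FractionRing E) L]
    exact (algebraMap (FractionRing E) L).injective.comp (IsFractionRing.injective E _)
  have : Module.IsTorsionFree A D := Module.isTorsionFree_iff_algebraMap_injective.2 hD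
  have : Module.IsTorsionFree A L := by
    rw [Module.isTorsionFree_iff_algebraMap_injective, IsScalarTower.algebraMap_eq A E L]
    exact hEL.comp hE
  let σ : D →ₐ[A] L := IsAlgClosed.lift
  let ι : E →ₐ[A] L := IsScalarTower.toAlgHom A E L
  have hσ : ∀ y, σ y ∈ ι.range := by
    intro y
    have hy : y ∈ Algebra.adjoin A s := hs ▸ Algebra.mem_top
    have : Algebra.adjoin A s ≤ ι.range.comap σ := by
      rw [Algebra.adjoin_le_iff]
      intro y hy
      have h1 : aeval (σ y) F = 0 := by rw [aeval_algHom_apply, hF y hy, map_zero]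
      have h2 : F.map (algebraMap A L) = (zs.map fun z => X - C (ι z)).prod := by
        rw [IsScalarTower.algebraMap_eq A E L, ← Polynomial.map_map, hzs, Polynomial.map_list_prod,
          List.map_map]
        congr 1
        exact List.map_congr_left fun z _ => by simp [ι]
      rw [aeval_def, ← eval_map, h2, eval_list_prod, List.prod_eq_zero_iff, List.map_map,
        List.mem_map] at h1
      obtain ⟨z, -, hz⟩ := h1
      refine ⟨z, ?_⟩
      simp [sub_eq_zero] at hz
      exact hz.symm
    exact this hy
  exact ⟨((AlgEquiv.ofInjective ι hEL).symm : ι.range →ₐ[A] E).comp (σ.codRestrict ι.range hσ)⟩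

open Polynomial in
/-- A sequence generating a stage over a Noetherian domain `A` of dimension its length becomes
regular in some algebra over any given domain finite over `A`. -/
theorem StageClass.exists_regMod {T : ∀ (S : Type u) [CommRing S], List S → Prop}
    (hT : StageClass T) {A : Type u} [CommRing A] [IsDomain A] [IsNoetherianRing A] (ξ : List A)
    (hdim : ringKrullDim A ≤ ξ.length) {D : Type u} [CommRing D] [IsDomain D] [Algebra A D]
    [Module.Finite A D] (hinj : Function.Injective (algebraMap A D)) {S : Type u} [CommRing S]
    (φ : A →+* S) (h : T S (ξ.map φ)) :
    ∃ (B : Type u) (_ : CommRing B) (g : D →+* B),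
      RegMod ⊥ (ξ.map fun x => g (algebraMap A D x)) ∧
      Ideal.ofList (ξ.map fun x => g (algebraMap A D x)) ≠ ⊤ := by
  obtain ⟨s, hs⟩ := Module.Finite.fg_top (R := A) (M := D)
  choose f hfm hf using fun y : D => Algebra.IsIntegral.isIntegral (R := A) y
  let F : A[X] := ∏ y ∈ s, f y
  have hFm : F.Monic := monic_prod_of_monic _ _ fun y _ => hfm y
  have hF : ∀ y ∈ s, aeval y F = 0 := fun y hy => by
    rw [map_prod]
    exact Finset.prod_eq_zero hy (hf y)
  obtain ⟨S₁, _, f₁, h₁, zs, hzs⟩ := hT.exists_splits _ h (F.map φ) (hFm.map φ) rfl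
  let N := MvPolynomial (Fin zs.length) A
  let ψ : N →+* S₁ := MvPolynomial.eval₂Hom (f₁.comp φ) zs.get
  have hψC : ψ.comp MvPolynomial.C = f₁.comp φ := RingHom.ext fun a =>
    MvPolynomial.eval₂Hom_C (f₁.comp φ) zs.get a
  have hψ : T S₁ ((ξ.map MvPolynomial.C).map ψ) := by
    rw [List.map_map, ← RingHom.coe_comp, hψC, RingHom.coe_comp, ← List.map_map]
    exact h₁
  obtain ⟨q, hq, hker, B, _, g, hg, hg'⟩ := hT.exists_prime ψ _ hψ
  let E := N ⧸ q
  have hE : Function.Injective (algebraMap A E) := by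
    rw [RingHom.injective_iff_ker_eq_bot]
    by_contra hne
    obtain ⟨a, ha, ha0⟩ := Submodule.exists_mem_ne_zero_of_ne_bot hne
    let K := RingHom.ker (algebraMap A E)
    let g' : A ⧸ K →+* B := g.comp (RingHom.kerLift (algebraMap A E))
    have e : (ξ.map (Ideal.Quotient.mk K)).map g' =
        (ξ.map MvPolynomial.C).map fun x => g (Ideal.Quotient.mk q x) := by
      rw [List.map_map, List.map_map]
      rfl
    have h2 := RegMod.length_le_ringKrullDim g' (e ▸ hg) (e ▸ hg')
    have h3 : ringKrullDim (A ⧸ K) ≤ ringKrullDim (A ⧸ Ideal.span {a}) :=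
      ringKrullDim_le_of_surjective (Ideal.Quotient.factor
        ((Ideal.span_singleton_le_iff_mem _).2 ha)) (Ideal.Quotient.factor_surjective _)
    have h4 := ringKrullDim_quotient_succ_le_of_nonZeroDivisor (mem_nonZeroDivisors_of_ne_zero ha0)
    have h5 : ((ξ.length + 1 : ℕ) : WithBot ℕ∞) ≤ (ξ.length : ℕ) := by
      calc ((ξ.length + 1 : ℕ) : WithBot ℕ∞) = ξ.length + 1 := by push_cast; rfl
        _ ≤ ringKrullDim (A ⧸ Ideal.span {a}) + 1 := by
          gcongr
          simpa using h2.trans h3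
        _ ≤ _ := h4.trans hdim
    have h6 : ξ.length + 1 ≤ ξ.length := by exact_mod_cast h5
    omega
  let ws : List E := (List.finRange zs.length).map fun i => Ideal.Quotient.mk q (MvPolynomial.X i)
  have hws : F.map (algebraMap A E) = (ws.map fun z => X - C z).prod := by
    let P : N[X] := F.map MvPolynomial.C -
      ((List.finRange zs.length).map fun i => X - C (MvPolynomial.X i)).prod
    have hP : P.map ψ = 0 := by
      rw [Polynomial.map_sub, Polynomial.map_map, hψC, ← Polynomial.map_map, hzs,
        Polynomial.map_list_prod, List.map_map, sub_eq_zero]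
      congr 1
      conv_lhs => rw [← List.map_get_finRange zs, List.map_map]
      exact List.map_congr_left fun i _ => by
        have := MvPolynomial.eval₂Hom_X' (f₁.comp φ) zs.get i
        simp only [Function.comp_apply, Polynomial.map_sub, map_X, map_C]
        exact congrArg (fun z => X - C z) this.symm
    have hP' : P.map (Ideal.Quotient.mk q) = 0 := by
      ext n
      rw [coeff_map, coeff_zero, Ideal.Quotient.eq_zero_iff_mem]
      refine hker ?_
      rw [RingHom.mem_ker, ← coeff_map, hP, coeff_zero]
    rw [Polynomial.map_sub, Polynomial.map_map, Polynomial.map_list_prod, List.map_map,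
      sub_eq_zero] at hP'
    rw [List.map_map]
    refine hP'.trans (congrArg List.prod (List.map_congr_left fun i _ => ?_))
    simp only [Function.comp_apply, Polynomial.map_sub, map_X, map_C]
  have hadj : Algebra.adjoin A (s : Set D) = ⊤ := by
    rw [eq_top_iff]
    intro y _
    have : y ∈ Submodule.span A (s : Set D) := hs ▸ Submodule.mem_top
    exact Algebra.span_le_adjoin A _ this
  obtain ⟨σ⟩ := exists_ringHom_of_splits hinj hE F s hadj hF ws hws
  refine ⟨B, inferInstance, g.comp σ, ?_⟩
  have e : (ξ.map fun x => (g.comp (σ : D →+* E)) (algebraMap A D x)) =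
      (ξ.map MvPolynomial.C).map fun x => g (Ideal.Quotient.mk q x) := by
    rw [List.map_map]
    exact List.map_congr_left fun x _ => by
      rw [RingHom.comp_apply, RingHom.coe_coe, σ.commutes]; rfl
  rw [e]
  exact ⟨hg, hg'⟩

section PowerSeries

variable {σ : Type*} [Finite σ] {V B : Type*} [CommRing V] [CommRing B]

/-- Evaluation of power series at elements that are nilpotent modulo an ideal. -/
noncomputable def evalMod (g : V →+* B) (x : σ → B) (I : Ideal B) (n : ℕ)
    (h : Ideal.span (Set.range x) ^ n ≤ I) : MvPowerSeries σ V →+* B ⧸ I :=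
  (Ideal.Quotient.lift (MvPolynomial.idealOfVars σ V ^ n)
    ((Ideal.Quotient.mk I).comp (MvPolynomial.eval₂Hom g x)) (by
      have : MvPolynomial.idealOfVars σ V ^ n ≤
          (I.comap (MvPolynomial.eval₂Hom g x)) := by
        rw [← Ideal.map_le_iff_le_comap, Ideal.map_pow, Ideal.map_span, ← Set.range_comp]
        convert h using 5
        ext i
        simp
      exact fun a ha => Ideal.Quotient.eq_zero_iff_mem.2 (this ha))).comp
    (MvPowerSeries.truncTotalAlgHom σ V n : MvPowerSeries σ V →+* _)

theorem evalMod_coe (g : V →+* B) (x : σ → B) (I : Ideal B) (n : ℕ)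
    (h : Ideal.span (Set.range x) ^ n ≤ I) (f : MvPolynomial σ V) :
    evalMod g x I n h (f : MvPowerSeries σ V) = Ideal.Quotient.mk I (f.eval₂ g x) := by
  have := (MvPowerSeries.truncTotalAlgHom σ V n).commutes f
  rw [evalMod, RingHom.comp_apply]
  refine (congrArg _ this).trans ?_
  exact Ideal.Quotient.lift_mk _ _ _

theorem evalMod_C (g : V →+* B) (x : σ → B) (I : Ideal B) (n : ℕ)
    (h : Ideal.span (Set.range x) ^ n ≤ I) (v : V) :
    evalMod g x I n h (MvPowerSeries.C v) = Ideal.Quotient.mk I (g v) := by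
  rw [← MvPolynomial.coe_C, evalMod_coe, MvPolynomial.eval₂_C]

theorem evalMod_X (g : V →+* B) (x : σ → B) (I : Ideal B) (n : ℕ)
    (h : Ideal.span (Set.range x) ^ n ≤ I) (i : σ) :
    evalMod g x I n h (MvPowerSeries.X i) = Ideal.Quotient.mk I (x i) := by
  rw [← MvPolynomial.coe_X, evalMod_coe, MvPolynomial.eval₂_X]

theorem evalMod_eq (g : V →+* B) (x : σ → B) (I : Ideal B) (n : ℕ)
    (h : Ideal.span (Set.range x) ^ n ≤ I) {m : ℕ} (hm : n ≤ m) (f : MvPowerSeries σ V) :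
    evalMod g x I n h f = Ideal.Quotient.mk I ((f.truncTotal m).eval₂ g x) := by
  rw [← evalMod_coe g x I n h]
  have : MvPowerSeries.truncTotalAlgHom σ V n f =
      MvPowerSeries.truncTotalAlgHom σ V n (f.truncTotal m : MvPolynomial σ V) := by
    rw [show ((f.truncTotal m : MvPolynomial σ V) : MvPowerSeries σ V) =
      algebraMap (MvPolynomial σ V) _ (f.truncTotal m) from rfl, AlgHom.commutes]
    exact (Ideal.Quotient.mk_eq_mk_iff_sub_mem _ _).2
      (MvPowerSeries.truncTotal_sub_truncTotal_mem_pow_idealOfVars le_rfl hm f)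
  rw [evalMod, RingHom.comp_apply, RingHom.comp_apply]
  exact congrArg _ this

theorem exists_eval_of_isAdicComplete (g : V →+* B) (x : σ → B) (I : Ideal B) [IsAdicComplete I B]
    (hx : ∀ i, x i ∈ I) :
    ∃ φ : MvPowerSeries σ V →+* B, (∀ v, φ (MvPowerSeries.C v) = g v) ∧
      ∀ i, φ (MvPowerSeries.X i) = x i := by
  have hI : ∀ n, Ideal.span (Set.range x) ^ n ≤ I ^ n := fun n =>
    Ideal.pow_right_mono (Ideal.span_le.2 (Set.range_subset_iff.2 hx)) n
  let f : ∀ n, MvPowerSeries σ V →+* B ⧸ I ^ n := fun n => evalMod g x (I ^ n) n (hI n)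
  have hf : ∀ {m n : ℕ} (hle : m ≤ n), (Ideal.Quotient.factorPow I hle).comp (f n) = f m := by
    intro m n hle
    ext s
    rw [RingHom.comp_apply]
    simp only [f]
    rw [evalMod_eq g x _ n _ le_rfl, evalMod_eq g x _ m _ hle]
    rfl
  refine ⟨IsAdicComplete.liftRingHom I f hf, fun v => ?_, fun i => ?_⟩
  · rw [IsHausdorff.eq_iff_smodEq (I := I)]
    intro n
    rw [SModEq, smul_eq_mul, Ideal.mul_top]
    exact (IsAdicComplete.mk_liftRingHom I f hf n _).trans (evalMod_C ..)
  · rw [IsHausdorff.eq_iff_smodEq (I := I)]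
    intro n
    rw [SModEq, smul_eq_mul, Ideal.mul_top]
    exact (IsAdicComplete.mk_liftRingHom I f hf n _).trans (evalMod_X ..)

end PowerSeries

namespace Tilde

/-- A sequence of elements of the quotients `B ⧸ J m` defines an element of `Tilde J`. -/
noncomputable def ofPi {B : Type*} [CommRing B] {J : ℕ → Ideal B} (hJ : Antitone J) :
    (∀ m, B ⧸ J m) →+* Tilde J :=
  RingHom.liftOfSurjective (RingHom.pi fun m => (Ideal.Quotient.mk (J m)).comp (Pi.evalRingHom _ m))
    (fun v => ⟨fun m => (v m).out, funext fun m => Ideal.Quotient.mk_out (v m)⟩)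
    ⟨Ideal.Quotient.mk (nullIdeal J), fun u hu => by
      rw [RingHom.mem_ker, Ideal.Quotient.eq_zero_iff_mem]
      intro n
      filter_upwards [eventually_ge_atTop n] with m hm
      exact hJ hm (Ideal.Quotient.eq_zero_iff_mem.1 (congrFun hu m))⟩

theorem ofPi_mk {B : Type*} [CommRing B] {J : ℕ → Ideal B} (hJ : Antitone J) (u : ℕ → B) :
    ofPi hJ (fun m => Ideal.Quotient.mk (J m) (u m)) = Ideal.Quotient.mk (nullIdeal J) u :=
  RingHom.liftOfRightInverse_comp_apply _ _ (Function.rightInverse_surjInv _) _ u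

theorem ofPi_const {B : Type*} [CommRing B] {J : ℕ → Ideal B} (hJ : Antitone J) (b : B) :
    ofPi hJ (fun m => Ideal.Quotient.mk (J m) b) = const J b :=
  ofPi_mk hJ fun _ => b

end Tilde

/-- Witt vectors commute with products. -/
theorem WittVector.exists_pi (p : ℕ) [Fact p.Prime] {ι : Type*} (B : ι → Type*)
    [∀ i, CommRing (B i)] :
    ∃ φ : (∀ i, WittVector p (B i)) →+* WittVector p (∀ i, B i), ∀ w n i,
      (φ w).coeff n i = (w i).coeff n := by
  let ψ : WittVector p (∀ i, B i) →+* ∀ i, WittVector p (B i) :=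
    RingHom.pi fun i => WittVector.map (Pi.evalRingHom B i)
  have hψ : ∀ w i n, (ψ w i).coeff n = w.coeff n i := fun w i n => WittVector.map_coeff _ _ _
  have hb : Function.Bijective ψ := by
    constructor
    · intro a b hab
      ext n i
      rw [← hψ, ← hψ, hab]
    · intro w
      refine ⟨WittVector.mk p fun n i => (w i).coeff n, ?_⟩
      funext i
      ext n
      rw [hψ, WittVector.coeff_mk]
  let e := RingEquiv.ofBijective ψ hb
  refine ⟨(e.symm : _ →+* _), fun w n i => ?_⟩
  rw [← hψ]
  exact congrArg (fun z => (z i).coeff n) (e.apply_symm_apply w)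

theorem Tilde.exists_eval_witt (p : ℕ) [Fact p.Prime] {σ : Type*} [Finite σ] {V B : Type*}
    [CommRing V] [CommRing B] (g : V →+* WittVector p B) (x : σ → B) {J : ℕ → Ideal B}
    (hJ : Antitone J) (h : ∀ m, ∃ n, ∀ i, x i ^ n ∈ J m) :
    ∃ φ : MvPowerSeries σ V →+* WittVector p (Tilde J),
      (∀ v, φ (MvPowerSeries.C v) = WittVector.map (const J) (g v)) ∧
      ∀ i, φ (MvPowerSeries.X i) = WittVector.teichmuller p (const J (x i)) := by
  choose n hn using h
  let q : ∀ m, WittVector p B →+* WittVector p (B ⧸ J m) := fun m =>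
    WittVector.map (Ideal.Quotient.mk (J m))
  let y : σ → WittVector p B := fun i => WittVector.teichmuller p (x i)
  have hy : ∀ m, ∃ N, Ideal.span (Set.range y) ^ N ≤ RingHom.ker (q m) := by
    intro m
    have hfg : (Ideal.span (Set.range y)).FG := ⟨(Set.finite_range y).toFinset, by simp⟩
    refine Ideal.exists_pow_le_of_le_radical_of_fg ?_ hfg
    rw [Ideal.span_le]
    rintro _ ⟨i, rfl⟩
    refine ⟨n m, ?_⟩
    rw [RingHom.mem_ker]
    simp only [y, q]
    rw [← map_pow, WittVector.map_teichmuller, Ideal.Quotient.eq_zero_iff_mem.2 (hn m i),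
      WittVector.teichmuller_zero]
  choose N hN using hy
  obtain ⟨π, hπ⟩ := WittVector.exists_pi p fun m => B ⧸ J m
  refine ⟨((WittVector.map (ofPi hJ)).comp π).comp (RingHom.pi fun m =>
    (RingHom.kerLift (q m)).comp (evalMod g y _ (N m) (hN m))), fun v => ?_, fun i => ?_⟩
  · ext k
    rw [RingHom.comp_apply, RingHom.comp_apply, WittVector.map_coeff, WittVector.map_coeff,
      ← ofPi_const hJ]
    congr 1
    funext m
    rw [hπ]
    refine (congrArg (fun z => WittVector.coeff z k) ?_).trans (WittVector.map_coeff _ _ _)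
    change (q m).kerLift (evalMod g y _ (N m) (hN m) _) = _
    rw [evalMod_C, RingHom.kerLift_mk]
  · ext k
    rw [RingHom.comp_apply, RingHom.comp_apply, WittVector.map_coeff,
      ← WittVector.map_teichmuller, WittVector.map_coeff, ← ofPi_const hJ]
    congr 1
    funext m
    rw [hπ]
    refine (congrArg (fun z => WittVector.coeff z k) ?_).trans (WittVector.map_coeff _ _ _)
    change (q m).kerLift (evalMod g y _ (N m) (hN m) _) = _
    rw [evalMod_X, RingHom.kerLift_mk]

open Polynomial in
theorem regMod_X (k : Type*) [CommRing k] [Nontrivial k] (n : ℕ) :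
    RegMod ⊥ ((List.range n).map (MvPolynomial.X : ℕ → MvPolynomial ℕ k)) ∧
      Ideal.ofList ((List.range n).map (MvPolynomial.X : ℕ → MvPolynomial ℕ k)) ≠ ⊤ := by
  let e : ℕ → MvPolynomial ℕ k →+* (MvPolynomial ℕ k)[X] := fun n =>
    MvPolynomial.eval₂Hom (C.comp MvPolynomial.C) fun i => if i = n then X else C (MvPolynomial.X i)
  have heX : ∀ n i, e n (MvPolynomial.X i) = if i = n then X else C (MvPolynomial.X i) :=
    fun n i => MvPolynomial.eval₂Hom_X' _ _ _
  refine PerfStage.regMod_of_triangular _ e MvPolynomial.X (fun n r => ?_) (fun n j hj => ?_) (fun n => ?_)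
    (fun n => ?_) n
  · have : ((evalRingHom (MvPolynomial.X n)).comp (e n)) = RingHom.id _ := by
      ext i
      · simp [e]
      · rw [RingHom.comp_apply, heX]
        split_ifs with h <;> simp [h]
    exact congrArg (fun f => f r) this
  · rw [heX, if_neg hj.ne]
  · rw [heX, if_pos rfl]; exact monic_X
  · rw [heX, if_pos rfl, natDegree_X]; exact one_pos

/-- The perfection of a polynomial ring as a perfect stage. -/
noncomputable def polyStage (p : ℕ) [Fact p.Prime] (k : Type u) [Field k] [CharP k p] (e : ℕ) :
    PerfStage.{u} p where
  Q := PerfectClosure (MvPolynomial ℕ k) p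
  xs := (((List.range (e + 1)).map MvPolynomial.X).map (PerfectClosure.of (MvPolynomial ℕ k) p))
  t := PerfectClosure.of (MvPolynomial ℕ k) p (MvPolynomial.X 0)
  ht := Or.inr ⟨_, by rw [List.range_succ_eq_map, List.map_cons, List.map_cons]⟩
  reg := regMod_of_isPRadical (p := p) _ (regMod_X k _).1
  proper := ofList_ne_top_of_isPRadical p _ (regMod_X k _).2

theorem exists_isPerfStage (p : ℕ) [Fact p.Prime] (k : Type u) [Field k] [CharP k p] (e : ℕ) :
    ∃ (S : Type u) (_ : CommRing S) (φ : MvPowerSeries (Fin e) (WittVector p k) →+* S),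
      IsPerfStage p S (((p : MvPowerSeries (Fin e) (WittVector p k)) ::
        List.ofFn MvPowerSeries.X).map φ) := by
  let E := polyStage p k e
  let x : Fin e → E.Q := fun i => PerfectClosure.of (MvPolynomial ℕ k) p (MvPolynomial.X (i + 1))
  have hxs : E.xs = E.t :: List.ofFn x := by
    simp only [E, polyStage, x]
    rw [List.range_succ_eq_map, List.map_cons, List.map_cons, List.map_map, List.map_map]
    congr 1
    rw [List.ofFn_eq_map, ← List.map_coe_finRange_eq_range, List.map_map]
    rfl
  obtain ⟨φ, hφ⟩ : ∃ φ : MvPowerSeries (Fin e) (WittVector p k) →+* WittVector p E.tilde.Q,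
      ∀ i, φ (MvPowerSeries.X i) = WittVector.teichmuller p (E.toTilde.f (x i)) := by
    obtain ⟨φ, -, hφ⟩ := Tilde.exists_eval_witt p (WittVector.map
      ((PerfectClosure.of (MvPolynomial ℕ k) p).comp MvPolynomial.C)) x (powFilt_antitone E.xs)
      (fun m => ⟨m, fun i => by
        refine Ideal.subset_span (List.mem_map.2 ⟨_, ?_, rfl⟩)
        rw [hxs]
        exact List.mem_cons_of_mem _ (List.mem_ofFn.2 ⟨i, rfl⟩)⟩)
    exact ⟨φ, hφ⟩
  let π : WittVector p E.tilde.Q →+* E.tilde.S := Ideal.Quotient.mk _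
  refine ⟨E.tilde.S, inferInstance, π.comp φ, ?_⟩
  have h0 : π.comp φ (p : MvPowerSeries (Fin e) (WittVector p k)) = E.tilde.tm E.tilde.t := by
    rw [map_natCast, ← map_natCast π]
    exact Ideal.Quotient.eq.2 (Ideal.subset_span rfl)
  have h1 : ∀ i, π.comp φ (MvPowerSeries.X i) = E.tilde.tm (E.toTilde.f (x i)) := fun i => by
    rw [RingHom.comp_apply, hφ]
    rfl
  have h2 : E.tilde.xs = E.tilde.t :: List.ofFn fun i => E.toTilde.f (x i) := by
    rw [E.toTilde.hx, hxs, List.map_cons, List.map_ofFn]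
    rfl
  have : ((p : MvPowerSeries (Fin e) (WittVector p k)) :: List.ofFn MvPowerSeries.X).map
      (π.comp φ) = E.tilde.xs.map E.tilde.tm := by
    rw [h2, List.map_cons, List.map_cons, List.map_ofFn, List.map_ofFn, h0]
    exact congrArg _ (congrArg List.ofFn (funext h1))
  rw [this]
  exact ⟨E.tilde⟩

section WittLift

variable {p : ℕ} [Fact p.Prime] {C : Type*} [CommRing C] (I : Ideal C)

theorem ghostComponent_mem (hp : (p : C) ∈ I) (n : ℕ) (y : WittVector p C)
    (hy : ∀ i, y.coeff i ∈ I) : WittVector.ghostComponent n y ∈ I ^ (n + 1) := by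
  rw [WittVector.ghostComponent_apply, wittPolynomial_eq_sum_C_mul_X_pow, map_sum]
  refine Ideal.sum_mem _ fun i hi => ?_
  have hi : i ≤ n := Nat.lt_succ_iff.1 (Finset.mem_range.1 hi)
  have h1 : n + 1 ≤ i + p ^ (n - i) := by
    have := Nat.lt_pow_self (n := n - i) (Fact.out : p.Prime).one_lt
    omega
  have h2 := Ideal.mul_mem_mul (Ideal.pow_mem_pow hp i) (Ideal.pow_mem_pow (hy i) (p ^ (n - i)))
  rw [← pow_add] at h2
  simpa using Ideal.pow_le_pow_right h1 h2

theorem ghostComponent_succ_of_pow (n : ℕ) (y y' : WittVector p C)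
    (hy : ∀ i, y'.coeff i = y.coeff i ^ p) :
    WittVector.ghostComponent (n + 1) y =
      WittVector.ghostComponent n y' + (p : C) ^ (n + 1) * y.coeff (n + 1) := by
  simp only [WittVector.ghostComponent_apply, wittPolynomial_eq_sum_C_mul_X_pow, map_sum]
  rw [Finset.sum_range_succ]
  congr 1
  · refine Finset.sum_congr rfl fun i hi => ?_
    have hi : i ≤ n := Nat.lt_succ_iff.1 (Finset.mem_range.1 hi)
    simp [hy, ← pow_mul, ← pow_succ', Nat.succ_sub hi]
  · simp

/-- A complete ring with perfect residue ring of characteristic `p` receives a homomorphism from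
the Witt vectors of the latter. -/
theorem exists_ringHom_witt [IsAdicComplete I C] [CharP (C ⧸ I) p] [PerfectRing (C ⧸ I) p] :
    ∃ θ : WittVector p (C ⧸ I) →+* C, ∀ x, Ideal.Quotient.mk I (θ x) = x.coeff 0 := by
  have hp : (p : C) ∈ I := by
    rw [← Ideal.Quotient.eq_zero_iff_mem, map_natCast, CharP.cast_eq_zero]
  let q : WittVector p C →+* WittVector p (C ⧸ I) := WittVector.map (Ideal.Quotient.mk I)
  have hq : Function.Surjective q := WittVector.map_surjective _ Ideal.Quotient.mk_surjective
  let γ : ∀ n, WittVector p C →+* C ⧸ I ^ (n + 1) := fun n =>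
    (Ideal.Quotient.mk (I ^ (n + 1))).comp (WittVector.ghostComponent n)
  have hγ : ∀ n, RingHom.ker q ≤ RingHom.ker (γ n) := by
    intro n y hy
    rw [RingHom.mem_ker] at hy
    refine Ideal.Quotient.eq_zero_iff_mem.2 (ghostComponent_mem I hp n y fun i => ?_)
    rw [← Ideal.Quotient.eq_zero_iff_mem, ← WittVector.map_coeff]
    exact (congrArg (fun z => WittVector.coeff z i) hy).trans (WittVector.zero_coeff p _ i)
  let g : ∀ n, WittVector p (C ⧸ I) →+* C ⧸ I ^ (n + 1) := fun n =>
    RingHom.liftOfSurjective q hq ⟨γ n, hγ n⟩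
  have hg : ∀ n y, g n (q y) = γ n y := fun n y =>
    RingHom.liftOfRightInverse_comp_apply _ _ _ _ y
  let F : ∀ n : ℕ, (C ⧸ I) →+* (C ⧸ I) := fun n => ((frobeniusEquiv (C ⧸ I) p).symm ^ n : _ ≃+* _)
  have hF : ∀ n a, F (n + 1) a ^ p = F n a := by
    intro n a
    simp only [F, pow_succ']
    exact frobenius_apply_frobeniusEquiv_symm ..
  let f : ∀ n, WittVector p (C ⧸ I) →+* C ⧸ I ^ (n + 1) := fun n => (g n).comp (WittVector.map (F n))
  have hf : ∀ {m}, (Ideal.Quotient.factorPow I (Order.succ_strictMono.monotone m.le_succ)).comp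
      (f (m + 1)) = f m := by
    intro n
    ext x
    obtain ⟨y, hy⟩ := hq (WittVector.map (F (n + 1)) x)
    let y' : WittVector p C := WittVector.mk p fun i => y.coeff i ^ p
    have hy' : q y' = WittVector.map (F n) x := by
      ext i
      rw [WittVector.map_coeff, WittVector.map_coeff, WittVector.coeff_mk, map_pow, ← hF,
        ← WittVector.map_coeff, ← WittVector.map_coeff]
      exact congrArg (fun z => WittVector.coeff z i ^ p) hy
    have h1 : f (n + 1) x = γ (n + 1) y := by rw [← hg, hy]; rfl
    have h2 : f n x = γ n y' := by rw [← hg, hy']; rfl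
    refine (congrArg (Ideal.Quotient.factor (Ideal.pow_le_pow_right (n + 1).le_succ)) h1).trans
      (Eq.trans ?_ h2.symm)
    refine Ideal.Quotient.eq.2 ?_
    rw [ghostComponent_succ_of_pow n y y' fun _ => rfl, add_sub_cancel_left]
    exact Ideal.mul_mem_right _ _ (Ideal.pow_mem_pow hp _)
  refine ⟨IsAdicComplete.StrictMono.liftRingHom I Order.succ_strictMono f hf, fun x => ?_⟩
  have h1 := IsAdicComplete.StrictMono.mk_liftRingHom I Order.succ_strictMono f hf (n := 0) x
  obtain ⟨y, hy⟩ := hq (WittVector.map (F 0) x)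
  have h2 : f 0 x = γ 0 y := by rw [← hg, hy]; rfl
  have h3 := Ideal.Quotient.eq.1 (h1.trans h2)
  rw [show Order.succ 0 = 1 from rfl, pow_one] at h3
  have h4 : WittVector.ghostComponent 0 y = y.coeff 0 := by
    simp [WittVector.ghostComponent_apply, wittPolynomial_zero]
  rw [h4] at h3
  refine (Ideal.Quotient.eq.2 h3).trans ?_
  have h5 := congrArg (fun z => WittVector.coeff z 0) hy
  simpa [q, F] using h5

end WittLift

section Precomplete

theorem IsPrecomplete.exists_lim {A : Type*} [CommRing A] (I : Ideal A) [IsPrecomplete I A]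
    (f : ℕ → A) (h : ∀ n, f (n + 1) - f n ∈ I ^ n) : ∃ L, ∀ n, f n - L ∈ I ^ n := by
  have h1 (m k : ℕ) : f m - f (m + k) ∈ I ^ m := by
    induction k with
    | zero => simp
    | succ k ih =>
      have := sub_mem ih (Ideal.pow_le_pow_right (Nat.le_add_right m k) (h (m + k)))
      rwa [sub_sub_sub_cancel_right] at this
  obtain ⟨L, hL⟩ := IsPrecomplete.prec ‹_› (I := I) (f := f) fun {m n} hmn => by
    obtain ⟨k, rfl⟩ := Nat.exists_eq_add_of_le hmn
    rw [SModEq.sub_mem]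
    simpa using h1 m k
  refine ⟨L, fun n => ?_⟩
  have := hL n
  rw [SModEq.sub_mem] at this
  simpa using this

theorem IsPrecomplete.of_exists_lim {A : Type*} [CommRing A] (I : Ideal A)
    (h : ∀ f : ℕ → A, (∀ n, f (n + 1) - f n ∈ I ^ n) → ∃ L, ∀ n, f n - L ∈ I ^ n) :
    IsPrecomplete I A := by
  refine ⟨fun f hf => ?_⟩
  obtain ⟨L, hL⟩ := h f fun n => by
    have := hf (Nat.le_succ n)
    rw [SModEq.sub_mem] at this
    rw [← neg_mem_iff]
    simpa using this
  refine ⟨L, fun n => ?_⟩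
  rw [SModEq.sub_mem]
  simpa using hL n

theorem IsPrecomplete.exists_shift {A : Type*} [CommRing A] (p : A) (K : Ideal A)
    [IsPrecomplete K A] (f : ℕ → A) (hf : ∀ n, f (n + 1) - f n ∈ (Ideal.span {p} ⊔ K) ^ n) :
    ∃ (f' : ℕ → A) (L : A), (∀ n, f' (n + 1) - f' n ∈ (Ideal.span {p} ⊔ K) ^ n) ∧
      ∀ n, f (n + 1) - L - p * f' n ∈ (Ideal.span {p} ⊔ K) ^ (n + 1) := by
  set J := Ideal.span {p} ⊔ K
  have h1 (n : ℕ) : J ^ (n + 1) ≤ Ideal.span {p} * J ^ n ⊔ K ^ (n + 1) := by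
    induction n with
    | zero => simp [J]
    | succ n ih =>
      calc J ^ (n + 1 + 1) = Ideal.span {p} * J ^ (n + 1) ⊔ K * J ^ (n + 1) := by
            rw [pow_succ', ← Ideal.sup_mul]
        _ ≤ Ideal.span {p} * J ^ (n + 1) ⊔ K * (Ideal.span {p} * J ^ n ⊔ K ^ (n + 1)) := by
            gcongr
        _ ≤ _ := by
            rw [Ideal.mul_sup, ← pow_succ' K, ← sup_assoc]
            refine sup_le_sup_right (sup_le le_rfl ?_) _
            rw [mul_left_comm, pow_succ' J]
            gcongr
            exact le_sup_right
  have h2 (n : ℕ) : ∃ c ∈ J ^ n, ∃ b ∈ K ^ (n + 1), p * c + b = f (n + 2) - f (n + 1) := by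
    obtain ⟨x, hx, b, hb, h⟩ := Submodule.mem_sup.1 (h1 n (hf (n + 1)))
    obtain ⟨c, hc, rfl⟩ := Ideal.mem_span_singleton_mul.1 hx
    exact ⟨c, hc, b, hb, h⟩
  choose c hc b hb hcb using h2
  obtain ⟨L, hL⟩ := IsPrecomplete.exists_lim K (fun n => f 1 + ∑ i ∈ Finset.range n, b i)
    fun n => by
      rw [Finset.sum_range_succ, add_sub_add_left_eq_sub, add_sub_cancel_left]
      exact Ideal.pow_le_pow_right n.le_succ (hb n)
  refine ⟨fun n => ∑ i ∈ Finset.range n, c i, L, fun n => ?_, fun n => ?_⟩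
  · simp only [Finset.sum_range_succ, add_sub_cancel_left]
    exact hc n
  · have h3 : f (n + 1) = f 1 + ∑ i ∈ Finset.range n, (p * c i + b i) := by
      simp only [hcb]
      rw [Finset.sum_range_sub fun i => f (i + 1)]
      simp
    have h4 : f (n + 1) - L - p * ∑ i ∈ Finset.range n, c i =
        (f 1 + ∑ i ∈ Finset.range (n + 1), b i - L) - b n := by
      rw [h3, Finset.sum_add_distrib, Finset.sum_range_succ, Finset.mul_sum]
      ring
    rw [h4]
    exact Ideal.pow_right_mono le_sup_right _ (sub_mem (hL (n + 1)) (hb n))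

theorem IsPrecomplete.span_singleton_sup {A : Type*} [CommRing A] (p : A) (K : Ideal A)
    [IsPrecomplete (Ideal.span {p}) A] [IsPrecomplete K A] :
    IsPrecomplete (Ideal.span {p} ⊔ K) A := by
  set J := Ideal.span {p} ⊔ K
  have hp : p ∈ J := Ideal.mem_sup_left (Ideal.mem_span_singleton_self p)
  refine IsPrecomplete.of_exists_lim _ fun f hf => ?_
  choose s L hs hsL using IsPrecomplete.exists_shift p K
  let F : ℕ → {f : ℕ → A // ∀ n, f (n + 1) - f n ∈ J ^ n} := fun i =>
    (fun g => ⟨s g.1 g.2, hs g.1 g.2⟩)^[i] ⟨f, hf⟩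
  let l : ℕ → A := fun i => L (F i).1 (F i).2
  have hF (i n : ℕ) : (F i).1 (n + 1) - l i - p * (F (i + 1)).1 n ∈ J ^ (n + 1) := by
    have h := hsL (F i).1 (F i).2 n
    have h2 : (F (i + 1)).1 = s (F i).1 (F i).2 := by
      simp only [F, Function.iterate_succ_apply']
    rwa [h2]
  have h1 (n : ℕ) : ∀ i, (F i).1 n - ∑ j ∈ Finset.range n, p ^ j * l (i + j) ∈ J ^ n := by
    induction n with
    | zero => simp
    | succ n ih =>
      intro i
      have h3 := add_mem (hF i n) (by
        simpa only [← pow_succ'] using Ideal.mul_mem_mul hp (ih (i + 1)))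
      convert h3 using 1
      rw [Finset.sum_range_succ', mul_sub, Finset.mul_sum]
      have h5 : ∑ j ∈ Finset.range n, p ^ (j + 1) * l (i + (j + 1)) =
          ∑ j ∈ Finset.range n, p * (p ^ j * l (i + 1 + j)) :=
        Finset.sum_congr rfl fun j _ => by
          rw [pow_succ', mul_assoc, add_right_comm, add_assoc]
      rw [h5, pow_zero, one_mul, add_zero]
      ring
  obtain ⟨M, hM⟩ := IsPrecomplete.exists_lim (Ideal.span {p})
    (fun n => ∑ j ∈ Finset.range n, p ^ j * l j) fun n => by
      rw [Finset.sum_range_succ, add_sub_cancel_left]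
      exact Ideal.mul_mem_right _ _ (Ideal.pow_mem_pow (Ideal.mem_span_singleton_self p) n)
  refine ⟨M, fun n => ?_⟩
  have h4 := add_mem (h1 n 0) (Ideal.pow_right_mono le_sup_left n (hM n))
  simpa [F] using h4

instance MvPowerSeries.isPrecomplete_span_C {σ V : Type*} [CommRing V] (p : V)
    [IsPrecomplete (Ideal.span {p}) V] :
    IsPrecomplete (Ideal.span {MvPowerSeries.C (σ := σ) p}) (MvPowerSeries σ V) := by
  have h1 (n : ℕ) (f : MvPowerSeries σ V) :
      f ∈ Ideal.span {MvPowerSeries.C (σ := σ) p} ^ n ↔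
        ∀ α, MvPowerSeries.coeff α f ∈ Ideal.span {p} ^ n := by
    simp only [Ideal.span_singleton_pow, Ideal.mem_span_singleton, ← map_pow]
    constructor
    · rintro ⟨g, rfl⟩ α
      exact ⟨_, MvPowerSeries.coeff_C_mul _ _ _⟩
    · intro h
      choose g hg using h
      refine ⟨(g : MvPowerSeries σ V), ?_⟩
      ext α
      exact (hg α).trans (MvPowerSeries.coeff_C_mul α (g : MvPowerSeries σ V) (p ^ n)).symm
  refine IsPrecomplete.of_exists_lim _ fun f hf => ?_
  have h2 (α : σ →₀ ℕ) := IsPrecomplete.exists_lim (Ideal.span {p})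
    (fun n => MvPowerSeries.coeff α (f n)) fun n => by
      rw [← map_sub]
      exact (h1 _ _).1 (hf n) α
  choose L hL using h2
  let M : MvPowerSeries σ V := L
  refine ⟨M, fun n => (h1 _ _).2 fun α => ?_⟩
  rw [map_sub]
  exact hL α n

end Precomplete

section FiniteOfComplete

theorem IsPrecomplete.pi {A ι : Type*} [CommRing A] [Finite ι] (J : Ideal A) [IsPrecomplete J A] :
    IsPrecomplete J (ι → A) := by
  have := Fintype.ofFinite ι
  classical
  have h1 (n : ℕ) (f : ι → A) (hf : f ∈ J ^ n • (⊤ : Submodule A (ι → A))) (i : ι) :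
      f i ∈ J ^ n • (⊤ : Submodule A A) := by
    have := Submodule.mem_map_of_mem (f := LinearMap.proj (R := A) (φ := fun _ : ι => A) i) hf
    rw [Submodule.map_smul''] at this
    exact Submodule.smul_mono le_rfl le_top this
  have h2 (n : ℕ) (f : ι → A) (hf : ∀ i, f i ∈ J ^ n • (⊤ : Submodule A A)) :
      f ∈ J ^ n • (⊤ : Submodule A (ι → A)) := by
    rw [pi_eq_sum_univ f]
    refine Submodule.sum_mem _ fun i _ => Submodule.smul_mem_smul ?_ trivial
    simpa using hf i
  refine ⟨fun f hf => ?_⟩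
  have h3 (i : ι) : ∃ L : A, ∀ n, f n i ≡ L [SMOD (J ^ n • ⊤ : Submodule A A)] := by
    refine IsPrecomplete.prec ‹_› fun {m n} hmn => ?_
    have := hf hmn
    rw [SModEq.sub_mem] at this ⊢
    exact h1 _ _ this i
  choose L hL using h3
  refine ⟨L, fun n => ?_⟩
  rw [SModEq.sub_mem]
  refine h2 _ _ fun i => ?_
  have := hL i n
  rwa [SModEq.sub_mem] at this

/-- A ring that is separated for the extension of `J`, where `A` is `J`-adically complete, is finite
over `A` as soon as the extension of `J` contains a power of a finitely generated ideal modulo which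
`A` is everything. -/
theorem finite_of_isPrecomplete {A C : Type*} [CommRing A] [CommRing C] [Algebra A C]
    (J : Ideal A) [IsPrecomplete J A] (m : Ideal C) (hm : m.FG) [IsHausdorff m C]
    (hJ : J.map (algebraMap A C) ≤ m) (N : ℕ) (hN : m ^ N ≤ J.map (algebraMap A C))
    (hs : ∀ c : C, ∃ a : A, c - algebraMap A C a ∈ m) : Module.Finite A C := by
  have h1 (n : ℕ) : ∃ F : Submodule A C, F.FG ∧ ∀ c, ∃ f ∈ F, c - f ∈ m ^ n := by
    induction n with
    | zero => exact ⟨⊥, Submodule.fg_bot, fun c => ⟨0, zero_mem _, by simp⟩⟩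
    | succ n ih =>
      obtain ⟨F, hF, h⟩ := ih
      obtain ⟨s, hs'⟩ := hm.pow (n := n)
      refine ⟨F ⊔ Submodule.span A s, hF.sup (Submodule.fg_span s.finite_toSet), fun c => ?_⟩
      obtain ⟨f, hf, hcf⟩ := h c
      have h2 : ∀ x ∈ m ^ n, ∃ y ∈ Submodule.span A (s : Set C), x - y ∈ m ^ (n + 1) := by
        intro x hx
        rw [← hs'] at hx
        induction hx using Submodule.span_induction with
        | mem x hx => exact ⟨x, Submodule.subset_span hx, by simp⟩
        | zero => exact ⟨0, zero_mem _, by simp⟩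
        | add x y hx hy ihx ihy =>
          obtain ⟨x', hx', hx''⟩ := ihx
          obtain ⟨y', hy', hy''⟩ := ihy
          refine ⟨x' + y', add_mem hx' hy', ?_⟩
          rw [add_sub_add_comm]
          exact add_mem hx'' hy''
        | smul r x hx ihx =>
          obtain ⟨x', hx', hx''⟩ := ihx
          obtain ⟨a, ha⟩ := hs r
          refine ⟨a • x', Submodule.smul_mem _ _ hx', ?_⟩
          have h3 : r • x - a • x' = (r - algebraMap A C a) * x + algebraMap A C a * (x - x') := by
            rw [Algebra.smul_def a, smul_eq_mul]; ring
          rw [h3]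
          refine add_mem ?_ (Ideal.mul_mem_left _ _ hx'')
          rw [pow_succ']
          exact Ideal.mul_mem_mul ha (hs' ▸ hx)
      obtain ⟨y, hy, hxy⟩ := h2 _ hcf
      exact ⟨f + y, Submodule.add_mem_sup hf hy, by rwa [sub_add_eq_sub_sub]⟩
  obtain ⟨F, hF, h⟩ := h1 N
  have hH : IsHausdorff J C := IsHausdorff.of_map hJ
  obtain ⟨k, g, hg⟩ := Submodule.fg_iff_exists_fin_generating_family.1 hF
  have := IsPrecomplete.pi (ι := Fin k) J
  let f : (Fin k → A) →ₗ[A] C := Fintype.linearCombination A g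
  refine Module.Finite.of_surjective f (surjective_of_mkQ_comp_surjective (I := J) ?_)
  intro z
  obtain ⟨c, rfl⟩ := Submodule.mkQ_surjective _ z
  obtain ⟨y, hy, hcy⟩ := h c
  rw [← hg, ← Fintype.range_linearCombination] at hy
  obtain ⟨a, rfl⟩ := hy
  refine ⟨a, ?_⟩
  rw [LinearMap.comp_apply, ← sub_eq_zero, ← map_sub, Submodule.mkQ_apply,
    Submodule.Quotient.mk_eq_zero, Ideal.smul_top_eq_map, ← neg_mem_iff, neg_sub]
  exact hN hcy

end FiniteOfComplete

section Dimension

theorem ringKrullDim_le_of_isIntegral {A C : Type*} [CommRing A] [CommRing C] [Algebra A C]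
    [Algebra.IsIntegral A C] (hinj : Function.Injective (algebraMap A C)) :
    ringKrullDim A ≤ ringKrullDim C := by
  refine iSup_le fun l => ?_
  obtain ⟨Q, -, hQ, hQl⟩ := Ideal.exists_ideal_over_prime_of_isIntegral (S := C) l.head.asIdeal ⊥ (by
    rw [← RingHom.ker_eq_comap_bot, (RingHom.injective_iff_ker_eq_bot _).1 hinj]
    exact bot_le)
  have : Q.LiesOver l.head.asIdeal := ⟨hQl.symm⟩
  obtain ⟨L, hL, -⟩ := Ideal.exists_ltSeries_of_hasGoingUp l Q
  rw [← hL]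
  exact Order.LTSeries.length_le_krullDim L

theorem exists_prime_injective {A C : Type*} [CommRing A] [IsDomain A] [CommRing C] [Algebra A C]
    [Algebra.IsIntegral A C] (d : ℕ) (hA : ringKrullDim A ≤ d) (hC : (d : WithBot ℕ∞) ≤ ringKrullDim C) :
    ∃ P : Ideal C, P.IsPrime ∧ Function.Injective (algebraMap A (C ⧸ P)) := by
  obtain ⟨l, hl⟩ := Order.le_krullDim_iff.1 hC
  refine ⟨l.head.asIdeal, inferInstance, ?_⟩
  by_contra h
  have hmono : StrictMono (PrimeSpectrum.comap (algebraMap A C)) := fun P Q hPQ =>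
    Ideal.IsIntegral.comap_lt_comap hPQ
  let L := (l.map _ hmono).cons ⟨⊥, Ideal.isPrime_bot⟩ (by
    refine lt_of_le_of_ne (bot_le (a := Ideal.comap (algebraMap A C) l.head.asIdeal))
      fun h2 => h ?_
    rw [RingHom.injective_iff_ker_eq_bot, IsScalarTower.algebraMap_eq A C, ← RingHom.comap_ker,
      Ideal.Quotient.algebraMap_eq, Ideal.mk_ker]
    exact h2.symm)
  have h1 := (Order.LTSeries.length_le_krullDim L).trans hA
  have h2 : L.length = d + 1 := by
    rw [← hl]
    exact RelSeries.cons_length ..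
  rw [h2] at h1
  exact absurd (WithBot.coe_le_coe.1 h1) (by simp; exact_mod_cast Nat.lt_succ_self d)

theorem ringKrullDim_le_length {A : Type*} [CommRing A] [IsNoetherianRing A] [IsLocalRing A]
    (xs : List A) (h : (Ideal.ofList xs).radical = IsLocalRing.maximalIdeal A) :
    ringKrullDim A ≤ xs.length := by
  classical
  have h1 : IsLocalRing.maximalIdeal A ∈ (Ideal.span (xs.toFinset : Set A)).minimalPrimes := by
    rw [← Ideal.radical_minimalPrimes, List.coe_toFinset]
    have : (Ideal.span {a | a ∈ xs}).radical = IsLocalRing.maximalIdeal A := h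
    rw [this, Ideal.minimalPrimes_eq_subsingleton_self]
    rfl
  rw [← IsLocalRing.maximalIdeal_height_eq_ringKrullDim]
  refine WithBot.coe_le_coe.2 ((Ideal.height_le_card_of_mem_minimalPrimes_span_finset h1).trans ?_)
  exact_mod_cast xs.toFinset_card_le

theorem MvPowerSeries.mem_span_range_X {σ V : Type*} [Finite σ] [CommRing V] (f : MvPowerSeries σ V)
    (hf : MvPowerSeries.constantCoeff f = 0) :
    f ∈ Ideal.span (Set.range (MvPowerSeries.X : σ → MvPowerSeries σ V)) := by
  have h : Ideal.map (toAdicCompletionAlgEquiv σ V).toRingEquiv (Ideal.span (Set.range X)) =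
      (MvPolynomial.idealOfVars σ V).map (algebraMap ..) := by
    simp_rw [Ideal.map_span, ← Set.range_comp]
    congr 2; ext1
    simp [AdicCompletion.algebraMap_apply, ← MvPolynomial.coe_X, toAdicCompletion_coe]
  rw [← AdicCompletion.ker_evalOneₐ_eq_map _ (MvPolynomial.idealOfVars_fg σ V)] at h
  have h2 : (toAdicCompletionAlgEquiv σ V).toRingEquiv f ∈
      Ideal.map (toAdicCompletionAlgEquiv σ V).toRingEquiv (Ideal.span (Set.range X)) := by
    have h3 : truncTotal 1 f = 0 := by
      ext α
      by_cases hα : α = 0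
      · rw [coeff_truncTotal _ (by simp [hα]), hα]
        simpa using hf
      · rw [coeff_truncTotal_eq_zero]
        · simp
        · rwa [Nat.one_le_iff_ne_zero, ne_eq, Finsupp.degree_eq_zero_iff]
    have h4 : AdicCompletion.evalOneₐ (MvPolynomial.idealOfVars σ V)
        (toAdicCompletion σ V f) = 0 := by
      refine (AdicCompletion.evalOneₐ_liftAlgHom (MvPolynomial.idealOfVars σ V) (truncTotalAlgHom σ V)
        (fun h => AlgHom.ext fun _ => by
          simpa [Ideal.Quotient.mk_eq_mk_iff_sub_mem] using
            truncTotal_sub_truncTotal_mem_pow_idealOfVars h (le_refl _) _) f).trans ?_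
      rw [truncTotalAlgHom_apply, h3]
      simp
    rw [h]
    exact h4
  obtain ⟨g, hg, hgf⟩ := (Ideal.mem_map_of_equiv (toAdicCompletionAlgEquiv σ V).toRingEquiv _).1 h2
  rwa [(toAdicCompletionAlgEquiv σ V).toRingEquiv.injective hgf] at hg

end Dimension

section Feed

open IsLocalRing in
theorem MvPowerSeries.maximalIdeal_eq {σ V : Type*} [Finite σ] [CommRing V] [IsLocalRing V] (π : V)
    (hπ : maximalIdeal V = Ideal.span {π}) :
    maximalIdeal (MvPowerSeries σ V) =
      Ideal.span {MvPowerSeries.C π} ⊔ Ideal.span (Set.range MvPowerSeries.X) := by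
  apply le_antisymm
  · intro f hf
    have h1 : constantCoeff f ∈ maximalIdeal V := by
      rw [mem_maximalIdeal, mem_nonunits_iff, ← isUnit_iff_constantCoeff]
      exact hf
    rw [hπ, Ideal.mem_span_singleton] at h1
    obtain ⟨c, hc⟩ := h1
    rw [← add_sub_cancel (C (constantCoeff f)) f]
    refine Submodule.add_mem_sup ?_ (mem_span_range_X _ (by simp))
    rw [hc, map_mul]
    exact Ideal.mul_mem_right _ _ (Ideal.mem_span_singleton_self _)
  · have hπ' : π ∈ maximalIdeal V := hπ ▸ Ideal.mem_span_singleton_self π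
    refine sup_le ?_ ?_
    · rw [Ideal.span_singleton_le_iff_mem, mem_maximalIdeal, mem_nonunits_iff,
        isUnit_iff_constantCoeff, constantCoeff_C]
      exact hπ'
    · rw [Ideal.span_le]
      rintro _ ⟨s, rfl⟩
      rw [SetLike.mem_coe, mem_maximalIdeal, mem_nonunits_iff, isUnit_iff_constantCoeff,
        constantCoeff_X]
      exact not_isUnit_zero

/-- The structure-theoretic input of the construction: `ψ` presents the complete local ring `C` as a
finite extension of a power series ring, and `φ` is a stage over the latter. -/
theorem StageClass.exists_regMod_of_isAdicComplete
    {T : ∀ (S : Type u) [CommRing S], List S → Prop} (hT : StageClass T)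
    {V : Type u} [CommRing V] [IsDomain V] [IsNoetherianRing V] [IsLocalRing V] (π : V)
    (hπ : IsLocalRing.maximalIdeal V = Ideal.span {π}) [IsPrecomplete (Ideal.span {π}) V] {e : ℕ}
    (ξ : List (MvPowerSeries (Fin e) V))
    (hξ : Ideal.ofList ξ = IsLocalRing.maximalIdeal (MvPowerSeries (Fin e) V))
    {C : Type u} [CommRing C] [IsLocalRing C] (hC : (IsLocalRing.maximalIdeal C).FG)
    [IsHausdorff (IsLocalRing.maximalIdeal C) C] (ψ : MvPowerSeries (Fin e) V →+* C)
    (hψ : (Ideal.ofList (ξ.map ψ)).radical = IsLocalRing.maximalIdeal C)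
    (hs : ∀ c : C, ∃ v : V, c - ψ (MvPowerSeries.C v) ∈ IsLocalRing.maximalIdeal C)
    (hdim : IsNoetherianRing C → (ξ.length : WithBot ℕ∞) ≤ ringKrullDim C)
    {S : Type u} [CommRing S] (φ : MvPowerSeries (Fin e) V →+* S) (hφ : T S (ξ.map φ)) :
    ∃ (B : Type u) (_ : CommRing B) (g : C →+* B),
      RegMod ⊥ (ξ.map fun x => g (ψ x)) ∧ Ideal.ofList (ξ.map fun x => g (ψ x)) ≠ ⊤ := by
  let := ψ.toAlgebra
  have hmap : (IsLocalRing.maximalIdeal (MvPowerSeries (Fin e) V)).map (algebraMap (MvPowerSeries (Fin e) V) C) = Ideal.ofList (ξ.map ψ) := by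
    rw [← hξ, Ideal.map_ofList]
    rfl
  have hle : (IsLocalRing.maximalIdeal (MvPowerSeries (Fin e) V)).map (algebraMap (MvPowerSeries (Fin e) V) C) ≤ IsLocalRing.maximalIdeal C := by
    rw [hmap, ← hψ]
    exact Ideal.le_radical
  obtain ⟨N, hN⟩ := Ideal.exists_pow_le_of_le_radical_of_fg hψ.ge hC
  have hJ := MvPowerSeries.maximalIdeal_eq (σ := Fin e) π hπ
  have : IsPrecomplete (IsLocalRing.maximalIdeal (MvPowerSeries (Fin e) V)) (MvPowerSeries (Fin e) V) := by
    rw [hJ]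
    exact IsPrecomplete.span_singleton_sup _ _
  have hfin : Module.Finite (MvPowerSeries (Fin e) V) C :=
    finite_of_isPrecomplete (IsLocalRing.maximalIdeal (MvPowerSeries (Fin e) V)) (IsLocalRing.maximalIdeal C) hC hle N
      (hmap.symm ▸ hN) fun c => (hs c).imp' _ fun _ => id
  have hCN : IsNoetherianRing C := IsNoetherianRing.of_finite (MvPowerSeries (Fin e) V) C
  have hdimA : ringKrullDim (MvPowerSeries (Fin e) V) ≤ ξ.length := ringKrullDim_le_length ξ (by
    rw [hξ]
    exact Ideal.IsPrime.radical inferInstance)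
  have : IsDomain (MvPowerSeries (Fin e) V) := NoZeroDivisors.to_isDomain _
  obtain ⟨P, hP, hinj⟩ := exists_prime_injective (A := MvPowerSeries (Fin e) V) (C := C) ξ.length hdimA
    (hdim hCN)
  obtain ⟨B, _, g, hg⟩ := hT.exists_regMod ξ hdimA hinj φ hφ
  exact ⟨B, inferInstance, g.comp (Ideal.Quotient.mk P), hg⟩

end Feed

section SystemsOfParameters

open IsLocalRing

theorem radical_eq_maximalIdeal_of_mem_minimalPrimes {R : Type*} [CommRing R] [IsLocalRing R]
    {I : Ideal R} (h : maximalIdeal R ∈ I.minimalPrimes) : I.radical = maximalIdeal R := by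
  rw [← Ideal.sInf_minimalPrimes]
  refine le_antisymm (sInf_le h) (le_sInf fun P hP => ?_)
  have := hP.1.1
  exact h.2 hP.1 (le_maximalIdeal hP.1.1.ne_top)

theorem exists_isSOP (R : Type*) [CommRing R] [IsNoetherianRing R] [IsLocalRing R] :
    ∃ xs : List R, IsSOP R xs := by
  obtain ⟨s, hs, hc⟩ := Ideal.exists_finset_card_eq_height_of_isNoetherianRing (maximalIdeal R)
  refine ⟨s.toList, fun x hx => hs.1.2 (Ideal.subset_span (Finset.mem_toList.1 hx)), ?_, ?_⟩
  · rw [← maximalIdeal_height_eq_ringKrullDim, ← hc, Finset.length_toList]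
    rfl
  · simpa using radical_eq_maximalIdeal_of_mem_minimalPrimes hs

theorem exists_isSOP_cons {R : Type*} [CommRing R] [IsDomain R] [IsNoetherianRing R]
    [IsLocalRing R] {π : R} (h0 : π ≠ 0) (hπ : π ∈ maximalIdeal R) :
    ∃ ys : List R, IsSOP R (π :: ys) := by
  have hne : Ideal.span {π} ≠ ⊤ := fun h => (mem_maximalIdeal π).1 hπ (Ideal.span_singleton_eq_top.1 h)
  have : Nontrivial (R ⧸ Ideal.span {π}) := Ideal.Quotient.nontrivial_iff.2 hne
  have : IsLocalRing (R ⧸ Ideal.span {π}) := .of_surjective' _ Ideal.Quotient.mk_surjective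
  have : IsLocalHom (Ideal.Quotient.mk (Ideal.span {π})) :=
    .of_surjective _ Ideal.Quotient.mk_surjective
  obtain ⟨zs, hz, hl, hr⟩ := exists_isSOP (R ⧸ Ideal.span {π})
  obtain ⟨ys, rfl⟩ := List.map_surjective_iff.2 Ideal.Quotient.mk_surjective zs
  refine ⟨ys, ?_, ?_, ?_⟩
  · rintro x (_ | ⟨_, hx⟩)
    · exact hπ
    · have := hz _ (List.mem_map_of_mem hx)
      rwa [← Ideal.mem_comap, maximalIdeal_comap] at this
  · rw [← ringKrullDim_quotient_span_singleton_succ_eq_ringKrullDim_of_mem_nonZeroDivisors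
      (mem_nonZeroDivisors_of_ne_zero h0) hπ, ← hl]
    simp
  · change (Ideal.ofList (π :: ys)).radical = _
    rw [← maximalIdeal_comap (Ideal.Quotient.mk (Ideal.span {π})), ← hr, Ideal.comap_radical]
    change _ = ((Ideal.ofList (ys.map _)).comap _).radical
    rw [← Ideal.map_ofList, Ideal.comap_map_of_surjective _ Ideal.Quotient.mk_surjective,
      ← RingHom.ker_eq_comap_bot, Ideal.mk_ker, sup_comm, Ideal.ofList_cons]

theorem IsBalancedBigCM.of_quotient {R B : Type*} [CommRing R] [IsLocalRing R] (P : Ideal R)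
    [P.IsPrime] [IsLocalRing (R ⧸ P)] (hdim : ringKrullDim (R ⧸ P) = ringKrullDim R) [CommRing B]
    [Algebra R B] [Algebra (R ⧸ P) B] [IsScalarTower R (R ⧸ P) B]
    (h : IsBalancedBigCM (R ⧸ P) B) : IsBalancedBigCM R B := by
  have : IsLocalHom (Ideal.Quotient.mk P) := .of_surjective _ Ideal.Quotient.mk_surjective
  have hm : maximalIdeal (R ⧸ P) = (maximalIdeal R).map (algebraMap R (R ⧸ P)) := by
    rw [← maximalIdeal_comap (Ideal.Quotient.mk P)]
    exact (Ideal.map_comap_of_surjective _ Ideal.Quotient.mk_surjective _).symm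
  refine ⟨?_, fun xs hxs => ?_⟩
  · rw [IsScalarTower.algebraMap_eq R (R ⧸ P) B, ← Ideal.map_map, ← hm]
    exact h.1
  · rw [← RingTheory.Sequence.isWeaklyRegular_map_algebraMap_iff (R ⧸ P)]
    refine h.2 _ ⟨fun y hy => ?_, ?_, ?_⟩
    · obtain ⟨x, hx, rfl⟩ := List.mem_map.1 hy
      exact hm ▸ Ideal.mem_map_of_mem _ (hxs.1 x hx)
    · rw [hdim, List.length_map, hxs.2.1]
    · apply Ideal.comap_injective_of_surjective _ (Ideal.Quotient.mk_surjective (I := P))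
      change Ideal.comap _ (Ideal.ofList (xs.map (Ideal.Quotient.mk P))).radical = _
      rw [maximalIdeal_comap, Ideal.comap_radical, ← Ideal.map_ofList,
        Ideal.comap_map_of_surjective _ Ideal.Quotient.mk_surjective, ← RingHom.ker_eq_comap_bot,
        Ideal.mk_ker]
      have h3 : (Ideal.ofList xs).radical = maximalIdeal R := hxs.2.2
      apply le_antisymm
      · refine (Ideal.radical_mono (sup_le (Ideal.le_radical.trans h3.le)
          (le_maximalIdeal Ideal.IsPrime.ne_top'))).trans ?_
        rw [Ideal.IsPrime.radical inferInstance]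
      · exact h3.ge.trans (Ideal.radical_mono le_sup_left)

theorem exists_prime_ringKrullDim_quotient_eq (R : Type*) [CommRing R] [IsNoetherianRing R]
    [IsLocalRing R] : ∃ P : Ideal R, P.IsPrime ∧ ringKrullDim (R ⧸ P) = ringKrullDim R := by
  obtain ⟨xs, -, hxs, -⟩ := exists_isSOP R
  obtain ⟨l, hl⟩ := Order.le_krullDim_iff.1 hxs.le
  refine ⟨l.head.asIdeal, inferInstance, le_antisymm (ringKrullDim_quotient_le _) ?_⟩
  rw [← hxs, ringKrullDim_quotient, ← hl]
  refine Order.LTSeries.length_le_krullDim (α := PrimeSpectrum.zeroLocus (l.head.asIdeal : Set R))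
    ⟨l.length, fun i => ⟨l i, LTSeries.head_le l i⟩, fun i => l.step i⟩

end SystemsOfParameters

section PerfectResidueField

open IsLocalRing Polynomial

/-- The extension of `m` to `T` is the unit ideal or a maximal ideal. -/
def MaximalAbove {R : Type*} [CommRing R] (m : Ideal R) (T : Type*) [CommRing T] [Algebra R T] :
    Prop :=
  ∀ t : T, t ∈ m.map (algebraMap R T) ∨ ∃ s, t * s - 1 ∈ m.map (algebraMap R T)

variable {R : Type*} [CommRing R]

theorem MaximalAbove.isMaximal {m : Ideal R} {T : Type*} [CommRing T] [Algebra R T]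
    (h : MaximalAbove m T) (hne : m.map (algebraMap R T) ≠ ⊤) :
    (m.map (algebraMap R T)).IsMaximal := by
  refine Ideal.isMaximal_iff.2 ⟨(Ideal.ne_top_iff_one _).1 hne, fun J t hJ ht htJ => ?_⟩
  obtain ⟨s, hs⟩ := (h t).resolve_left ht
  rw [← sub_sub_cancel (t * s) 1]
  exact J.sub_mem (J.mul_mem_right _ htJ) (hJ hs)

theorem MaximalAbove.isLocalRing [IsLocalRing R] {T : Type*} [CommRing T] [Algebra R T]
    [Algebra.IsIntegral R T] (hinj : Function.Injective (algebraMap R T))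
    (h : MaximalAbove (maximalIdeal R) T) :
    ∃ _ : IsLocalRing T, maximalIdeal T = (maximalIdeal R).map (algebraMap R T) := by
  obtain ⟨Q, hQ, hQm⟩ := Ideal.exists_ideal_over_maximal_of_isIntegral (S := T) (maximalIdeal R) (by
    rw [(RingHom.injective_iff_ker_eq_bot _).1 hinj]
    exact bot_le)
  have hle : (maximalIdeal R).map (algebraMap R T) ≤ Q := Ideal.map_le_iff_le_comap.2 hQm.ge
  have hM := h.isMaximal fun h2 => hQ.ne_top (top_le_iff.1 (h2 ▸ hle))
  have hloc : IsLocalRing T := .of_unique_max_ideal ⟨_, hM, fun N hN => by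
    have := Ideal.isMaximal_comap_of_isIntegral_of_isMaximal (R := R) N
    exact (hM.eq_of_le hN.ne_top
      (Ideal.map_le_iff_le_comap.2 (eq_maximalIdeal this).ge)).symm⟩
  exact ⟨hloc, (eq_maximalIdeal hM).symm⟩

theorem MaximalAbove.adjoin_root {m : Ideal R} {T T' : Type*} [CommRing T] [CommRing T']
    [Algebra R T] [Algebra R T'] [Algebra T T'] [IsScalarTower R T T'] {p : ℕ} (hp : p.Prime)
    (hT : (m.map (algebraMap R T)).IsMaximal) (r : T)
    (hr : ∀ q : T, q ^ p - r ∉ m.map (algebraMap R T)) (ζ : T') (hζ : ζ ^ p = algebraMap T T' r)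
    (hs : Function.Surjective (aeval ζ : T[X] →ₐ[T] T')) : MaximalAbove m T' := by
  let I := m.map (algebraMap R T)
  have : I.IsMaximal := hT
  let := Ideal.Quotient.field I
  have key : ∀ H : T[X], H.map (Ideal.Quotient.mk I) = 0 → aeval ζ H ∈ m.map (algebraMap R T') := by
    intro H hH
    have h1 : H ∈ I.map (C : T →+* T[X]) := Ideal.mem_map_C_iff.2 fun n => by
      rw [← Ideal.Quotient.eq_zero_iff_mem, ← coeff_map, hH, coeff_zero]
    have h2 := Ideal.mem_map_of_mem (aeval ζ : T[X] →ₐ[T] T').toRingHom h1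
    rw [Ideal.map_map, Ideal.map_map] at h2
    have h3 : ((aeval ζ : T[X] →ₐ[T] T').toRingHom.comp C).comp (algebraMap R T) =
        algebraMap R T' := by
      ext x
      simp [← IsScalarTower.algebraMap_apply]
    rwa [h3] at h2
  have hirr : Irreducible (X ^ p - C (Ideal.Quotient.mk I r)) :=
    X_pow_sub_C_irreducible_of_prime hp fun b hb => by
      obtain ⟨q, rfl⟩ := Ideal.Quotient.mk_surjective b
      exact hr q (by rwa [← Ideal.Quotient.eq, map_pow])
  intro t
  obtain ⟨F, rfl⟩ := hs t
  have hsurj := Polynomial.map_surjective _ (Ideal.Quotient.mk_surjective (I := I))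
  by_cases hd : X ^ p - C (Ideal.Quotient.mk I r) ∣ F.map (Ideal.Quotient.mk I)
  · left
    obtain ⟨G, hG⟩ := hd
    obtain ⟨G, rfl⟩ := hsurj G
    have := key (F - (X ^ p - C r) * G) (by simp [hG])
    simpa [hζ] using this
  · right
    obtain ⟨K, G, hKG⟩ := (hirr.coprime_iff_not_dvd).2 hd
    obtain ⟨G, rfl⟩ := hsurj G
    obtain ⟨K, rfl⟩ := hsurj K
    refine ⟨aeval ζ G, ?_⟩
    have := key (F * G - 1 + K * (X ^ p - C r)) (by
      simp only [Polynomial.map_sub, Polynomial.map_add, Polynomial.map_mul, Polynomial.map_pow, map_X, map_C, Polynomial.map_one]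
      linear_combination hKG)
    simpa [hζ] using this

theorem MaximalAbove.of_directed {m : Ideal R} {Ω : Type*} [CommRing Ω] [Algebra R Ω]
    {ι : Type*} [Nonempty ι] (K : ι → Subalgebra R Ω) (hK : Directed (· ≤ ·) K)
    (h : ∀ i, MaximalAbove m (K i)) : MaximalAbove m (iSup K : Subalgebra R Ω) := by
  rintro ⟨t, ht⟩
  rw [← SetLike.mem_coe, Subalgebra.coe_iSup_of_directed hK] at ht
  obtain ⟨i, hi⟩ := Set.mem_iUnion.1 ht
  have hmap : ∀ x : K i, x ∈ m.map (algebraMap R (K i)) →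
      Subalgebra.inclusion (le_iSup K i) x ∈ m.map (algebraMap R (iSup K : Subalgebra R Ω)) := by
    intro x hx
    have := Ideal.mem_map_of_mem (Subalgebra.inclusion (le_iSup K i)).toRingHom hx
    rw [Ideal.map_map] at this
    exact this
  obtain h1 | ⟨s, hs⟩ := h i ⟨t, hi⟩
  · exact .inl (hmap _ h1)
  · exact .inr ⟨Subalgebra.inclusion (le_iSup K i) s, by simpa using hmap _ hs⟩

theorem MaximalAbove.bot {R Ω : Type*} [CommRing R] [IsLocalRing R] [CommRing Ω] [Algebra R Ω] :
    MaximalAbove (maximalIdeal R) (⊥ : Subalgebra R Ω) := by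
  rintro ⟨x, hx⟩
  obtain ⟨r, rfl⟩ := Algebra.mem_bot.1 hx
  by_cases hr : r ∈ maximalIdeal R
  · exact .inl (Ideal.mem_map_of_mem (algebraMap R (⊥ : Subalgebra R Ω)) hr)
  · obtain ⟨s, hs⟩ := (notMem_maximalIdeal.1 hr).exists_right_inv
    refine .inr ⟨algebraMap R _ s, ?_⟩
    suffices h : (⟨algebraMap R Ω r, hx⟩ : (⊥ : Subalgebra R Ω)) * algebraMap R _ s - 1 = 0 from
      h ▸ zero_mem _
    rw [sub_eq_zero]
    exact Subtype.ext ((map_mul (algebraMap R Ω) r s).symm.trans (by rw [hs, map_one]; rfl))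

theorem exists_maximal_maximalAbove (R Ω : Type*) [CommRing R] [IsLocalRing R] [CommRing Ω]
    [Algebra R Ω] : ∃ T : Subalgebra R Ω, Maximal (fun T : Subalgebra R Ω =>
      (∀ t ∈ T, IsIntegral R t) ∧ MaximalAbove (maximalIdeal R) T) T := by
  refine (zorn_le_nonempty₀ {T : Subalgebra R Ω |
    (∀ t ∈ T, IsIntegral R t) ∧ MaximalAbove (maximalIdeal R) T} ?_ ⊥ ⟨?_, .bot⟩).imp fun _ h => h.2
  · intro c hc hch y hy
    have : Nonempty c := ⟨⟨y, hy⟩⟩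
    have hd : Directed (· ≤ ·) (fun T : c => (T : Subalgebra R Ω)) := hch.directed
    refine ⟨⨆ T : c, (T : Subalgebra R Ω), ⟨fun t ht => ?_, .of_directed _ hd fun T => (hc T.2).2⟩,
      fun z hz => le_iSup (fun T : c => (T : Subalgebra R Ω)) ⟨z, hz⟩⟩
    rw [← SetLike.mem_coe, Subalgebra.coe_iSup_of_directed hd] at ht
    obtain ⟨i, hi⟩ := Set.mem_iUnion.1 ht
    exact (hc i.2).1 t hi
  · intro t ht
    obtain ⟨r, rfl⟩ := Algebra.mem_bot.1 ht
    exact isIntegral_algebraMap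

theorem MaximalAbove.adjoin {Ω : Type*} [CommRing Ω] [Algebra R Ω] {m : Ideal R}
    (T : Subalgebra R Ω) {p : ℕ} (hp : p.Prime) (hT : (m.map (algebraMap R T)).IsMaximal) (r : T)
    (hr : ∀ q : T, q ^ p - r ∉ m.map (algebraMap R T)) (ζ : Ω) (hζ : ζ ^ p = r) :
    MaximalAbove m (Algebra.adjoin T {ζ}) := by
  refine .adjoin_root hp hT r hr ⟨ζ, Algebra.subset_adjoin rfl⟩ (Subtype.ext hζ) ?_
  rintro ⟨x, hx⟩
  have hx' := hx
  rw [Algebra.adjoin_singleton_eq_range_aeval] at hx'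
  obtain ⟨F, rfl⟩ := hx'
  exact ⟨F, Subtype.ext (by rw [Polynomial.coe_aeval_mk_apply]; rfl)⟩

theorem exists_perfect_residue_extension_of_isAlgClosed {R : Type*} {Ω : Type u} [CommRing R]
    [IsLocalRing R] [Field Ω] [IsAlgClosed Ω] [Algebra R Ω]
    (hinj : Function.Injective (algebraMap R Ω)) (p : ℕ) (hp : p.Prime) :
    ∃ (T : Type u) (_ : CommRing T) (_ : IsLocalRing T) (_ : Algebra R T),
      Algebra.IsIntegral R T ∧ Function.Injective (algebraMap R T) ∧
      maximalIdeal T = (maximalIdeal R).map (algebraMap R T) ∧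
      ∀ r : T, ∃ q, q ^ p - r ∈ maximalIdeal T := by
  obtain ⟨T, ⟨hTi, hTm⟩, hmax⟩ := exists_maximal_maximalAbove R Ω
  have hinj' : Function.Injective (algebraMap R T) := fun x y hxy =>
    hinj (congrArg Subtype.val hxy)
  have hTi' : Algebra.IsIntegral R T :=
    ⟨fun x => (isIntegral_algHom_iff T.val Subtype.val_injective).1 (hTi x x.2)⟩
  obtain ⟨hloc, hmT⟩ := hTm.isLocalRing hinj'
  refine ⟨T, inferInstance, hloc, inferInstance, hTi', hinj', hmT, fun r => ?_⟩
  by_contra! hr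
  obtain ⟨ζ, hζ⟩ := IsAlgClosed.exists_pow_nat_eq (r : Ω) hp.pos
  have hζi : IsIntegral T ζ := .of_pow hp.pos (by
    rw [hζ]
    exact isIntegral_algebraMap (x := r))
  have hint : ∀ t ∈ Algebra.adjoin T {ζ}, IsIntegral R t := fun t ht =>
    isIntegral_trans t (IsIntegral.of_mem_of_fg _ hζi.fg_adjoin_singleton t ht)
  have hMA := MaximalAbove.adjoin T hp (m := maximalIdeal R) (by
    rw [← hmT]
    infer_instance) r (by rwa [← hmT]) ζ hζ
  have hTle : T ≤ (Algebra.adjoin T {ζ}).restrictScalars R := fun t ht =>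
    (Algebra.adjoin T {ζ}).algebraMap_mem ⟨t, ht⟩
  have hle : (Algebra.adjoin T {ζ}).restrictScalars R ≤ T := hmax ⟨hint, hMA⟩ hTle
  obtain ⟨z, rfl⟩ : ∃ z : T, (z : Ω) = ζ :=
    ⟨⟨ζ, hle (Algebra.self_mem_adjoin_singleton T ζ)⟩, rfl⟩
  have hz : z ^ p = r := Subtype.ext (by rw [Subalgebra.coe_pow, hζ])
  exact hr z (by simp [hz])

theorem exists_perfect_residue_extension (R : Type u) [CommRing R] [IsDomain R] [IsLocalRing R]
    (p : ℕ) (hp : p.Prime) :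
    ∃ (T : Type u) (_ : CommRing T) (_ : IsLocalRing T) (_ : Algebra R T),
      Algebra.IsIntegral R T ∧ Function.Injective (algebraMap R T) ∧
      maximalIdeal T = (maximalIdeal R).map (algebraMap R T) ∧
      ∀ r : T, ∃ q, q ^ p - r ∈ maximalIdeal T := by
  refine exists_perfect_residue_extension_of_isAlgClosed (Ω := AlgebraicClosure (FractionRing R))
    ?_ p hp
  rw [IsScalarTower.algebraMap_eq R (FractionRing R)]
  exact (algebraMap (FractionRing R) _).injective.comp (IsFractionRing.injective R _)

end PerfectResidueField

section CompletedDimension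

open IsLocalRing

theorem AdicCompletion.mem_map_pow_iff {T : Type*} [CommRing T] {I : Ideal T} (hI : I.FG) (n : ℕ)
    (x : AdicCompletion I T) :
    x ∈ (I ^ n).map (algebraMap T (AdicCompletion I T)) ↔ AdicCompletion.eval I T n x = 0 := by
  rw [← LinearMap.mem_ker, ← AdicCompletion.pow_smul_top_eq_ker_eval hI, Ideal.smul_top_eq_map]
  rfl

theorem AdicCompletion.exists_sub_mem {T : Type*} [CommRing T] {I : Ideal T} (hI : I.FG) (n : ℕ)
    (x : AdicCompletion I T) :
    ∃ t, x - algebraMap T _ t ∈ (I ^ n).map (algebraMap T (AdicCompletion I T)) := by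
  obtain ⟨t, ht⟩ := Submodule.mkQ_surjective _ (AdicCompletion.eval I T n x)
  refine ⟨t, (AdicCompletion.mem_map_pow_iff hI n _).2 ?_⟩
  rw [map_sub, sub_eq_zero, ← ht]
  exact (AdicCompletion.eval_of I T n t).symm

theorem AdicCompletion.mem_pow_of_algebraMap_mem {T : Type*} [CommRing T] {I : Ideal T}
    (hI : I.FG) (n : ℕ) (t : T)
    (h : algebraMap T _ t ∈ (I ^ n).map (algebraMap T (AdicCompletion I T))) : t ∈ I ^ n := by
  rw [AdicCompletion.mem_map_pow_iff hI] at h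
  have := (AdicCompletion.eval_of I T n t).symm.trans h
  rw [Submodule.mkQ_apply, Submodule.Quotient.mk_eq_zero] at this
  simpa using this

theorem pow_le_span_of_approx {T C : Type*} [CommRing T] [CommRing C] [Algebra T C] [IsLocalRing T]
    (hT : (maximalIdeal T).FG)
    (happ : ∀ n (c : C), ∃ t, c - algebraMap T C t ∈ (maximalIdeal T ^ n).map (algebraMap T C))
    (hcomap : ∀ n t, algebraMap T C t ∈ (maximalIdeal T ^ n).map (algebraMap T C) →
      t ∈ maximalIdeal T ^ n) {e N : ℕ} (y : Fin e → C)
    (hy : (maximalIdeal T ^ N).map (algebraMap T C) ≤ Ideal.span (Set.range y)) (t : Fin e → T)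
    (ht : ∀ i, y i - algebraMap T C (t i) ∈ (maximalIdeal T ^ (N + 1)).map (algebraMap T C)) :
    maximalIdeal T ^ N ≤ Ideal.span (Set.range t) := by
  refine Submodule.le_of_le_smul_of_le_jacobson_bot (I := maximalIdeal T) (hT.pow (n := N))
    (jacobson_eq_maximalIdeal ⊥ bot_ne_top).ge ?_
  intro z hz
  obtain ⟨c, hc⟩ := Ideal.mem_span_range_iff_exists_fun.1 (hy (Ideal.mem_map_of_mem _ hz))
  choose s hs using fun i => happ (N + 1) (c i)
  rw [← add_sub_cancel (∑ i, s i * t i) z]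
  refine Submodule.add_mem_sup (Ideal.mem_span_range_iff_exists_fun.2 ⟨s, rfl⟩) ?_
  rw [smul_eq_mul, ← pow_succ']
  apply hcomap
  rw [map_sub, ← hc, map_sum, ← Finset.sum_sub_distrib]
  refine sum_mem fun i _ => ?_
  have : c i * y i - algebraMap T C (s i * t i) =
      c i * (y i - algebraMap T C (t i)) + algebraMap T C (t i) * (c i - algebraMap T C (s i)) := by
    rw [map_mul]
    ring
  rw [this]
  exact add_mem (Ideal.mul_mem_left _ _ (ht i)) (Ideal.mul_mem_left _ _ (hs i))

theorem ringKrullDim_le_of_pow_le_span {R T : Type*} [CommRing R] [IsNoetherianRing R]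
    [IsLocalRing R] [CommRing T] [IsLocalRing T] [Algebra R T] [Algebra.IsIntegral R T]
    (hinj : Function.Injective (algebraMap R T))
    (hm : maximalIdeal T = (maximalIdeal R).map (algebraMap R T)) {e N : ℕ} (t : Fin e → T)
    (ht : ∀ i, t i ∈ maximalIdeal T) (hN : maximalIdeal T ^ N ≤ Ideal.span (Set.range t)) :
    ringKrullDim R ≤ e := by
  obtain ⟨G, hG⟩ := (IsNoetherian.noetherian (maximalIdeal R ^ N) : (maximalIdeal R ^ N).FG)
  have hG' : ∀ g : G, ∃ a : Fin e → T, ∑ i, a i * t i = algebraMap R T g := fun g => by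
    apply Ideal.mem_span_range_iff_exists_fun.1 (hN _)
    rw [hm, ← Ideal.map_pow, ← hG]
    exact Ideal.mem_map_of_mem _ (Ideal.subset_span g.2)
  choose a ha using hG'
  let W := Set.range t ∪ Set.range fun q : G × Fin e => a q.1 q.2
  have hW : W.Finite := (Set.finite_range _).union (Set.finite_range _)
  let A := Algebra.adjoin R W
  have hfin : Module.Finite R A :=
    Algebra.finite_adjoin_of_finite_of_isIntegral hW fun x _ => Algebra.IsIntegral.isIntegral x
  have hA : IsNoetherianRing A := IsNoetherianRing.of_finite R A
  have hAT : Algebra.IsIntegral A T := Algebra.IsIntegral.tower_top R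
  have htA : ∀ i, t i ∈ A := fun i => Algebra.subset_adjoin (.inl ⟨i, rfl⟩)
  let t' : Fin e → A := fun i => ⟨t i, htA i⟩
  have huniq : ∀ Q : Ideal A, Q.IsMaximal → Q = (maximalIdeal T).comap (algebraMap A T) := by
    intro Q hQ
    obtain ⟨M, hM, rfl⟩ := Ideal.exists_ideal_over_maximal_of_isIntegral (S := T) Q (by
      rw [(RingHom.injective_iff_ker_eq_bot (algebraMap A T)).1 Subtype.val_injective]
      exact bot_le)
    rw [eq_maximalIdeal hM]
  have hloc : IsLocalRing A := by
    obtain ⟨Q, hQ⟩ := Ideal.exists_maximal A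
    exact .of_unique_max_ideal ⟨Q, hQ, fun Q' hQ' => (huniq Q' hQ').trans (huniq Q hQ).symm⟩
  have hmA := huniq (maximalIdeal A) inferInstance
  have hmem : ∀ x ∈ maximalIdeal R ^ N, algebraMap R A x ∈ Ideal.span (Set.range t') := by
    have : (maximalIdeal R ^ N).map (algebraMap R A) ≤ Ideal.span (Set.range t') := by
      rw [← hG, Ideal.map_span, Ideal.span_le]
      rintro _ ⟨g, hg, rfl⟩
      refine Ideal.mem_span_range_iff_exists_fun.2
        ⟨fun i => ⟨a ⟨g, hg⟩ i, Algebra.subset_adjoin (.inr ⟨(⟨g, hg⟩, i), rfl⟩)⟩, ?_⟩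
      apply Subtype.ext
      rw [AddSubmonoidClass.coe_finsetSum]
      exact ha ⟨g, hg⟩
    exact fun x hx => this (Ideal.mem_map_of_mem _ hx)
  refine (ringKrullDim_le_of_isIntegral (A := R) (C := A) fun x y hxy =>
    hinj (congrArg Subtype.val hxy)).trans ?_
  have hrad : (Ideal.ofList (List.ofFn t')).radical = maximalIdeal A := by
    have hs : Ideal.ofList (List.ofFn t') = Ideal.span (Set.range t') :=
      congrArg Ideal.span (Set.ext fun x => List.mem_ofFn)
    rw [hs]
    apply radical_eq_maximalIdeal_of_mem_minimalPrimes
    refine ⟨⟨inferInstance, ?_⟩, fun Q hQ _ => ?_⟩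
    · rw [Ideal.span_le, hmA]
      rintro _ ⟨i, rfl⟩
      exact ht i
    · have := hQ.1
      have h1 : maximalIdeal R ≤ Q.comap (algebraMap R A) := fun x hx =>
        hQ.1.mem_of_pow_mem N (by
          rw [← map_pow]
          exact hQ.2 (hmem _ (Ideal.pow_mem_pow hx N)))
      have h2 : (Q.comap (algebraMap R A)).IsMaximal := by
        rw [← (maximalIdeal.isMaximal R).eq_of_le (Ideal.IsPrime.ne_top inferInstance) h1]
        infer_instance
      have h3 := Ideal.isMaximal_of_isIntegral_of_isMaximal_comap Q h2
      exact (eq_maximalIdeal h3).ge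
  simpa using ringKrullDim_le_length _ hrad

theorem ringKrullDim_le_of_approx {R T C : Type*} [CommRing R] [IsNoetherianRing R]
    [IsLocalRing R] [CommRing T] [IsLocalRing T] [Algebra R T] [Algebra.IsIntegral R T]
    (hinj : Function.Injective (algebraMap R T))
    (hm : maximalIdeal T = (maximalIdeal R).map (algebraMap R T))
    [CommRing C] [IsLocalRing C] [IsNoetherianRing C] [Algebra T C]
    (hC : maximalIdeal C = (maximalIdeal T).map (algebraMap T C))
    (happ : ∀ n (c : C), ∃ t, c - algebraMap T C t ∈ (maximalIdeal T ^ n).map (algebraMap T C))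
    (hcomap : ∀ n t, algebraMap T C t ∈ (maximalIdeal T ^ n).map (algebraMap T C) →
      t ∈ maximalIdeal T ^ n) : ringKrullDim R ≤ ringKrullDim C := by
  obtain ⟨ys, hys, hlen, hrad⟩ := exists_isSOP C
  have hT : (maximalIdeal T).FG := hm ▸ (maximalIdeal R).fg_of_isNoetherianRing.map _
  obtain ⟨N, hN⟩ := Ideal.exists_pow_le_of_le_radical_of_fg hrad.ge
    (maximalIdeal C).fg_of_isNoetherianRing
  choose t ht using fun i => happ (N + 1) (ys.get i)
  rw [← hlen]
  refine ringKrullDim_le_of_pow_le_span hinj hm t (fun i => ?_)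
    (pow_le_span_of_approx hT happ hcomap ys.get ?_ t ht)
  · have h1 := ht i
    rw [Ideal.map_pow, ← hC] at h1
    have h2 := sub_mem (hys _ (ys.get_mem i)) (Ideal.pow_le_self N.succ_ne_zero h1)
    rw [sub_sub_cancel, hC, ← pow_one (maximalIdeal T)] at h2
    simpa using hcomap 1 _ h2
  · rw [Ideal.map_pow, ← hC, Set.range_list_get]
    exact hN

end CompletedDimension

section MixedCharacteristic

open IsLocalRing

theorem MvPowerSeries.ofList_cons_ofFn_X {V : Type*} [CommRing V] [IsLocalRing V] (π : V)
    (hπ : maximalIdeal V = Ideal.span {π}) (e : ℕ) :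
    Ideal.ofList (MvPowerSeries.C π :: List.ofFn MvPowerSeries.X) =
      maximalIdeal (MvPowerSeries (Fin e) V) := by
  rw [MvPowerSeries.maximalIdeal_eq π hπ, Ideal.ofList_cons]
  congr 1
  exact congrArg Ideal.span (Set.ext fun x => List.mem_ofFn)

theorem exists_regMod_of_perfect_residue (p : ℕ) [Fact p.Prime] {C : Type u} [CommRing C]
    [IsLocalRing C] (hC : (maximalIdeal C).FG) [IsAdicComplete (maximalIdeal C) C]
    [CharP (C ⧸ maximalIdeal C) p] [PerfectRing (C ⧸ maximalIdeal C) p] (ys : List C)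
    (hrad : (Ideal.ofList ((p : C) :: ys)).radical = maximalIdeal C)
    (hdim : IsNoetherianRing C → (ys.length + 1 : WithBot ℕ∞) ≤ ringKrullDim C) :
    ∃ (B : Type u) (_ : CommRing B) (g : C →+* B),
      RegMod ⊥ (((p : C) :: ys).map g) ∧ Ideal.ofList (((p : C) :: ys).map g) ≠ ⊤ := by
  let := Ideal.Quotient.field (maximalIdeal C)
  let V := WittVector p (C ⧸ maximalIdeal C)
  obtain ⟨θ, hθ⟩ := exists_ringHom_witt (p := p) (maximalIdeal C)
  have hys : ∀ y ∈ ys, y ∈ maximalIdeal C := fun y hy => by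
    rw [← hrad]
    exact Ideal.le_radical (Ideal.subset_span (List.mem_cons_of_mem _ hy))
  obtain ⟨ψ, hψC, hψX⟩ := exists_eval_of_isAdicComplete θ ys.get (maximalIdeal C)
    fun i => hys _ (ys.get_mem i)
  have hπ : maximalIdeal V = Ideal.span {(p : V)} :=
    (WittVector.irreducible p).maximalIdeal_eq
  obtain ⟨S, _, φ, hφ⟩ := exists_isPerfStage p (C ⧸ maximalIdeal C) ys.length
  let ξ : List (MvPowerSeries (Fin ys.length) V) := (p : MvPowerSeries (Fin ys.length) V) ::
    List.ofFn MvPowerSeries.X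
  have hξψ : ξ.map ψ = (p : C) :: ys := by
    simp only [ξ, List.map_cons, map_natCast, List.map_ofFn]
    congr 1
    refine Eq.trans ?_ (List.ofFn_get ys)
    exact congrArg List.ofFn (funext hψX)
  have hξ : Ideal.ofList ξ = maximalIdeal (MvPowerSeries (Fin ys.length) V) := by
    rw [← MvPowerSeries.ofList_cons_ofFn_X (p : V) hπ, map_natCast]
  have hs : ∀ c, ∃ v, c - ψ (MvPowerSeries.C v) ∈ maximalIdeal C := fun c => by
    refine ⟨WittVector.teichmuller p (Ideal.Quotient.mk _ c), ?_⟩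
    rw [← Ideal.Quotient.eq, hψC, hθ, WittVector.teichmuller_coeff_zero]
  have hd : IsNoetherianRing C → (ξ.length : WithBot ℕ∞) ≤ ringKrullDim C := fun hN => by
    simpa [ξ] using hdim hN
  obtain ⟨B, _, g, hg⟩ := (stageClass_isPerfStage p).exists_regMod_of_isAdicComplete (p : V) hπ ξ
    hξ hC ψ (by rw [hξψ, hrad]) hs hd φ hφ
  refine ⟨B, inferInstance, g, ?_⟩
  rw [← hξψ, List.map_map]
  exact hg

theorem exists_complete_perfect_residue (R : Type u) [CommRing R] [IsDomain R] [IsNoetherianRing R]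
    [IsLocalRing R] (p : ℕ) [Fact p.Prime] (hp : (p : R) ∈ maximalIdeal R) {xs : List R}
    (hsop : IsSOP R xs) :
    ∃ (C : Type u) (_ : CommRing C) (_ : IsLocalRing C) (f : R →+* C),
      (maximalIdeal C).FG ∧ IsAdicComplete (maximalIdeal C) C ∧
      (∃ _ : CharP (C ⧸ maximalIdeal C) p, PerfectRing (C ⧸ maximalIdeal C) p) ∧
      (Ideal.ofList (xs.map f)).radical = maximalIdeal C ∧
      (IsNoetherianRing C → ((xs.map f).length : WithBot ℕ∞) ≤ ringKrullDim C) := by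
  obtain ⟨-, hlen, hrad⟩ := hsop
  obtain ⟨T, _, _, _, hint, hinj, hmT, hperf⟩ :=
    exists_perfect_residue_extension R p (Fact.out : p.Prime)
  have hT : (maximalIdeal T).FG := hmT ▸ (maximalIdeal R).fg_of_isNoetherianRing.map _
  let C : Type u := AdicCompletion (maximalIdeal T) T
  have hloc : IsLocalRing C := AdicCompletion.isLocalRing_of_fg hT
  have hmC : maximalIdeal C = (maximalIdeal T).map (algebraMap T C) :=
    AdicCompletion.maximalIdeal_eq_map_of_fg hT
  have hcomp : IsAdicComplete (maximalIdeal C) C := AdicCompletion.isAdicComplete_of_fg hT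
  let f : R →+* C := (algebraMap T C).comp (algebraMap R T)
  have hmf : maximalIdeal C = (maximalIdeal R).map f :=
    hmC.trans ((congrArg (Ideal.map (algebraMap T C)) hmT).trans (Ideal.map_map _ _))
  have hpC : (p : C) ∈ maximalIdeal C := by
    rw [hmf, ← map_natCast f]
    exact Ideal.mem_map_of_mem _ hp
  have hchar : CharP (C ⧸ maximalIdeal C) p :=
    (CharP.charP_iff_prime_eq_zero (Fact.out : p.Prime)).2 (by
      rw [← map_natCast (Ideal.Quotient.mk _), Ideal.Quotient.eq_zero_iff_mem]
      exact hpC)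
  have happ := AdicCompletion.exists_sub_mem hT
  have hperfC : PerfectRing (C ⧸ maximalIdeal C) p := .ofSurjective _ _ fun c => by
    obtain ⟨c, rfl⟩ := Ideal.Quotient.mk_surjective c
    obtain ⟨t, ht⟩ := happ 1 c
    obtain ⟨q, hq⟩ := hperf t
    refine ⟨Ideal.Quotient.mk _ (algebraMap T C q), ?_⟩
    rw [frobenius_def, ← map_pow, eq_comm, Ideal.Quotient.eq,
      ← sub_sub_sub_cancel_right _ _ (algebraMap T C t), ← map_pow, ← map_sub]
    refine sub_mem ?_ (hmC ▸ Ideal.mem_map_of_mem _ hq)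
    rwa [pow_one, ← hmC] at ht
  refine ⟨C, inferInstance, hloc, f, hmC ▸ hT.map _, hcomp, ⟨hchar, hperfC⟩, ?_, fun hN => ?_⟩
  · rw [← Ideal.map_ofList]
    apply le_antisymm
    · rw [← Ideal.IsPrime.radical (I := maximalIdeal C) inferInstance]
      refine Ideal.radical_mono ?_
      rw [hmf]
      exact Ideal.map_mono (Ideal.le_radical.trans hrad.le)
    · rw [hmf, ← hrad]
      exact Ideal.map_radical_le f
  · rw [List.length_map, hlen]
    exact ringKrullDim_le_of_approx hinj hmT hmC happ
      (AdicCompletion.mem_pow_of_algebraMap_mem hT)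

theorem exists_regMod_of_mixedChar (R : Type u) [CommRing R] [IsDomain R] [IsNoetherianRing R]
    [IsLocalRing R] (p : ℕ) [Fact p.Prime] (hp0 : (p : R) ≠ 0) (hp : (p : R) ∈ maximalIdeal R) :
    ∃ xs : List R, IsSOP R xs ∧ ∃ (B : Type u) (_ : CommRing B) (f : R →+* B),
      RegMod ⊥ (xs.map f) ∧ Ideal.ofList (xs.map f) ≠ ⊤ := by
  obtain ⟨ys, hsop⟩ := exists_isSOP_cons hp0 hp
  refine ⟨_, hsop, ?_⟩
  obtain ⟨C, _, _, f, hfg, _, ⟨_, _⟩, hrad, hdim⟩ := exists_complete_perfect_residue R p hp hsop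
  have h1 : ((p : R) :: ys).map f = (p : C) :: ys.map f := by simp
  rw [h1] at hrad hdim
  obtain ⟨B, _, g, hg⟩ := exists_regMod_of_perfect_residue p hfg (ys.map f) hrad
    fun hN => by simpa using hdim hN
  refine ⟨B, inferInstance, g.comp f, ?_⟩
  rw [← h1, List.map_map] at hg
  exact hg

end MixedCharacteristic

section NullSequences

variable {Q : ℕ → Type u} [∀ n, CommRing (Q n)] {F : Filter ℕ} {J : ∀ n, ℕ → Ideal (Q n)}

/-- The sequences tending to zero along a filter with respect to a family of filtrations. -/
def nullSeqIdeal (F : Filter ℕ) (J : ∀ n, ℕ → Ideal (Q n)) : Ideal (∀ n, Q n) where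
  carrier := {u | ∀ N, ∀ᶠ n in F, u n ∈ J n N}
  add_mem' ha hb N := by
    filter_upwards [ha N, hb N] with n h1 h2 using Ideal.add_mem _ h1 h2
  zero_mem' N := by simp
  smul_mem' c x hx N := by
    filter_upwards [hx N] with n h1 using Ideal.mul_mem_left _ _ h1

theorem exists_eventually_diagonal (hF : F ≤ atTop) {P : ℕ → ℕ → Prop}
    (h : ∀ N, ∀ᶠ n in F, P n N) : ∃ G : ℕ → ℕ, ∀ N, ∀ᶠ n in F, N ≤ G n ∧ P n (G n) := by
  classical
  refine ⟨fun n => Nat.findGreatest (P n) n, fun N => ?_⟩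
  filter_upwards [h N, hF (eventually_ge_atTop N)] with n h1 h2
  exact ⟨Nat.le_findGreatest h2 h1, Nat.findGreatest_spec h2 h1⟩

theorem mem_ofList_nullSeqIdeal (hF : F ≤ atTop) (hJ : ∀ n, Antitone (J n)) (u : ∀ n, Q n)
    (l : List (∀ n, Q n)) :
    Ideal.Quotient.mk (nullSeqIdeal F J) u ∈
        Ideal.ofList (l.map (Ideal.Quotient.mk (nullSeqIdeal F J))) ↔
      ∀ N, ∀ᶠ n in F, u n ∈ Ideal.ofList (l.map (fun a => a n)) ⊔ J n N := by
  classical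
  rw [← Ideal.map_ofList, Ideal.mem_quotient_iff_mem_sup]
  constructor
  · intro h N
    obtain ⟨v, hv, w, hw, rfl⟩ := Submodule.mem_sup.1 h
    filter_upwards [hw N] with n hn
    refine Ideal.add_mem _ (Ideal.mem_sup_left ?_) (Ideal.mem_sup_right hn)
    have := Ideal.mem_map_of_mem (Pi.evalRingHom Q n) hv
    rwa [Ideal.map_ofList] at this
  · intro h
    obtain ⟨G, hG⟩ := exists_eventually_diagonal hF h
    have hc : ∀ n, ∃ c : Fin l.length → Q n,
        u n ∈ Ideal.ofList (l.map (fun a => a n)) ⊔ J n (G n) →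
          u n - ∑ i, c i * l[i] n ∈ J n (G n) := by
      intro n
      by_cases hP : u n ∈ Ideal.ofList (l.map (fun a => a n)) ⊔ J n (G n)
      · obtain ⟨v, hv, w, hw, e⟩ := Submodule.mem_sup.1 hP
        obtain ⟨c, hc⟩ := mem_ofList_iff.1 hv
        refine ⟨fun i => c (i.cast (by simp)), fun _ => ?_⟩
        convert hw using 1
        rw [← e, hc, add_comm, add_sub_assoc, ← Fin.sum_congr' (fun i => c i * _)
          (List.length_map (fun a : ∀ n, Q n => a n)).symm]
        simp
      · exact ⟨0, fun h => absurd h hP⟩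
    choose c hc using hc
    refine Submodule.mem_sup.2 ⟨∑ i, (fun n => c n i) * l[i], mem_ofList_iff.2 ⟨_, rfl⟩,
      u - ∑ i, (fun n => c n i) * l[i], fun N => ?_, by ring⟩
    filter_upwards [hG N] with n hn
    have := hJ n hn.1 (hc n hn.2)
    simpa using this

end NullSequences

theorem ofList_pow_le_powFilt {B : Type*} [CommRing B] (l : List B) (t : ℕ) :
    Ideal.ofList l ^ (l.length * t + 1) ≤ powFilt l t := by
  induction l with
  | nil => simp [powFilt]
  | cons a l ih =>
    rw [powFilt, List.map_cons, Ideal.ofList_cons, Ideal.ofList_cons, List.length_cons, add_mul,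
      one_mul, add_comm (l.length * t), add_assoc]
    refine (Ideal.sup_pow_add_le_pow_sup_pow).trans (sup_le_sup ?_ ih)
    exact (Ideal.span_singleton_pow a t).le

theorem powFilt_le_pow {B : Type*} [CommRing B] (l : List B) (n : ℕ) :
    powFilt l n ≤ Ideal.ofList l ^ n := by
  rw [powFilt, Ideal.ofList, Ideal.span_le]
  intro x hx
  obtain ⟨y, hy, rfl⟩ := List.mem_map.1 hx
  have h : y ∈ Ideal.ofList l := Ideal.subset_span hy
  exact Ideal.pow_mem_pow h n

/-- A sequence of perfect rings of prime characteristics together with regular sequences. -/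
structure SeqStage (p : ℕ → ℕ) [∀ n, Fact (p n).Prime] where
  Q : ℕ → Type u
  [commRing : ∀ n, CommRing (Q n)]
  [charP : ∀ n, CharP (Q n) (p n)]
  [perfectRing : ∀ n, PerfectRing (Q n) (p n)]
  xs : List (∀ n, Q n)
  reg : ∀ n, RegMod ⊥ (xs.map fun x => x n)
  proper : ∀ n, Ideal.ofList (xs.map fun x => x n) ≠ ⊤

namespace SeqStage

variable {p : ℕ → ℕ} [∀ n, Fact (p n).Prime]

attribute [instance] commRing charP perfectRing

/-- The filtrations by powers of the entries of the regular sequences. -/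
def filt (E : SeqStage.{u} p) (n : ℕ) : ℕ → Ideal (E.Q n) := powFilt (E.xs.map fun x => x n)

/-- The ring of sequences modulo null sequences. -/
abbrev S (E : SeqStage.{u} p) (F : Filter ℕ) : Type u := (∀ n, E.Q n) ⧸ nullSeqIdeal F E.filt

/-- The quotient map. -/
abbrev proj (E : SeqStage.{u} p) (F : Filter ℕ) : (∀ n, E.Q n) →+* E.S F :=
  Ideal.Quotient.mk (nullSeqIdeal F E.filt)

variable (E : SeqStage.{u} p) {F : Filter ℕ}

theorem mem_ofList (hF : F ≤ atTop) (u : ∀ n, E.Q n) (l : List (∀ n, E.Q n)) :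
    E.proj F u ∈ Ideal.ofList (l.map (E.proj F)) ↔
      ∀ N, ∀ᶠ n in F, u n ∈ Ideal.ofList (l.map (fun a => a n)) ⊔ E.filt n N :=
  mem_ofList_nullSeqIdeal hF (fun _ => powFilt_antitone _) u l

theorem proj_eq_zero {u : ∀ n, E.Q n} :
    E.proj F u = 0 ↔ ∀ N, ∀ᶠ n in F, u n ∈ E.filt n N := Ideal.Quotient.eq_zero_iff_mem

theorem mem_ofList_xs (hF : F ≤ atTop) {u : ∀ n, E.Q n} :
    E.proj F u ∈ Ideal.ofList (E.xs.map (E.proj F)) ↔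
      ∀ᶠ n in F, u n ∈ Ideal.ofList (E.xs.map fun x => x n) := by
  rw [E.mem_ofList hF]
  refine ⟨fun h => ?_, fun h N => h.mono fun n hn => Ideal.mem_sup_left hn⟩
  filter_upwards [h 1] with n hn
  rwa [sup_eq_left.2 (powFilt_le _ one_pos)] at hn

theorem mem_powFilt_xs (hF : F ≤ atTop) {u : ∀ n, E.Q n} (N : ℕ) :
    E.proj F u ∈ powFilt (E.xs.map (E.proj F)) N ↔ ∀ᶠ n in F, u n ∈ E.filt n N := by
  have h1 : (E.xs.map (E.proj F)).map (· ^ N) = (E.xs.map (· ^ N)).map (E.proj F) := by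
    simp [Function.comp_def]
  have h2 (n : ℕ) : Ideal.ofList ((E.xs.map (· ^ N)).map fun x => x n) = E.filt n N := by
    simp [filt, powFilt, Function.comp_def]
  rw [powFilt, h1, E.mem_ofList hF]
  simp only [h2]
  refine ⟨fun h => ?_, fun h M => h.mono fun n hn => Ideal.mem_sup_left hn⟩
  filter_upwards [h N] with n hn
  rwa [sup_idem] at hn

theorem regMod_proj (hF : F ≤ atTop) : RegMod ⊥ (E.xs.map (E.proj F)) := by
  rw [RegMod.iff_split]
  intro l₁ a l₂ hl u hu
  obtain ⟨l₁, l', hxs, rfl, hl'⟩ := List.map_eq_append_iff.1 hl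
  obtain ⟨a, l₂, rfl, rfl, rfl⟩ := List.map_eq_cons_iff.1 hl'
  obtain ⟨u, rfl⟩ := Ideal.Quotient.mk_surjective u
  rw [bot_sup_eq] at hu ⊢
  rw [E.mem_ofList hF]
  intro N
  rw [← map_mul, E.mem_ofList hF] at hu
  filter_upwards [hu (N + 1)] with n hn
  have h := E.reg n
  rw [filt, powFilt] at hn ⊢
  rw [hxs, List.map_append, List.map_cons] at h hn ⊢
  exact h.mul_mem_pow hn

theorem ofList_proj_ne_top (hF : F ≤ atTop) [NeBot F] : Ideal.ofList (E.xs.map (E.proj F)) ≠ ⊤ := by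
  rw [Ne, Ideal.eq_top_iff_one, ← map_one (E.proj F), E.mem_ofList_xs hF]
  intro h
  obtain ⟨n, hn⟩ := h.exists
  exact E.proper n ((Ideal.eq_top_iff_one _).2 hn)

theorem isAdicComplete (hF : F ≤ atTop) :
    IsAdicComplete (Ideal.ofList (E.xs.map (E.proj F))) (E.S F) := by
  set I := Ideal.ofList (E.xs.map (E.proj F))
  set d := (E.xs.map (E.proj F)).length + 1 with hd0
  have hd (N : ℕ) : I ^ (d * N + 1) ≤ powFilt (E.xs.map (E.proj F)) N :=
    (Ideal.pow_le_pow_right (by rw [hd0]; gcongr; omega)).trans (ofList_pow_le_powFilt _ N)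
  have hpre : IsPrecomplete I (E.S F) := .of_exists_lim _ fun f hf => by
    have hmono (m k : ℕ) : f (m + k) - f m ∈ I ^ m := by
      induction k with
      | zero => simp
      | succ k ih =>
        have := add_mem (Ideal.pow_le_pow_right (Nat.le_add_right m k) (hf (m + k))) ih
        rwa [sub_add_sub_cancel] at this
    choose v hv using fun n => Ideal.Quotient.mk_surjective (f n)
    let g : ℕ → ∀ n, E.Q n := fun N => v (d * N + 1)
    have hg (N : ℕ) : ∀ᶠ n in F, ∀ M < N, g N n - g M n ∈ E.filt n M := by
      refine (eventually_all_finite (Set.finite_lt_nat N)).2 fun M (hM : M < N) => ?_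
      rw [← E.mem_powFilt_xs hF]
      change E.proj F (g N - g M) ∈ _
      rw [map_sub, hv, hv]
      obtain ⟨k, hk⟩ := Nat.exists_eq_add_of_le
        (Nat.add_le_add_right (Nat.mul_le_mul_left d hM.le) 1)
      rw [hk]
      exact hd M (hmono _ k)
    obtain ⟨G, hG⟩ := exists_eventually_diagonal hF hg
    refine ⟨E.proj F fun n => g (G n) n, fun N => ?_⟩
    have h1 : E.proj F (g N) - E.proj F (fun n => g (G n) n) ∈ powFilt (E.xs.map (E.proj F)) N := by
      rw [← map_sub, E.mem_powFilt_xs hF]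
      filter_upwards [hG (N + 1)] with n hn
      rw [← neg_mem_iff]
      simpa using hn.2 N hn.1
    have h2 := powFilt_le_pow _ N h1
    rw [hv] at h2
    obtain ⟨k, hk⟩ := Nat.exists_eq_add_of_le (show N ≤ d * N + 1 by nlinarith)
    have h3 := hmono N k
    rw [← hk] at h3
    simpa using sub_mem h2 h3
  refine { hpre with haus' := fun u hu => ?_ }
  obtain ⟨u, rfl⟩ := Ideal.Quotient.mk_surjective u
  rw [E.proj_eq_zero]
  intro N
  rw [← E.mem_powFilt_xs hF]
  have := hu (d * N + 1)
  rw [SModEq.zero] at this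
  exact hd N (by simpa using this)

end SeqStage

theorem RegMod.of_isWeaklyRegular {B : Type*} [CommRing B] {l : List B}
    (h : RingTheory.Sequence.IsWeaklyRegular B l) : RegMod ⊥ l := by
  rw [RegMod.iff_split]
  rintro l₁ a l₂ rfl u hu
  have h1 := h.regular_mod_prev l₁.length (by simp)
  rw [isSMulRegular_quotient_iff_mem_of_smul_mem] at h1
  simpa using h1 u (by simpa using hu)

theorem RegMod.of_flat {A B : Type*} [CommRing A] [CommRing B] [Algebra A B] [Module.Flat A B]
    {l : List A} (h : RegMod ⊥ l) : RegMod ⊥ (l.map (algebraMap A B)) :=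
  .of_isWeaklyRegular h.isWeaklyRegular.of_flat

theorem exists_perfect_root (p : ℕ) [Fact p.Prime] {Q : Type u} [CommRing Q] [CharP Q p]
    {l : List Q} (h : RegMod ⊥ l) (hl : Ideal.ofList l ≠ ⊤) (f : Polynomial Q) (hf : f.Monic)
    (hdeg : 0 < f.natDegree) :
    ∃ (Q' : Type u) (_ : CommRing Q') (_ : CharP Q' p) (_ : PerfectRing Q' p) (g : Q →+* Q'),
      RegMod ⊥ (l.map g) ∧ Ideal.ofList (l.map g) ≠ ⊤ ∧ ∃ z, f.eval₂ g z = 0 := by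
  have : Nontrivial Q := CharP.nontrivial_of_char_ne_one (Fact.out : p.Prime).ne_one
  have : Module.Free Q (AdjoinRoot f) := hf.free_adjoinRoot
  have : Nontrivial (AdjoinRoot f) := by
    refine Ideal.Quotient.nontrivial_iff.2 fun h => ?_
    rw [Ideal.span_singleton_eq_top] at h
    rw [hf.eq_one_of_isUnit h, Polynomial.natDegree_one] at hdeg
    exact hdeg.false
  have : CharP (AdjoinRoot f) p := charP_of_ringHom (AdjoinRoot.of f) p
  let i := PerfectClosure.of (AdjoinRoot f) p
  have e : l.map (i.comp (AdjoinRoot.of f)) = (l.map (algebraMap Q (AdjoinRoot f))).map i := by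
    rw [List.map_map]; rfl
  refine ⟨PerfectClosure (AdjoinRoot f) p, inferInstance, inferInstance, inferInstance,
    i.comp (AdjoinRoot.of f), ?_, ?_, i (AdjoinRoot.root f), ?_⟩
  · rw [e]
    exact regMod_of_isPRadical (p := p) _ h.of_flat
  · rw [e]
    refine ofList_ne_top_of_isPRadical p _ ?_
    rw [← Ideal.map_ofList]
    intro h1
    refine hl ?_
    rw [← Ideal.comap_map_eq_self_of_faithfullyFlat (B := AdjoinRoot f) (Ideal.ofList l), h1,
      Ideal.comap_top]
  · rw [← Polynomial.hom_eval₂, AdjoinRoot.eval₂_root, map_zero]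

/-- The rings of sequences modulo null sequences arising from sequences of perfect rings. -/
inductive IsSeqStage (p : ℕ → ℕ) [∀ n, Fact (p n).Prime] (F : Filter ℕ) :
    ∀ (S : Type u) [CommRing S], List S → Prop
  | mk (E : SeqStage.{u} p) : IsSeqStage p F (E.S F) (E.xs.map (E.proj F))

namespace SeqStage

variable {p : ℕ → ℕ} [∀ n, Fact (p n).Prime] (E : SeqStage.{u} p) {F : Filter ℕ}

theorem exists_eval₂_eq_zero (f : Polynomial (E.S F)) (hf : f.Monic) (hdeg : 0 < f.natDegree) :
    ∃ (S' : Type u) (_ : CommRing S') (g : E.S F →+* S'),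
      IsSeqStage p F S' ((E.xs.map (E.proj F)).map g) ∧ ∃ z, f.eval₂ g z = 0 := by
  obtain ⟨f, rfl, hdeg', hf'⟩ := Polynomial.lifts_and_natDegree_eq_and_monic
    ((Polynomial.mem_lifts _).2 (Polynomial.map_surjective _ Ideal.Quotient.mk_surjective f)) hf
  let f' (n : ℕ) : Polynomial (E.Q n) := f.map (Pi.evalRingHom E.Q n)
  have (n : ℕ) : Nontrivial (E.Q n) :=
    CharP.nontrivial_of_char_ne_one (Fact.out : (p n).Prime).ne_one
  choose Q' _ _ _ g h1 h2 z hz using fun n => exists_perfect_root (p n) (E.reg n) (E.proper n)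
    (f' n) (hf'.map _) (by rwa [hf'.natDegree_map, hdeg'])
  let G : (∀ n, E.Q n) →+* ∀ n, Q' n := RingHom.pi fun n => (g n).comp (Pi.evalRingHom E.Q n)
  have e (n : ℕ) : (E.xs.map G).map (fun x => x n) = (E.xs.map fun x => x n).map (g n) := by
    rw [List.map_map, List.map_map]; rfl
  let E' : SeqStage.{u} p :=
    { Q := Q'
      xs := E.xs.map G
      reg := fun n => by rw [e]; exact h1 n
      proper := fun n => by rw [e]; exact h2 n }
  let γ : E.S F →+* E'.S F := Ideal.quotientMap _ G fun u hu N => by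
    filter_upwards [hu N] with n hn
    have := Ideal.mem_map_of_mem (g n) hn
    simpa [filt, powFilt, E', Function.comp_def, G] using this
  refine ⟨E'.S F, inferInstance, γ, ?_, E'.proj F z, ?_⟩
  · have : (E.xs.map (E.proj F)).map γ = E'.xs.map (E'.proj F) := by
      rw [List.map_map, List.map_map]; rfl
    rw [this]
    exact ⟨E'⟩
  · rw [Polynomial.eval₂_map]
    have : γ.comp (Ideal.Quotient.mk (nullSeqIdeal F E.filt)) = (E'.proj F).comp G := rfl
    rw [this, ← Polynomial.hom_eval₂]
    convert map_zero (E'.proj F)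
    ext n
    have := Polynomial.hom_eval₂ f G (Pi.evalRingHom Q' n) z
    refine this.trans (Eq.trans ?_ (hz n))
    rw [Polynomial.eval₂_map]
    rfl

end SeqStage

section PerfectRing

variable {Q : Type*} [CommRing Q] (p : ℕ) [Fact p.Prime] [CharP Q p] [PerfectRing Q p]

theorem iterateFrobeniusEquiv_symm_pow (j : ℕ) (a : Q) :
    (iterateFrobeniusEquiv Q p j).symm a ^ p ^ j = a := by
  rw [← iterateFrobeniusEquiv_def, RingEquiv.apply_symm_apply]

theorem iterateFrobeniusEquiv_symm_pow_mul_mem {l : List Q} {a b : Q} {j s N : ℕ} (hs : 2 ≤ s)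
    (hj : s * (l.length + 1) ≤ p ^ j) (h : a * b ∈ powFilt l (2 * s * (l.length + 1) * N)) :
    (iterateFrobeniusEquiv Q p j).symm a ^ (p ^ j / s + 1) * b ∈ powFilt l N := by
  set ρ := (iterateFrobeniusEquiv Q p j).symm
  set q := p ^ j
  set D := l.length + 1 with hD
  have hρ (x : Q) : ρ x ^ q = x := iterateFrobeniusEquiv_symm_pow p j x
  set r := q / s + 1 with hr
  have hrq : r ≤ q := by
    have h1 : q / s ≤ q / 2 := Nat.div_le_div_left hs two_pos
    have h2 : 2 ≤ q := by nlinarith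
    omega
  set t := q / (s * D) with ht
  have htr : l.length * t + 1 ≤ r := by
    rw [hr, ht, ← Nat.div_div_eq_div_mul]
    gcongr
    calc l.length * (q / s / D) ≤ D * (q / s / D) := by gcongr; omega
      _ ≤ q / s := Nat.mul_div_le _ _
  have htq : q ≤ 2 * s * D * t := by
    have h0 : 0 < s * D := by positivity
    have h1 : 1 ≤ t := (Nat.one_le_div_iff h0).2 hj
    have h2 : q < s * D * (t + 1) := Nat.lt_mul_div_succ q h0
    nlinarith
  have h1 : ρ a * ρ b ∈ Ideal.ofList ((l.map ρ).map (· ^ (2 * s * D * N))) := by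
    have := Ideal.mem_map_of_mem (ρ : Q →+* Q) h
    rw [powFilt, Ideal.map_ofList] at this
    simpa [Function.comp_def] using this
  have h2 : (ρ a * ρ b) ^ r ∈ powFilt l N := by
    have h3 := Ideal.pow_le_pow_right htr (Ideal.pow_mem_pow h1 r)
    have h4 := ofList_pow_le_powFilt ((l.map ρ).map (· ^ (2 * s * D * N))) t
    rw [List.length_map, List.length_map] at h4
    refine (h4.trans ?_) h3
    rw [powFilt, Ideal.ofList, Ideal.span_le]
    intro y hy
    simp only [List.map_map, Set.mem_ofPred_eq, List.mem_map, Function.comp_apply] at hy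
    obtain ⟨x, hx, rfl⟩ := hy
    rw [← pow_mul]
    refine Ideal.mem_of_dvd _ (pow_dvd_pow (ρ x) (m := q * N) ?_) ?_
    · calc q * N ≤ 2 * s * D * t * N := by gcongr
        _ = _ := by ring
    · rw [pow_mul, hρ]
      exact Ideal.subset_span (List.mem_map.2 ⟨x, hx, rfl⟩)
  have h3 : ρ a ^ r * b = ρ b ^ (q - r) * (ρ a * ρ b) ^ r := by
    nth_rw 1 [← hρ b, ← Nat.sub_add_cancel hrq, pow_add]
    ring
  rw [h3]
  exact Ideal.mul_mem_left _ _ h2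

theorem mem_powFilt_of_iterateFrobeniusEquiv_symm_pow_mem {l : List Q} {a : Q} {j k N : ℕ}
    (hj : 2 * k * (l.length * N + 1) ≤ p ^ j)
    (h : ((iterateFrobeniusEquiv Q p j).symm a ^
      (p ^ j / (2 * k * (l.length * N + 1) + 2) + 1)) ^ k ∈ Ideal.ofList l) :
    a ∈ powFilt l N := by
  set q := p ^ j
  set M := l.length * N + 1
  have h1 := ofList_pow_le_powFilt l N (Ideal.pow_mem_pow h M)
  rw [← pow_mul, ← pow_mul] at h1
  rw [← iterateFrobeniusEquiv_symm_pow p j a]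
  refine Ideal.mem_of_dvd _ (pow_dvd_pow _ ?_) h1
  have h2 := Nat.mul_div_le q (2 * k * M + 2)
  change (q / (2 * k * M + 2) + 1) * (k * M) ≤ q
  generalize q / (2 * k * M + 2) = d at h2
  nlinarith

end PerfectRing

namespace SeqStage

variable {p : ℕ → ℕ} [∀ n, Fact (p n).Prime] (E : SeqStage.{u} p) {F : Filter ℕ}

/-- A zero divisor relation is witnessed by elements arbitrarily close to a unit. -/
theorem exists_almost_annihilator (hF : F ≤ atTop) {a : E.S F} (ha : a ≠ 0) :
    ∃ γ : ℕ → E.S F, (∀ k, ∃ s, γ s ^ k ∉ Ideal.ofList (E.xs.map (E.proj F))) ∧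
      ∀ b, a * b = 0 → ∀ s, γ s * b = 0 := by
  obtain ⟨a, rfl⟩ := Ideal.Quotient.mk_surjective a
  have hq (m : ℕ) : ∀ᶠ n in F, m ≤ p n ^ n := by
    filter_upwards [hF (eventually_ge_atTop m)] with n hn
    exact hn.trans (Nat.lt_pow_self (Fact.out : (p n).Prime).one_lt).le
  refine ⟨fun s => E.proj F fun n => (iterateFrobeniusEquiv (E.Q n) (p n) n).symm (a n) ^
    (p n ^ n / (s + 2) + 1), fun k => ?_, fun b hb s => ?_⟩
  · by_contra! h
    refine ha ((E.proj_eq_zero).2 fun N => ?_)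
    have h1 := h (2 * k * (E.xs.length * N + 1))
    rw [← map_pow, E.mem_ofList_xs hF] at h1
    filter_upwards [h1, hq (2 * k * (E.xs.length * N + 1))] with n h2 h3
    have e : E.xs.length = (E.xs.map fun x => x n).length := (List.length_map _).symm
    rw [e] at h3
    refine mem_powFilt_of_iterateFrobeniusEquiv_symm_pow_mem (p n) h3 ?_
    rw [← e]
    exact h2
  · obtain ⟨b, rfl⟩ := Ideal.Quotient.mk_surjective b
    rw [← map_mul, E.proj_eq_zero] at hb
    rw [← map_mul, E.proj_eq_zero]
    intro N
    filter_upwards [hb (2 * (s + 2) * (E.xs.length + 1) * N),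
      hq ((s + 2) * (E.xs.length + 1))] with n h2 h3
    have e : E.xs.length = (E.xs.map fun x => x n).length := (List.length_map _).symm
    rw [e] at h2 h3
    exact iterateFrobeniusEquiv_symm_pow_mul_mem (p n) (by omega) h3 h2

end SeqStage

theorem stageClass_isSeqStage (p : ℕ → ℕ) [∀ n, Fact (p n).Prime] {F : Filter ℕ} (hF : F ≤ atTop)
    [NeBot F] : StageClass.{u} (fun S [CommRing S] xs => IsSeqStage p F S xs) where
  reg h := by
    obtain ⟨E⟩ := h
    exact ⟨E.regMod_proj hF, E.ofList_proj_ne_top hF⟩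
  root h f hf hdeg := by
    obtain ⟨E⟩ := h
    exact E.exists_eval₂_eq_zero f hf hdeg
  ann h a l := by
    obtain ⟨E⟩ := h
    refine ⟨E.S F, inferInstance, RingHom.id _, ?_, fun h => or_iff_not_imp_left.2 fun ha => ?_⟩
    · rw [RingHom.coe_id, List.map_id]
      exact ⟨E⟩
    · obtain ⟨γ, h1, h2⟩ := E.exists_almost_annihilator hF ha
      rw [RingHom.coe_id, List.map_id]
      exact ⟨γ, h1, fun b hb j => h2 b (h b hb) j⟩

section EqualCharacteristic

open IsLocalRing

theorem exists_isSeqStage {p : ℕ → ℕ} [∀ n, Fact (p n).Prime] {F : Filter ℕ} (hF : F ≤ atTop)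
    [NeBot F] (k : ℕ → Type u) [∀ n, Field (k n)] [∀ n, CharP (k n) (p n)] {K : Type u} [Field K]
    (θ : K →+* (∀ n, k n) ⧸ nullSeqIdeal F (fun n _ => (⊥ : Ideal (k n)))) (e : ℕ) :
    ∃ (S : Type u) (_ : CommRing S) (φ : MvPowerSeries (Fin e) K →+* S),
      IsSeqStage p F S ((List.ofFn MvPowerSeries.X).map φ) := by
  let h (n : ℕ) : MvPolynomial ℕ (k n) →+* PerfectClosure (MvPolynomial ℕ (k n)) (p n) :=
    PerfectClosure.of _ (p n)
  let x (i : ℕ) : ∀ n, PerfectClosure (MvPolynomial ℕ (k n)) (p n) :=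
    fun n => h n (MvPolynomial.X i)
  have hx : ∀ n, ((List.range e).map x).map (fun x => x n) =
      ((List.range e).map MvPolynomial.X).map (h n) := fun n => by
    rw [List.map_map, List.map_map]
    rfl
  let E : SeqStage.{u} p :=
    { Q := fun n => PerfectClosure (MvPolynomial ℕ (k n)) (p n)
      xs := (List.range e).map x
      reg := fun n => by
        rw [hx]
        exact regMod_of_isPRadical (p := p n) _ (regMod_X _ _).1
      proper := fun n => by
        rw [hx]
        exact ofList_ne_top_of_isPRadical (p n) _ (regMod_X _ _).2 }
  let ι : (∀ n, k n) →+* ∀ n, E.Q n :=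
    RingHom.pi fun n => ((h n).comp MvPolynomial.C).comp (Pi.evalRingHom k n)
  have hι : ∀ u ∈ nullSeqIdeal F (fun n _ => (⊥ : Ideal (k n))), (E.proj F).comp ι u = 0 := by
    intro u hu
    refine E.proj_eq_zero.2 fun N => (hu N).mono fun n hn => ?_
    have : ι u n = 0 := by
      change h n (MvPolynomial.C (u n)) = 0
      rw [Ideal.mem_bot.1 hn, map_zero, map_zero]
    rw [this]
    exact zero_mem _
  have := E.isAdicComplete hF
  have hmem : ∀ i : Fin e, E.proj F (x i) ∈ Ideal.ofList (E.xs.map (E.proj F)) := fun i =>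
    Ideal.subset_span (List.mem_map_of_mem (List.mem_map_of_mem (List.mem_range.2 i.2)))
  obtain ⟨φ, -, hφ⟩ := exists_eval_of_isAdicComplete ((Ideal.Quotient.lift _ _ hι).comp θ)
    (fun i : Fin e => E.proj F (x i)) _ hmem
  refine ⟨E.S F, inferInstance, φ, ?_⟩
  have : (List.ofFn MvPowerSeries.X).map φ = E.xs.map (E.proj F) := by
    rw [List.map_ofFn]
    refine (congrArg List.ofFn (funext hφ)).trans ?_
    change _ = ((List.range e).map x).map (E.proj F)
    rw [List.ofFn_eq_map, ← List.map_coe_finRange_eq_range, List.map_map, List.map_map]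
    rfl
  rw [this]
  exact ⟨E⟩

theorem exists_regMod_of_coefficientField {p : ℕ → ℕ} [∀ n, Fact (p n).Prime] {F : Filter ℕ}
    (hF : F ≤ atTop) [NeBot F] (k : ℕ → Type u) [∀ n, Field (k n)] [∀ n, CharP (k n) (p n)]
    {K : Type u} [Field K]
    (θ : K →+* (∀ n, k n) ⧸ nullSeqIdeal F (fun n _ => (⊥ : Ideal (k n))))
    {C : Type u} [CommRing C] [IsLocalRing C] (hC : (maximalIdeal C).FG)
    [IsAdicComplete (maximalIdeal C) C] (σ : K →+* C) (hσ : ∀ c, ∃ v, c - σ v ∈ maximalIdeal C)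
    (ys : List C) (hrad : (Ideal.ofList ys).radical = maximalIdeal C)
    (hdim : IsNoetherianRing C → (ys.length : WithBot ℕ∞) ≤ ringKrullDim C) :
    ∃ (B : Type u) (_ : CommRing B) (g : C →+* B),
      RegMod ⊥ (ys.map g) ∧ Ideal.ofList (ys.map g) ≠ ⊤ := by
  have hys : ∀ y ∈ ys, y ∈ maximalIdeal C := fun y hy => by
    rw [← hrad]
    exact Ideal.le_radical (Ideal.subset_span hy)
  obtain ⟨ψ, hψC, hψX⟩ := exists_eval_of_isAdicComplete σ ys.get (maximalIdeal C)
    fun i => hys _ (ys.get_mem i)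
  have hπ : maximalIdeal K = Ideal.span {0} := by
    rw [Ideal.span_singleton_eq_bot.2 rfl, IsLocalRing.maximalIdeal_eq_bot]
  have : IsPrecomplete (Ideal.span {(0 : K)}) K := by
    rw [Ideal.span_singleton_eq_bot.2 rfl]
    infer_instance
  obtain ⟨S, _, φ, hφ⟩ := exists_isSeqStage hF k θ ys.length
  let ξ : List (MvPowerSeries (Fin ys.length) K) := List.ofFn MvPowerSeries.X
  have hξψ : ξ.map ψ = ys := by
    simp only [ξ, List.map_ofFn]
    refine Eq.trans ?_ (List.ofFn_get ys)
    exact congrArg List.ofFn (funext hψX)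
  have hξ : Ideal.ofList ξ = maximalIdeal (MvPowerSeries (Fin ys.length) K) := by
    rw [← MvPowerSeries.ofList_cons_ofFn_X (0 : K) hπ, map_zero, Ideal.ofList_cons,
      Ideal.span_singleton_eq_bot.2 rfl, bot_sup_eq]
  obtain ⟨B, _, g, hg⟩ := (stageClass_isSeqStage p hF).exists_regMod_of_isAdicComplete (0 : K) hπ ξ
    hξ hC ψ (by rw [hξψ, hrad]) (fun c => by simpa only [hψC] using hσ c)
    (fun hN => by simpa [ξ] using hdim hN) φ hφ
  refine ⟨B, inferInstance, g, ?_⟩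
  rw [← hξψ, List.map_map]
  exact hg

end EqualCharacteristic

section PrimeCharacteristic

open IsLocalRing

theorem exists_coefficientField_of_perfect_residue (p : ℕ) [Fact p.Prime] (C : Type u) [CommRing C]
    [IsLocalRing C] [CharP C p] [IsAdicComplete (maximalIdeal C) C]
    [CharP (C ⧸ maximalIdeal C) p] [PerfectRing (C ⧸ maximalIdeal C) p] :
    ∃ σ : C ⧸ maximalIdeal C →+* C, ∀ c, c - σ (Ideal.Quotient.mk _ c) ∈ maximalIdeal C := by
  let := Ideal.Quotient.field (maximalIdeal C)
  obtain ⟨θ, hθ⟩ := exists_ringHom_witt (p := p) (maximalIdeal C)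
  have hs : Function.Surjective
      (WittVector.constantCoeff : WittVector p (C ⧸ maximalIdeal C) →+* C ⧸ maximalIdeal C) :=
    fun x => ⟨WittVector.teichmuller p x, WittVector.teichmuller_coeff_zero p x⟩
  have hk : RingHom.ker
      (WittVector.constantCoeff : WittVector p (C ⧸ maximalIdeal C) →+* C ⧸ maximalIdeal C) ≤
      RingHom.ker θ := fun w hw => by
    have hw0 : w.coeff 0 = 0 := hw
    obtain ⟨y, rfl⟩ : (p : WittVector p (C ⧸ maximalIdeal C)) ∣ w := by
      rw [← Ideal.mem_span_singleton]
      exact WittVector.mem_span_p_iff_coeff_zero_eq_zero _ |>.2 hw0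
    rw [RingHom.mem_ker, map_mul, map_natCast, CharP.cast_eq_zero, zero_mul]
  refine ⟨RingHom.liftOfSurjective _ hs ⟨θ, hk⟩, fun c => ?_⟩
  have h1 : RingHom.liftOfSurjective _ hs ⟨θ, hk⟩ (Ideal.Quotient.mk _ c) =
      θ (WittVector.teichmuller p (Ideal.Quotient.mk _ c)) := by
    have h2 : WittVector.constantCoeff (WittVector.teichmuller p (Ideal.Quotient.mk _ c)) =
        Ideal.Quotient.mk (maximalIdeal C) c := WittVector.teichmuller_coeff_zero p _
    refine .trans (congrArg _ h2.symm) ?_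
    exact RingHom.liftOfSurjective_comp_apply _ hs _ _
  rw [← Ideal.Quotient.eq, h1, hθ, WittVector.teichmuller_coeff_zero]

theorem exists_regMod_of_charP (R : Type u) [CommRing R] [IsDomain R] [IsNoetherianRing R]
    [IsLocalRing R] (p : ℕ) [Fact p.Prime] [CharP R p] :
    ∃ xs : List R, IsSOP R xs ∧ ∃ (B : Type u) (_ : CommRing B) (f : R →+* B),
      RegMod ⊥ (xs.map f) ∧ Ideal.ofList (xs.map f) ≠ ⊤ := by
  obtain ⟨xs, hsop⟩ := exists_isSOP R
  refine ⟨_, hsop, ?_⟩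
  have hp : (p : R) ∈ maximalIdeal R := by
    rw [CharP.cast_eq_zero]
    exact zero_mem _
  obtain ⟨C, _, _, f, hfg, _, ⟨_, _⟩, hrad, hdim⟩ := exists_complete_perfect_residue R p hp hsop
  have := charP_of_ringHom f p
  obtain ⟨σ, hσ⟩ := exists_coefficientField_of_perfect_residue p C
  let := Ideal.Quotient.field (maximalIdeal C)
  obtain ⟨B, _, g, hg⟩ := exists_regMod_of_coefficientField (p := fun _ => p) (F := atTop) le_rfl
    (fun _ => C ⧸ maximalIdeal C) ((Ideal.Quotient.mk _).comp (Pi.constRingHom ℕ _)) hfg σ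
    (fun c => ⟨_, hσ c⟩) (xs.map f) hrad hdim
  refine ⟨B, inferInstance, g.comp f, ?_⟩
  rw [List.map_map] at hg
  exact hg

end PrimeCharacteristic

section Ultraproduct

variable {F : Ultrafilter ℕ} {k : ℕ → Type u} [∀ n, Field (k n)]

theorem mem_nullSeqIdeal_bot {F : Filter ℕ} {u : ∀ n, k n} :
    u ∈ nullSeqIdeal F (fun n _ => (⊥ : Ideal (k n))) ↔ ∀ᶠ n in F, u n = 0 :=
  ⟨fun h => h 0, fun h _ => h⟩

theorem isMaximal_nullSeqIdeal_bot (F : Ultrafilter ℕ) (k : ℕ → Type u) [∀ n, Field (k n)] :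
    (nullSeqIdeal (F : Filter ℕ) (fun n _ => (⊥ : Ideal (k n)))).IsMaximal := by
  rw [Ideal.isMaximal_iff]
  refine ⟨fun h => ?_, fun J x hJ hx hxJ => ?_⟩
  · obtain ⟨n, hn⟩ := (mem_nullSeqIdeal_bot.1 h).exists
    exact one_ne_zero hn
  · rw [mem_nullSeqIdeal_bot, ← Ultrafilter.eventually_not] at hx
    have h1 : 1 - x⁻¹ * x ∈ J := hJ (mem_nullSeqIdeal_bot.2 (hx.mono fun n hn => by
      simp [inv_mul_cancel₀ hn]))
    have := J.add_mem h1 (J.mul_mem_left x⁻¹ hxJ)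
    rwa [sub_add_cancel] at this

theorem isAlgClosed_of_surjective_pi [∀ n, IsAlgClosed (k n)] {L : Type u} [Field L]
    {g : (∀ n, k n) →+* L} (hg : Function.Surjective g) : IsAlgClosed L := by
  refine .of_exists_root _ fun f hf hirr => ?_
  obtain ⟨q, hq, hdeg, hmon⟩ := Polynomial.lifts_and_natDegree_eq_and_monic
    (Polynomial.map_surjective g hg f) hf
  have hroot : ∀ n, ∃ r, (q.map (Pi.evalRingHom k n)).IsRoot r := fun n => by
    refine IsAlgClosed.exists_root _ ?_
    rw [Polynomial.degree_eq_natDegree (hmon.map _).ne_zero, hmon.natDegree_map, hdeg]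
    exact_mod_cast hirr.natDegree_pos.ne'
  choose r hr using hroot
  refine ⟨g r, ?_⟩
  have h0 : q.eval r = 0 := funext fun n => by
    have := hr n
    rw [Polynomial.IsRoot, Polynomial.eval_map] at this
    rw [Pi.zero_apply, ← this]
    exact Polynomial.hom_eval₂ q (RingHom.id _) (Pi.evalRingHom k n) r
  rw [← hq, Polynomial.eval_map, Polynomial.eval₂_hom, h0, map_zero]

theorem MvPolynomial.eventually_map_ne_zero {σ : Type*} {p : ℕ → ℕ} (hp : Tendsto p atTop atTop)
    {a : MvPolynomial σ ℤ} (ha : a ≠ 0) :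
    ∀ᶠ n in atTop, MvPolynomial.map (Int.castRingHom (ZMod (p n))) a ≠ 0 := by
  obtain ⟨d, hd⟩ := MvPolynomial.ne_zero_iff.1 ha
  filter_upwards [hp.eventually_gt_atTop (a.coeff d).natAbs] with n hn h0
  have h1 := congrArg (MvPolynomial.coeff d) h0
  rw [MvPolynomial.coeff_map, MvPolynomial.coeff_zero, eq_intCast,
    ZMod.intCast_zmod_eq_zero_iff_dvd] at h1
  exact hd (Int.eq_zero_of_dvd_of_natAbs_lt_natAbs h1 (by simpa using hn))

theorem IsTranscendenceBasis.nonempty_ringHom {K L : Type*} [Field K] [Field L] [IsAlgClosed L]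
    {s : Type*} {x : s → K} (hx : IsTranscendenceBasis ℤ x) {j : MvPolynomial s ℤ →+* L}
    (hj : Function.Injective j) : Nonempty (K →+* L) := by
  let := j.toAlgebra
  let j' : MvPolynomial s ℤ →ₐ[ℤ] K := MvPolynomial.aeval x
  have hj' : Function.Injective j' := hx.1
  let := j'.toRingHom.toAlgebra
  have h1 : FaithfulSMul (MvPolynomial s ℤ) K :=
    (faithfulSMul_iff_algebraMap_injective _ K).2 hj'
  have h2 : FaithfulSMul (MvPolynomial s ℤ) L :=
    (faithfulSMul_iff_algebraMap_injective _ L).2 hj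
  have h3 : Algebra.IsAlgebraic (MvPolynomial s ℤ) K := by
    have := hx.isAlgebraic
    refine Algebra.IsAlgebraic.of_ringHom_of_comp_eq
      (hx.1.aevalEquiv : MvPolynomial s ℤ ≃ₐ[ℤ] _).toRingEquiv.toRingHom (RingHom.id K)
      (hx.1.aevalEquiv : MvPolynomial s ℤ ≃ₐ[ℤ] _).surjective Function.injective_id ?_
    exact RingHom.ext fun a => hx.1.algebraMap_aevalEquiv a
  exact ⟨(IsAlgClosed.lift : K →ₐ[MvPolynomial s ℤ] L).toRingHom⟩

theorem exists_ringHom_ultraproduct (K : Type u) [Field K] [CharZero K] :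
    ∃ (p : ℕ → ℕ) (_ : ∀ n, Fact (p n).Prime) (F : Filter ℕ) (k : ℕ → Type u)
      (_ : ∀ n, Field (k n)), F ≤ atTop ∧ NeBot F ∧ (∀ n, CharP (k n) (p n)) ∧
      Nonempty (K →+* (∀ n, k n) ⧸ nullSeqIdeal F (fun n _ => (⊥ : Ideal (k n)))) := by
  obtain ⟨s, hs⟩ := exists_isTranscendenceBasis ℤ K
  let p := Nat.nth Nat.Prime
  have hprime : ∀ n, Fact (p n).Prime := fun n => ⟨Nat.prime_nth_prime n⟩
  have hp : Tendsto p atTop atTop :=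
    (Nat.nth_strictMono Nat.infinite_setOfPred_prime).tendsto_atTop
  let A := MvPolynomial s ℤ
  let k (n : ℕ) : Type u := AlgebraicClosure (FractionRing (MvPolynomial s (ZMod (p n))))
  let i (n : ℕ) : MvPolynomial s (ZMod (p n)) →+* k n :=
    (algebraMap _ (k n)).comp (algebraMap _ (FractionRing (MvPolynomial s (ZMod (p n)))))
  have hi : ∀ n, Function.Injective (i n) := fun n =>
    (algebraMap (FractionRing (MvPolynomial s (ZMod (p n)))) (k n)).injective.comp
      (IsFractionRing.injective (MvPolynomial s (ZMod (p n))) _)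
  have hchar : ∀ n, CharP (k n) (p n) := fun n =>
    charP_of_ringHom ((i n).comp MvPolynomial.C) (p n)
  let F : Ultrafilter ℕ := hyperfilter ℕ
  have hF : (F : Filter ℕ) ≤ atTop := Nat.hyperfilter_le_atTop
  let I := nullSeqIdeal (F : Filter ℕ) (fun n _ => (⊥ : Ideal (k n)))
  have : I.IsMaximal := isMaximal_nullSeqIdeal_bot F k
  let := Ideal.Quotient.field I
  have : IsAlgClosed ((∀ n, k n) ⧸ I) :=
    isAlgClosed_of_surjective_pi (Ideal.Quotient.mk_surjective (I := I))
  let j : A →+* (∀ n, k n) ⧸ I := (Ideal.Quotient.mk I).comp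
    (RingHom.pi fun n => (i n).comp (MvPolynomial.map (Int.castRingHom (ZMod (p n)))))
  have hj : Function.Injective j := by
    refine (injective_iff_map_eq_zero j).2 fun a ha => by_contra fun h0 => ?_
    have h1 := mem_nullSeqIdeal_bot.1 (Ideal.Quotient.eq_zero_iff_mem.1 ha)
    obtain ⟨n, hn, hn'⟩ := (h1.and (hF (MvPolynomial.eventually_map_ne_zero hp h0))).exists
    exact hn' (hi n (hn.trans (map_zero _).symm))
  refine ⟨p, hprime, F, k, inferInstance, hF, inferInstance, hchar, ?_⟩
  exact hs.nonempty_ringHom hj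

end Ultraproduct

section CharacteristicZero

open IsLocalRing

theorem Algebra.FormallySmooth.of_charZero (k K : Type*) [Field k] [CharZero k] [Field K]
    [Algebra k K] : Algebra.FormallySmooth k K := by
  obtain ⟨s, hs⟩ := exists_isTranscendenceBasis k K
  have := hs.isAlgebraic_field
  exact .of_algebraicIndependent_of_isSeparable hs.1

theorem exists_regMod_of_charZero_residue (R : Type u) [CommRing R] [IsNoetherianRing R]
    [IsLocalRing R] [IsAdicComplete (maximalIdeal R) R] [CharZero (ResidueField R)] :
    ∃ xs : List R, IsSOP R xs ∧ ∃ (B : Type u) (_ : CommRing B) (f : R →+* B),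
      RegMod ⊥ (xs.map f) ∧ Ideal.ofList (xs.map f) ≠ ⊤ := by
  obtain ⟨xs, hsop⟩ := exists_isSOP R
  refine ⟨_, hsop, ?_⟩
  obtain ⟨-, hlen, hrad⟩ := hsop
  have : CharZero (R ⧸ maximalIdeal R) := inferInstanceAs (CharZero (ResidueField R))
  obtain ⟨_⟩ : Nonempty (Algebra ℚ R) := EqualCharZero.nonempty_algebraRat_iff R |>.2 fun I hI =>
    (Ideal.Quotient.factor (le_maximalIdeal hI)).charZero
  have := Algebra.FormallySmooth.of_charZero ℚ (ResidueField R)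
  let ι : ResidueField R →+* R ⧸ maximalIdeal R := RingHom.id _
  obtain ⟨σ, hσ⟩ := Algebra.FormallySmooth.exists_mkₐ_comp_eq_of_isAdicComplete
    (I := maximalIdeal R) ι.toRatAlgHom
  obtain ⟨p, _, F, k, _, hF, _, _, ⟨θ⟩⟩ := exists_ringHom_ultraproduct (ResidueField R)
  obtain ⟨B, _, g, hg⟩ := exists_regMod_of_coefficientField hF k θ
    (maximalIdeal R).fg_of_isNoetherianRing σ.toRingHom
    (fun c => ⟨residue R c, Ideal.Quotient.eq.1 (AlgHom.congr_fun hσ (residue R c)).symm⟩) xs hrad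
    fun _ => hlen.le
  exact ⟨B, inferInstance, g, hg⟩

end CharacteristicZero

theorem IsPrecomplete.map_of_surjective {A D : Type*} [CommRing A] [CommRing D] (I : Ideal A)
    [IsPrecomplete I A] {π : A →+* D} (hπ : Function.Surjective π) :
    IsPrecomplete (I.map π) D := by
  refine IsPrecomplete.of_exists_lim _ fun f hf => ?_
  have h1 : ∀ n, ∃ d ∈ I ^ n, π d = f (n + 1) - f n := fun n => by
    have := hf n
    rwa [← Ideal.map_pow, Ideal.mem_map_iff_of_surjective _ hπ] at this
  choose d hd hdf using h1
  obtain ⟨a, ha⟩ := hπ (f 0)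
  obtain ⟨L, hL⟩ := IsPrecomplete.exists_lim I (fun n => a + ∑ i ∈ Finset.range n, d i)
    fun n => by simpa [Finset.sum_range_succ] using hd n
  refine ⟨π L, fun n => ?_⟩
  have h2 : f n = π (a + ∑ i ∈ Finset.range n, d i) := by
    rw [map_add, map_sum, ha, Finset.sum_congr rfl fun i _ => hdf i, Finset.sum_range_sub]
    ring
  rw [h2, ← map_sub, ← Ideal.map_pow]
  exact Ideal.mem_map_of_mem _ (hL n)

theorem IsBalancedBigCM.comp_quotient {R B : Type*} [CommRing R] [IsLocalRing R] (P : Ideal R)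
    [P.IsPrime] [IsLocalRing (R ⧸ P)] (hdim : ringKrullDim (R ⧸ P) = ringKrullDim R) [CommRing B]
    [Algebra (R ⧸ P) B] (h : IsBalancedBigCM (R ⧸ P) B) :
    letI := ((algebraMap (R ⧸ P) B).comp (Ideal.Quotient.mk P)).toAlgebra
    IsBalancedBigCM R B := by
  let := ((algebraMap (R ⧸ P) B).comp (Ideal.Quotient.mk P)).toAlgebra
  have : IsScalarTower R (R ⧸ P) B := .of_algebraMap_eq' rfl
  exact h.of_quotient P hdim

section Assembly

open IsLocalRing

theorem exists_regMod_of_isDomain (R : Type u) [CommRing R] [IsDomain R] [IsNoetherianRing R]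
    [IsLocalRing R] [IsAdicComplete (maximalIdeal R) R] :
    ∃ xs : List R, IsSOP R xs ∧ ∃ (B : Type u) (_ : CommRing B) (f : R →+* B),
      RegMod ⊥ (xs.map f) ∧ Ideal.ofList (xs.map f) ≠ ⊤ := by
  obtain ⟨p, hp⟩ := CharP.exists (ResidueField R)
  obtain hprime | rfl := CharP.char_is_prime_or_zero (ResidueField R) p
  · have : Fact p.Prime := ⟨hprime⟩
    by_cases h0 : (p : R) = 0
    · have := (CharP.charP_iff_prime_eq_zero hprime).2 h0
      exact exists_regMod_of_charP R p
    · refine exists_regMod_of_mixedChar R p h0 ?_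
      rw [← residue_eq_zero_iff, map_natCast, CharP.cast_eq_zero]
  · have := CharP.charP_to_charZero (ResidueField R)
    exact exists_regMod_of_charZero_residue R

end Assembly

end BigCohenMacaulay

/-- Every complete Noetherian local ring admits a balanced big Cohen-Macaulay algebra. -/
theorem exists_balanced_bigCM (R : Type u) [CommRing R] [IsNoetherianRing R] [IsLocalRing R]
    (hcomplete : IsAdicComplete (IsLocalRing.maximalIdeal R) R) :
    ∃ (B : Type u) (_ : CommRing B) (_ : Algebra R B), IsBalancedBigCM R B := by
  obtain ⟨P, _, hdim⟩ := exists_prime_ringKrullDim_quotient_eq R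
  have hs : Function.Surjective (Ideal.Quotient.mk P) := Ideal.Quotient.mk_surjective
  have : IsLocalRing (R ⧸ P) := .of_surjective' _ hs
  have : IsLocalHom (Ideal.Quotient.mk P) := .of_surjective _ hs
  have : IsAdicComplete (IsLocalRing.maximalIdeal (R ⧸ P)) (R ⧸ P) :=
    { toIsHausdorff := inferInstance
      toIsPrecomplete := by
        rw [← Ideal.map_comap_of_surjective _ hs (IsLocalRing.maximalIdeal (R ⧸ P)),
          IsLocalRing.maximalIdeal_comap (Ideal.Quotient.mk P)]
        exact IsPrecomplete.map_of_surjective _ hs }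
  obtain ⟨xs, hxs, B, _, f, hr, hp⟩ := exists_regMod_of_isDomain (R ⧸ P)
  let := f.toAlgebra
  have hB := exists_balanced_of_regMod hxs hr hp
  exact ⟨_, inferInstance, _, hB.comp_quotient P hdim⟩
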